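/- Let U ∈ 𝒰 be such that the restriction of U to (0,π] is twice continuously differentiable with U'(π) = 0, U(t)/t = o(log h_U(t)) as t → 0⁺, and there is C₀ > 0 with t·U'(t) ≤ C₀·U(t) and t²·|U''(t)| ≤ C₀·U(t) for all 0 < t ≤ π/2. Define γ_U(t) = (∫_t^1 h_U(x)/U(x) dx)·(log h_U(t) − log h_U(1)) for t ∈ (0,1]; γ_U is continuous, strictly decreasing and tends to +∞ as t → 0⁺, and for y ≥ 0 let γ_U^{−1}(y) denote the unique point of (0,1] with γ_U(γ_U^{−1}(y)) = y. Let T = C_{φ_U}. Then there exist positive constants c, C, c₁, C₁ and N such that for all n ≥ N: c₁·(h_U(e^{−√n}))^{−(1/2 + c·n/γ_U(e^{−√n}))} ≤ a_n(T) ≤ C₁·(h_U(γ_U^{−1}(C·n)))^{−1/2}. -/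

import Mathlib

open Complex MeasureTheory Filter Set

noncomputable section

abbrev H2 : Type := lp (fun _ : ℕ => ℂ) 2

noncomputable def fa (a : H2) (z : ℂ) : ℂ := ∑' k : ℕ, a k * z ^ k

noncomputable def approxNum (T : H2 →L[ℂ] H2) (n : ℕ) : ℝ :=
  sInf {c : ℝ | ∃ R : H2 →L[ℂ] H2,
    FiniteDimensional ℂ (LinearMap.range R.toLinearMap) ∧
    Module.finrank ℂ (LinearMap.range R.toLinearMap) ≤ n - 1 ∧ c = ‖T - R‖}

noncomputable def hU (U : ℝ → ℝ) (t : ℝ) : ℝ := ∫ x in t..Real.pi, U x / x ^ 2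

def ClassU (U : ℝ → ℝ) : Prop :=
  Continuous U ∧ (∀ t, U (-t) = U t) ∧ Function.Periodic U (2 * Real.pi) ∧
  U 0 = 0 ∧ MonotoneOn U (Set.Icc 0 Real.pi) ∧
  (∀ t, 0 < t → t ≤ Real.pi → 0 < U t) ∧
  Tendsto (fun t => hU U t) (nhdsWithin 0 (Set.Ioi 0)) atTop

noncomputable def poisson (U : ℝ → ℝ) (r θ : ℝ) : ℝ :=
  ((1 - r ^ 2) / (2 * Real.pi)) *
    ∫ x in (-Real.pi)..Real.pi, U x / (1 - 2 * r * Real.cos (θ - x) + r ^ 2)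

/-- `γ_U(t) = (∫_t^1 h_U(x)/U(x) dx)·(log h_U(t) − log h_U(1))`. -/
noncomputable def gammaU (U : ℝ → ℝ) (t : ℝ) : ℝ :=
  (∫ x in t..(1 : ℝ), hU U x / U x) * (Real.log (hU U t) - Real.log (hU U 1))

/-- reproducing kernel -/
lemma memlp_ker (z : ℂ) (hz : ‖z‖ < 1) :
    Memℓp (E := fun _ : ℕ => ℂ) (fun k : ℕ => (starRingEnd ℂ) z ^ k) 2 := by
  rw [memℓp_gen_iff (by norm_num)]
  have : Summable (fun i : ℕ => (‖z‖ ^ 2) ^ i) :=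
    summable_geometric_of_lt_one (by positivity) (by nlinarith [norm_nonneg z])
  refine this.congr fun i => ?_
  simp [← pow_mul, mul_comm]

def kerZ (z : ℂ) : H2 :=
  if hz : ‖z‖ < 1 then ⟨fun k : ℕ => (starRingEnd ℂ) z ^ k, memlp_ker z hz⟩ else 0

lemma kerZ_apply {z : ℂ} (hz : ‖z‖ < 1) (k : ℕ) : kerZ z k = (starRingEnd ℂ) z ^ k := by
  simp [kerZ, hz]

lemma fa_eq_inner (a : H2) {z : ℂ} (hz : ‖z‖ < 1) : fa a z = inner ℂ (kerZ z) a := by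
  rw [lp.inner_eq_tsum, fa]
  congr 1
  ext k
  rw [kerZ_apply hz]
  simp [RCLike.inner_apply]

lemma fa_hasSum (a : H2) {z : ℂ} (hz : ‖z‖ < 1) : HasSum (fun k => a k * z ^ k) (fa a z) := by
  rw [fa_eq_inner a hz]
  refine (lp.hasSum_inner (kerZ z) a).congr_fun fun k => ?_
  rw [kerZ_apply hz]
  simp [RCLike.inner_apply]

lemma inner_kerZ {z w : ℂ} (hz : ‖z‖ < 1) (hw : ‖w‖ < 1) :
    inner ℂ (kerZ z) (kerZ w) = (1 - (starRingEnd ℂ) w * z)⁻¹ := by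
  rw [← fa_eq_inner _ hz, fa]
  rw [← tsum_geometric_of_norm_lt_one]
  · congr 1
    ext k
    rw [kerZ_apply hw, mul_pow]
  · rw [norm_mul, RCLike.norm_conj]
    nlinarith [norm_nonneg z, norm_nonneg w]

/-- adjoint on kernels -/
lemma adjoint_ker (T : H2 →L[ℂ] H2) {z : ℂ} (hz : ‖z‖ < 1) {w : ℂ} (hw : ‖w‖ < 1) {b : ℂ}
    (h : ∀ a, fa (T a) z = b * fa a w) :
    ContinuousLinearMap.adjoint T (kerZ z) = (starRingEnd ℂ) b • kerZ w := by
  refine ext_inner_right ℂ fun a => ?_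
  rw [ContinuousLinearMap.adjoint_inner_left, ← fa_eq_inner _ hz, h, inner_smul_left,
    fa_eq_inner _ hw]
  simp

/-- shift -/
lemma memlp_shift (a : H2) :
    Memℓp (E := fun _ : ℕ => ℂ) (fun k : ℕ => match k with | 0 => (0:ℂ) | k+1 => a k) 2 := by
  rw [memℓp_gen_iff (by norm_num)]
  rw [← summable_nat_add_iff 1]
  have := (memℓp_gen_iff (p := 2) (by norm_num)).1 (lp.memℓp a)
  exact this

def shiftFun (a : H2) : H2 := ⟨fun k : ℕ => match k with | 0 => (0:ℂ) | k+1 => a k, memlp_shift a⟩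

lemma shiftFun_zero (a : H2) : shiftFun a 0 = 0 := rfl
lemma shiftFun_succ (a : H2) (k : ℕ) : shiftFun a (k+1) = a k := rfl

lemma norm_sq_eq (a : H2) : HasSum (fun k => ‖a k‖ ^ 2) (‖a‖ ^ 2) := by
  have := lp.hasSum_norm (p := 2) (by norm_num) a
  simpa using this

lemma shiftFun_norm (a : H2) : ‖shiftFun a‖ = ‖a‖ := by
  have h1 := norm_sq_eq (shiftFun a)
  have h2 := norm_sq_eq a
  rw [← hasSum_nat_add_iff' 1] at h1
  simp [shiftFun_succ, shiftFun_zero] at h1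
  have := h1.unique h2
  exact (pow_left_inj₀ (norm_nonneg _) (norm_nonneg _) two_ne_zero).1 this

def shiftI : H2 →ₗᵢ[ℂ] H2 where
  toFun := shiftFun
  map_add' a b := by
    ext k
    cases k
    · simp [shiftFun_zero]
    · simp [shiftFun_succ]
  map_smul' c a := by
    ext k
    cases k
    · simp [shiftFun_zero]
    · simp [shiftFun_succ]
  norm_map' := shiftFun_norm

def Sh : H2 →L[ℂ] H2 := shiftI.toContinuousLinearMap

lemma Sh_zero (a : H2) : Sh a 0 = 0 := rfl
lemma Sh_succ (a : H2) (k : ℕ) : Sh a (k+1) = a k := rfl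
lemma Sh_inner (a b : H2) : inner ℂ (Sh a) (Sh b) = inner ℂ a b := shiftI.inner_map_map a b
lemma Sh_norm (a : H2) : ‖Sh a‖ = ‖a‖ := shiftFun_norm a

lemma fa_Sh (a : H2) {z : ℂ} (hz : ‖z‖ < 1) : fa (Sh a) z = z * fa a z := by
  have h1 := fa_hasSum (Sh a) hz
  have h2 := (fa_hasSum a hz).mul_left z
  rw [← hasSum_nat_add_iff' 1] at h1
  simp [Sh_zero, Sh_succ] at h1
  refine h1.unique (h2.congr_fun ?_)
  intro k
  ring

lemma fa_add (a b : H2) {z : ℂ} (hz : ‖z‖ < 1) : fa (a + b) z = fa a z + fa b z := by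
  simp only [fa_eq_inner _ hz, inner_add_right]
lemma fa_sub (a b : H2) {z : ℂ} (hz : ‖z‖ < 1) : fa (a - b) z = fa a z - fa b z := by
  simp only [fa_eq_inner _ hz, inner_sub_right]
lemma fa_smul (c : ℂ) (a : H2) {z : ℂ} (hz : ‖z‖ < 1) : fa (c • a) z = c * fa a z := by
  simp only [fa_eq_inner _ hz, inner_smul_right]

/-- key identity for isometries -/
lemma Sh_swap (a b : ℂ) (u v : H2) :
    inner ℂ (Sh u - a • u) (Sh v - b • v) =
      inner ℂ (u - (starRingEnd ℂ) b • Sh u) (v - (starRingEnd ℂ) a • Sh v) := by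
  simp only [inner_sub_left, inner_sub_right, inner_smul_left, inner_smul_right, Sh_inner]
  simp
  ring

lemma oneSub_surj {a : ℂ} (ha : ‖a‖ < 1) : ∃ Q : H2 →L[ℂ] H2,
    (∀ x, Q x - (starRingEnd ℂ) a • Sh (Q x) = x) ∧
    (∀ x, Q (x - (starRingEnd ℂ) a • Sh x) = x) := by
  have hn : ‖(starRingEnd ℂ) a • Sh‖ < 1 := by
    rw [norm_smul]
    have : ‖Sh‖ ≤ 1 := shiftI.norm_toContinuousLinearMap_le
    rw [RCLike.norm_conj]
    nlinarith [norm_nonneg a]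
  let u := Units.oneSub ((starRingEnd ℂ) a • Sh) hn
  refine ⟨(↑u⁻¹ : H2 →L[ℂ] H2), fun x => ?_, fun x => ?_⟩
  · have := congrArg (fun f : H2 →L[ℂ] H2 => f x) u.mul_inv
    simpa [u] using this
  · have := congrArg (fun f : H2 →L[ℂ] H2 => f x) u.inv_mul
    simpa [u] using this

def bl (a z : ℂ) : ℂ := (z - a) / (1 - (starRingEnd ℂ) a * z)

lemma one_sub_conj_mul_ne {a z : ℂ} (ha : ‖a‖ < 1) (hz : ‖z‖ < 1) :
    1 - (starRingEnd ℂ) a * z ≠ 0 := by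
  intro h
  have h1 : (starRingEnd ℂ) a * z = 1 := by linear_combination -h
  have h2 : ‖a‖ * ‖z‖ = 1 := by
    have := congrArg norm h1
    simpa using this
  nlinarith [norm_nonneg a, norm_nonneg z]

def RankLE (R : H2 →L[ℂ] H2) (N : ℕ) : Prop :=
  ∃ W : Submodule ℂ H2, FiniteDimensional ℂ W ∧ Module.finrank ℂ W ≤ N ∧ ∀ x, R x ∈ W

lemma exists_V {a : ℂ} (ha : ‖a‖ < 1) : ∃ V W : H2 →L[ℂ] H2,
    (∀ x, ‖V x‖ = ‖x‖) ∧ (∀ x, ‖W x‖ ≤ ‖x‖) ∧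
    (∀ x z, ‖z‖ < 1 → fa (V x) z = bl a z * fa x z) ∧
    RankLE (1 - V * W) 1 := by
  obtain ⟨Q, hQ1, hQ2⟩ := oneSub_surj ha
  let V : H2 →L[ℂ] H2 := (Sh - a • (1 : H2 →L[ℂ] H2)) * Q
  have hV : ∀ x, V x = Sh (Q x) - a • Q x := fun x => by simp [V]
  have hinner : ∀ x y, inner ℂ (V x) (V y) = inner ℂ x y := by
    intro x y
    rw [hV, hV, Sh_swap, hQ1, hQ1]
  have hnorm : ∀ x, ‖V x‖ = ‖x‖ := by
    intro x
    have h1 := hinner x x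
    rw [inner_self_eq_norm_sq_to_K, inner_self_eq_norm_sq_to_K] at h1
    have h2 : ‖V x‖ ^ 2 = ‖x‖ ^ 2 := by exact_mod_cast h1
    exact (pow_left_inj₀ (norm_nonneg _) (norm_nonneg _) two_ne_zero).1 h2
  let W := ContinuousLinearMap.adjoint V
  have hVn : ‖V‖ ≤ 1 := V.opNorm_le_bound zero_le_one (fun x => by rw [hnorm, one_mul])
  have hWV : ∀ x, W (V x) = x := by
    intro x
    refine ext_inner_left ℂ fun y => ?_
    rw [ContinuousLinearMap.adjoint_inner_right, hinner]
  refine ⟨V, W, hnorm, fun x => ?_, fun x z hz => ?_, ?_⟩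
  · have : ‖W‖ ≤ 1 := by
      rw [show ‖W‖ = ‖V‖ from LinearIsometryEquiv.norm_map _ _]; exact hVn
    calc ‖W x‖ ≤ ‖W‖ * ‖x‖ := W.le_opNorm x
      _ ≤ 1 * ‖x‖ := by gcongr
      _ = ‖x‖ := one_mul _
  · have h1 : fa x z = (1 - (starRingEnd ℂ) a * z) * fa (Q x) z := by
      conv_lhs => rw [← hQ1 x]
      rw [fa_sub _ _ hz, fa_smul _ _ hz, fa_Sh _ hz]; ring
    rw [hV, fa_sub _ _ hz, fa_smul _ _ hz, fa_Sh _ hz, h1, bl]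
    have hne := one_sub_conj_mul_ne ha hz
    rw [div_mul_eq_mul_div, eq_div_iff hne]
    ring
  · refine ⟨Submodule.span ℂ {kerZ a}, inferInstance, ?_, fun x => ?_⟩
    · exact (finrank_span_le_card _).trans (by simp)
    · set y : H2 := (1 - V * W) x with hy
      have hy0 : W y = 0 := by
        simp [hy, hWV]
      have horth : ∀ v, inner ℂ y (Sh v - a • v) = 0 := by
        intro v
        have : Sh v - a • v = V (v - (starRingEnd ℂ) a • Sh v) := by rw [hV, hQ2]
        rw [this, ← ContinuousLinearMap.adjoint_inner_left]
        change inner ℂ (W y) _ = 0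
        rw [hy0, inner_zero_left]
      have hrec : ∀ k, y (k+1) = (starRingEnd ℂ) a * y k := by
        intro k
        have h1 := horth (lp.single 2 k (1:ℂ))
        have h2 : Sh (lp.single 2 k (1:ℂ)) = lp.single 2 (k+1) (1:ℂ) := by
          ext j
          cases j with
          | zero => simp [Sh_zero, lp.single_apply, Pi.single_apply]
          | succ j => simp [Sh_succ, lp.single_apply, Pi.single_apply]
        rw [h2, inner_sub_right, inner_smul_right, lp.inner_single_right, lp.inner_single_right] at h1
        simp [RCLike.inner_apply] at h1
        have h3 := congrArg (starRingEnd ℂ) h1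
        simp at h3
        linear_combination h3
      rw [Submodule.mem_span_singleton]
      refine ⟨y 0, ?_⟩
      ext k
      have : ∀ k, y k = y 0 * (starRingEnd ℂ) a ^ k := by
        intro k
        induction k with
        | zero => simp
        | succ k ih => rw [hrec, ih]; ring
      rw [this k]
      simp [kerZ_apply ha]

lemma exists_V_list (l : List ℂ) (hl : ∀ a ∈ l, ‖a‖ < 1) : ∃ V W : H2 →L[ℂ] H2,
    (∀ x, ‖V x‖ = ‖x‖) ∧ (∀ x, ‖W x‖ ≤ ‖x‖) ∧
    (∀ x z, ‖z‖ < 1 → fa (V x) z = (l.map (fun a => bl a z)).prod * fa x z) ∧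
    RankLE (1 - V * W) l.length := by
  induction l with
  | nil =>
    refine ⟨1, 1, by simp, by simp, by simp, ⊥, inferInstance, by simp, by simp⟩
  | cons a l ih =>
    obtain ⟨V, W, h1, h2, h3, X, hX, hXf, hXm⟩ := ih (fun b hb => hl b (by simp [hb]))
    obtain ⟨V', W', h1', h2', h3', X', hX', hXf', hXm'⟩ := exists_V (hl a (by simp))
    refine ⟨V' * V, W * W', fun x => by simp [h1, h1'], fun x => (h2 _).trans (h2' _), ?_,
      X' ⊔ X.map V'.toLinearMap, inferInstance, ?_, fun x => ?_⟩
    · intro x z hz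
      simp [h3' _ _ hz, h3 _ _ hz, mul_assoc]
    · have := Submodule.finrank_add_le_finrank_add_finrank X' (X.map V'.toLinearMap)
      have h4 := Submodule.finrank_map_le V'.toLinearMap X
      simp only [List.length_cons]
      omega
    · have e : (1 - V' * V * (W * W')) x = (1 - V' * W') x + V' ((1 - V * W) (W' x)) := by
        simp
      rw [e]
      refine Submodule.add_mem_sup (hXm' x) ?_
      exact Submodule.mem_map_of_mem (hXm _)

lemma approxNum_nonneg (T : H2 →L[ℂ] H2) (n : ℕ) : 0 ≤ approxNum T n := by
  refine Real.sInf_nonneg ?_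
  rintro c ⟨R, -, -, rfl⟩
  exact norm_nonneg _

lemma approxNum_le_of_rank (T R : H2 →L[ℂ] H2) (n : ℕ) (hR : RankLE R (n - 1)) :
    approxNum T n ≤ ‖T - R‖ := by
  obtain ⟨W, hW, hWf, hm⟩ := hR
  have hle : LinearMap.range R.toLinearMap ≤ W := by
    rintro _ ⟨x, rfl⟩; exact hm x
  refine csInf_le ⟨0, ?_⟩ ⟨R, ?_, ?_, rfl⟩
  · rintro c ⟨R, -, -, rfl⟩
    exact norm_nonneg _
  · exact Submodule.finiteDimensional_of_le hle
  · exact (Submodule.finrank_mono hle).trans hWf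

lemma approxNum_le_blaschke (T : H2 →L[ℂ] H2) (n : ℕ) (l : List ℂ) (hl : ∀ a ∈ l, ‖a‖ < 1)
    (hn : l.length ≤ n - 1) (K : ℝ) (hK : 0 ≤ K)
    (h : ∀ y x : H2, (∀ z, ‖z‖ < 1 → fa y z = (l.map (fun a => bl a z)).prod * fa x z) →
      ‖T y‖ ≤ K * ‖x‖) :
    approxNum T n ≤ K := by
  obtain ⟨V, W, h1, h2, h3, X, hX, hXf, hXm⟩ := exists_V_list l hl
  refine (approxNum_le_of_rank T (T * (1 - V * W)) n
    ⟨X.map T.toLinearMap, inferInstance, ?_, fun x => Submodule.mem_map_of_mem (hXm x)⟩).trans ?_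
  · exact ((Submodule.finrank_map_le _ _).trans hXf).trans hn
  · refine ContinuousLinearMap.opNorm_le_bound _ hK fun x => ?_
    have : (T - T * (1 - V * W)) x = T (V (W x)) := by simp
    rw [this]
    refine (h _ _ (h3 (W x))).trans ?_
    gcongr
    exact h2 x

lemma le_approxNum (T : H2 →L[ℂ] H2) (n : ℕ) (hn : 1 ≤ n) (v : Fin n → H2) (s : ℝ) (hs : 0 < s)
    (A : ℝ) (hA : 0 < A)
    (hup : ∀ c : Fin n → ℂ, ‖∑ i, c i • v i‖ ≤ A * Real.sqrt (∑ i, ‖c i‖ ^ 2))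
    (hlow : ∀ c : Fin n → ℂ, s * Real.sqrt (∑ i, ‖c i‖ ^ 2) ≤
      ‖∑ i, c i • ContinuousLinearMap.adjoint T (v i)‖) :
    s / A ≤ approxNum T n := by
  refine le_csInf ⟨‖T - 0‖, 0, ?_, ?_, rfl⟩ ?_
  · have : LinearMap.range (0 : H2 →L[ℂ] H2).toLinearMap = ⊥ := by simp
    rw [this]; infer_instance
  · have : LinearMap.range (0 : H2 →L[ℂ] H2).toLinearMap = ⊥ := by simp
    rw [this]; simp
  · rintro _ ⟨R, hfd, hfr, rfl⟩
    let X := LinearMap.range R.toLinearMap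
    have : FiniteDimensional ℂ X := hfd
    let g : (Fin n → ℂ) →ₗ[ℂ] X := X.orthogonalProjectionOnto.toLinearMap ∘ₗ (Fintype.linearCombination ℂ v)
    have hker : ∃ c, c ≠ 0 ∧ g c = 0 := by
      have : ¬ Function.Injective g := by
        intro hinj
        have := LinearMap.finrank_le_finrank_of_injective hinj
        simp at this
        change n ≤ Module.finrank ℂ (LinearMap.range R.toLinearMap) at this
        omega
      rw [← LinearMap.ker_eq_bot, ← ne_eq, Submodule.ne_bot_iff] at this
      obtain ⟨c, h1, h2⟩ := this
      exact ⟨c, h2, h1⟩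
    obtain ⟨c, hc, hg⟩ := hker
    set x := ∑ i, c i • v i with hx
    have hgx : X.orthogonalProjectionOnto x = 0 := by
      have : g c = X.orthogonalProjectionOnto x := by
        simp [g, hx, Fintype.linearCombination_apply]
      rw [← this, hg]
    have hR : ContinuousLinearMap.adjoint R x = 0 := by
      refine ext_inner_left ℂ fun y => ?_
      rw [ContinuousLinearMap.adjoint_inner_right, inner_zero_right]
      have := Submodule.orthogonalProjectionOnto_eq_zero_iff.1 hgx
      exact this _ ⟨y, rfl⟩
    have hpos : 0 < Real.sqrt (∑ i, ‖c i‖ ^ 2) := by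
      apply Real.sqrt_pos.2
      obtain ⟨i, hi⟩ := Function.ne_iff.1 hc
      refine Finset.sum_pos' (fun i _ => by positivity) ⟨i, Finset.mem_univ _, ?_⟩
      have : 0 < ‖c i‖ := norm_pos_iff.2 hi
      positivity
    have h1 : ContinuousLinearMap.adjoint (T - R) x =
        ∑ i, c i • ContinuousLinearMap.adjoint T (v i) := by
      rw [map_sub, sub_apply, hR, sub_zero, hx, map_sum]
      simp
    have h2 := (ContinuousLinearMap.adjoint (T - R)).le_opNorm x
    rw [h1, LinearIsometryEquiv.norm_map] at h2
    have h3 := hlow c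
    have h4 := hup c
    rw [div_le_iff₀ hA]
    have h5 : s * Real.sqrt (∑ i, ‖c i‖ ^ 2) ≤ (‖T - R‖ * A) * Real.sqrt (∑ i, ‖c i‖ ^ 2) := by
      calc _ ≤ ‖T - R‖ * ‖x‖ := h3.trans h2
        _ ≤ ‖T - R‖ * (A * Real.sqrt (∑ i, ‖c i‖ ^ 2)) := by gcongr
        _ = _ := by ring
    exact le_of_mul_le_mul_right h5 hpos

lemma integral_exp_int (n : ℤ) : ∫ θ in (-Real.pi)..Real.pi, Complex.exp (n * θ * I) =
    if n = 0 then (2 * Real.pi : ℂ) else 0 := by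
  split_ifs with h
  · subst h; simp; ring
  · have hc : (n * I : ℂ) ≠ 0 := by simp [h]
    have := integral_exp_mul_complex (a := -Real.pi) (b := Real.pi) hc
    have e : ∀ θ : ℝ, Complex.exp (n * θ * I) = Complex.exp (n * I * θ) := by
      intro θ; congr 1; ring
    simp_rw [e, this]
    have : Complex.exp (n * I * (Real.pi : ℝ)) = Complex.exp (n * I * ((-Real.pi : ℝ))) := by
      rw [Complex.exp_eq_exp_iff_exists_int]
      exact ⟨n, by push_cast; ring⟩
    rw [this]; simp

lemma integral_trig_poly (c : ℕ → ℂ) (M : ℕ) :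
    ∫ θ in (-Real.pi)..Real.pi, ‖∑ k ∈ Finset.range M, c k * Complex.exp (k * θ * I)‖ ^ 2 =
      2 * Real.pi * ∑ k ∈ Finset.range M, ‖c k‖ ^ 2 := by
  have h : ((∫ θ in (-Real.pi)..Real.pi,
      ‖∑ k ∈ Finset.range M, c k * Complex.exp (k * θ * I)‖ ^ 2 : ℝ) : ℂ) =
      ((2 * Real.pi * ∑ k ∈ Finset.range M, ‖c k‖ ^ 2 : ℝ) : ℂ) := by
    rw [← intervalIntegral.integral_ofReal]
    have e : ∀ θ : ℝ, ((‖∑ k ∈ Finset.range M, c k * Complex.exp (k * θ * I)‖ ^ 2 : ℝ) : ℂ) =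
        ∑ j ∈ Finset.range M, ∑ k ∈ Finset.range M,
          c j * (starRingEnd ℂ) (c k) * Complex.exp (((j : ℤ) - (k : ℤ) : ℤ) * θ * I) := by
      intro θ
      push_cast
      rw [← Complex.mul_conj', map_sum, Finset.sum_mul_sum]
      refine Finset.sum_congr rfl fun j _ => Finset.sum_congr rfl fun k _ => ?_
      rw [map_mul, ← Complex.exp_conj]
      simp only [map_mul, conj_I, conj_ofReal, map_natCast]
      rw [show ((j : ℂ) - k) * θ * I = j * θ * I + k * θ * (-I) by ring, Complex.exp_add]
      ring
    simp_rw [e]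
    rw [intervalIntegral.integral_finsetSum (fun i _ => by
      apply Continuous.intervalIntegrable; fun_prop)]
    push_cast
    rw [Finset.mul_sum]
    refine Finset.sum_congr rfl fun j hj => ?_
    rw [intervalIntegral.integral_finsetSum (fun i _ => by
      apply Continuous.intervalIntegrable; fun_prop)]
    rw [Finset.sum_eq_single j]
    · rw [intervalIntegral.integral_const_mul]
      have := integral_exp_int ((j : ℤ) - (j : ℤ))
      push_cast at this ⊢
      rw [this, ← Complex.mul_conj']
      simp; ring
    · intro k _ hk
      have := integral_exp_int ((j : ℤ) - (k : ℤ))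
      rw [if_neg (by omega)] at this
      push_cast at this ⊢
      rw [intervalIntegral.integral_const_mul, this, mul_zero]
    · intro h; exact absurd hj h
  exact_mod_cast h

lemma fa_circle (g : H2) {r : ℝ} (hr : 0 ≤ r) (hr1 : r < 1) (θ : ℝ) :
    HasSum (fun k : ℕ => (g k * r ^ k) * Complex.exp (k * θ * I))
      (fa g (r * Complex.exp (θ * I))) := by
  have hz : ‖(r : ℂ) * Complex.exp (θ * I)‖ < 1 := by
    rw [norm_mul, Complex.norm_exp_ofReal_mul_I]; simpa [abs_of_nonneg hr] using hr1
  refine (fa_hasSum g hz).congr_fun fun k => ?_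
  rw [mul_pow, ← Complex.exp_nat_mul]
  ring_nf

lemma bessel_mean (g : H2) {r : ℝ} (hr : 0 ≤ r) (hr1 : r < 1) (N : ℕ) :
    2 * Real.pi * ∑ k ∈ Finset.range N, ‖g k * (r : ℂ) ^ k‖ ^ 2 ≤
      ∫ θ in (-Real.pi)..Real.pi, ‖fa g (r * Complex.exp (θ * I))‖ ^ 2 := by
  have hg : ∀ k, ‖g k‖ ≤ ‖g‖ := fun k => lp.norm_apply_le_norm (by norm_num) g k
  have hsum : Summable (fun k : ℕ => ‖g‖ * r ^ k) :=
    (summable_geometric_of_lt_one hr hr1).mul_left _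
  set B := ∑' k : ℕ, ‖g‖ * r ^ k with hB
  have hbound : ∀ M (θ : ℝ), ‖∑ k ∈ Finset.range M, (g k * (r:ℂ) ^ k) * Complex.exp (k * θ * I)‖ ≤ B := by
    intro M θ
    refine (norm_sum_le _ _).trans ?_
    refine le_trans (Finset.sum_le_sum (g := fun k => ‖g‖ * r ^ k) fun k _ => ?_)
      (hsum.sum_le_tsum _ (fun k _ => by positivity))
    rw [norm_mul, norm_mul, norm_pow, show (k : ℂ) * θ * I = ((k * θ : ℝ) : ℂ) * I by push_cast; ring,
      Complex.norm_exp_ofReal_mul_I, Complex.norm_of_nonneg hr, mul_one]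
    gcongr
    exact hg k
  have hlim : Tendsto (fun M => ∫ θ in (-Real.pi)..Real.pi,
      ‖∑ k ∈ Finset.range M, (g k * (r:ℂ) ^ k) * Complex.exp (k * θ * I)‖ ^ 2) atTop
      (nhds (∫ θ in (-Real.pi)..Real.pi, ‖fa g (r * Complex.exp (θ * I))‖ ^ 2)) := by
    refine intervalIntegral.tendsto_integral_filter_of_dominated_convergence (fun _ => B ^ 2) ?_ ?_ ?_ ?_
    · refine Eventually.of_forall fun M => ?_
      apply Continuous.aestronglyMeasurable; fun_prop
    · refine Eventually.of_forall fun M => Eventually.of_forall fun θ _ => ?_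
      rw [Real.norm_of_nonneg (by positivity)]
      gcongr
      exact hbound M θ
    · simp
    · refine Eventually.of_forall fun θ _ => ?_
      exact ((fa_circle g hr hr1 θ).tendsto_sum_nat.norm).pow 2
  refine ge_of_tendsto hlim ?_
  filter_upwards [eventually_ge_atTop N] with M hM
  rw [integral_trig_poly]
  gcongr

lemma norm_sq_le_of_mean (g : H2) (K : ℝ) (r0 : ℝ) (h0 : 0 ≤ r0) (h1 : r0 < 1)
    (h : ∀ r, r0 ≤ r → r < 1 →
      ∫ θ in (-Real.pi)..Real.pi, ‖fa g (r * Complex.exp (θ * I))‖ ^ 2 ≤ 2 * Real.pi * K) :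
    ‖g‖ ^ 2 ≤ K := by
  have hs := norm_sq_eq g
  refine le_of_tendsto hs.tendsto_sum_nat (Eventually.of_forall fun N => ?_)
  have hlim : Tendsto (fun r : ℝ => ∑ k ∈ Finset.range N, ‖g k * (r : ℂ) ^ k‖ ^ 2)
      (nhdsWithin 1 (Iio 1)) (nhds (∑ k ∈ Finset.range N, ‖g k‖ ^ 2)) := by
    have hc : Continuous (fun r : ℝ => ∑ k ∈ Finset.range N, ‖g k * (r : ℂ) ^ k‖ ^ 2) := by
      fun_prop
    have := hc.tendsto 1
    simp only [ofReal_one, one_pow, mul_one] at this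
    exact this.mono_left nhdsWithin_le_nhds
  refine le_of_tendsto hlim ?_
  have : Ico r0 1 ∈ nhdsWithin (1:ℝ) (Iio 1) := Ico_mem_nhdsLT h1
  filter_upwards [this] with r hr
  have h2 := (bessel_mean g (h0.trans hr.1) hr.2 N).trans (h r hr.1 hr.2)
  exact le_of_mul_le_mul_left h2 (by positivity)

/-- reduce a bound on an operator to finitely supported sequences, whose `fa` is bounded -/
lemma bound_of_bounded (A : H2 →L[ℂ] H2) (K : ℝ)
    (h : ∀ x : H2, (∃ B, ∀ z, ‖z‖ < 1 → ‖fa x z‖ ≤ B) → ‖A x‖ ≤ K * ‖x‖) (x : H2) :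
    ‖A x‖ ≤ K * ‖x‖ := by
  have hx := (lp.hasSum_single (p := 2) (by norm_num) x).tendsto_sum_nat
  have h1 : Tendsto (fun n => ‖A (∑ i ∈ Finset.range n, lp.single 2 i (x i))‖) atTop
      (nhds ‖A x‖) := (A.continuous.norm.tendsto x).comp hx
  have h2 : Tendsto (fun n => K * ‖(∑ i ∈ Finset.range n, lp.single 2 i (x i) : H2)‖) atTop
      (nhds (K * ‖x‖)) := (hx.norm).const_mul K
  refine le_of_tendsto_of_tendsto' h1 h2 fun n => h _ ?_
  refine ⟨∑ i ∈ Finset.range n, ‖x i‖, fun z hz => ?_⟩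
  rw [fa_eq_inner _ hz, inner_sum]
  refine (norm_sum_le _ _).trans (Finset.sum_le_sum fun i _ => ?_)
  rw [lp.inner_single_right, kerZ_apply hz]
  simp only [RCLike.inner_apply, norm_mul, RCLike.norm_conj, norm_pow]
  exact mul_le_of_le_one_right (norm_nonneg _) (pow_le_one₀ (norm_nonneg _) hz.le)

/-- Poisson type kernel on the line -/
def qk (d x : ℝ) : ℝ := d / (d ^ 2 + x ^ 2)

lemma qk_nonneg {d : ℝ} (hd : 0 < d) (x : ℝ) : 0 ≤ qk d x := by unfold qk; positivity

lemma qk_continuous {d : ℝ} (hd : 0 < d) : Continuous (qk d) := by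
  unfold qk
  refine continuous_const.div (by fun_prop) fun x => by positivity

lemma qk_eq {d : ℝ} (hd : 0 < d) (a s : ℝ) :
    qk d (a - s) = d⁻¹ * (1 + (d⁻¹ * (s - a)) ^ 2)⁻¹ := by
  unfold qk
  field_simp
  ring

lemma qk_integrable {d : ℝ} (hd : 0 < d) (a : ℝ) : Integrable (fun s => qk d (a - s)) := by
  simp_rw [qk_eq hd]
  refine Integrable.const_mul ?_ _
  exact ((integrable_inv_one_add_sq).comp_mul_left' (inv_ne_zero hd.ne')).comp_sub_right a

lemma qk_integral {d : ℝ} (hd : 0 < d) (a : ℝ) : ∫ s, qk d (a - s) = Real.pi := by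
  simp_rw [qk_eq hd]
  rw [integral_const_mul]
  rw [integral_sub_right_eq_self (fun s => (1 + (d⁻¹ * s) ^ 2)⁻¹) a]
  rw [Measure.integral_comp_mul_left (fun s => (1 + s ^ 2)⁻¹)]
  rw [integral_univ_inv_one_add_sq]
  rw [inv_inv, abs_of_pos hd, smul_eq_mul]
  field_simp

lemma qk_mul_le {d e : ℝ} (hd : 0 < d) (he : 0 < e) (x y : ℝ) :
    qk d x * qk e y ≤ qk (d + e) (x - y) * (qk d x + qk e y) := by
  unfold qk
  rw [div_mul_div_comm, div_add_div _ _ (by positivity) (by positivity), div_mul_div_comm,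
    div_le_div_iff₀ (by positivity) (by positivity)]
  have key : d * e * ((d + e) ^ 2 + (x - y) ^ 2) ≤
      (d + e) * (d * (e ^ 2 + y ^ 2) + (d ^ 2 + x ^ 2) * e) := by
    nlinarith [sq_nonneg (e * x + d * y)]
  have h2 : 0 ≤ (d ^ 2 + x ^ 2) * (e ^ 2 + y ^ 2) := by positivity
  nlinarith [mul_le_mul_of_nonneg_right key h2]

lemma qk_prod_integral {d e : ℝ} (hd : 0 < d) (he : 0 < e) (x y : ℝ) :
    Integrable (fun s => qk d (x - s) * qk e (y - s)) ∧
    ∫ s, qk d (x - s) * qk e (y - s) ≤ 2 * Real.pi * qk (d + e) (x - y) := by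
  have hI : Integrable (fun s => qk (d + e) (x - y) * (qk d (x - s) + qk e (y - s))) :=
    ((qk_integrable hd x).add (qk_integrable he y)).const_mul _
  have hle : ∀ s, qk d (x - s) * qk e (y - s) ≤
      qk (d + e) (x - y) * (qk d (x - s) + qk e (y - s)) := fun s => by
    have := qk_mul_le hd he (x - s) (y - s)
    rwa [show x - s - (y - s) = x - y by ring] at this
  have h0 : ∀ s, 0 ≤ qk d (x - s) * qk e (y - s) := fun s =>
    mul_nonneg (qk_nonneg hd _) (qk_nonneg he _)
  have hP : Integrable (fun s => qk d (x - s) * qk e (y - s)) := by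
    refine hI.mono' ?_ (Eventually.of_forall fun s => ?_)
    · exact (((qk_continuous hd).comp (by fun_prop)).mul
        ((qk_continuous he).comp (by fun_prop))).aestronglyMeasurable
    · rw [Real.norm_of_nonneg (h0 s)]; exact hle s
  refine ⟨hP, (integral_mono hP hI hle).trans ?_⟩
  rw [integral_const_mul, integral_add (qk_integrable hd x) (qk_integrable he y),
    qk_integral hd, qk_integral he]
  linarith

lemma quad_bound {ι : Type} [Fintype ι] (L : ℝ) (u α p q b : ι → ℝ)
    (hu : ∀ i, 0 < u i) (hpq : ∀ i, p i ≤ q i)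
    (hI : ∀ i, α i - L * u i ≤ p i ∧ q i ≤ α i + L * u i)
    (hdisj : Pairwise fun i j => Disjoint (Ioc (p i) (q i)) (Ioc (p j) (q j)))
    (hb : ∀ i, 0 ≤ b i) :
    ∑ i, ∑ j, (b i * √(q i - p i)) * (b j * √(q j - p j)) * qk (u i + u j) (α i - α j) ≤
      (8 * Real.pi * (2 + 2 * L ^ 2) ^ 2) * ∑ i, b i ^ 2 := by
  set K := 2 + 2 * L ^ 2 with hK
  have hK0 : 0 < K := by positivity
  set a : ι → ℝ := fun i => b i * √(q i - p i) with ha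
  have ha0 : ∀ i, 0 ≤ a i := fun i => mul_nonneg (hb i) (Real.sqrt_nonneg _)
  set Q := ∑ i, ∑ j, a i * a j * qk (u i + u j) (α i - α j) with hQ
  change Q ≤ _
  set G : ℝ → ℝ := fun s => ∑ i, a i * qk (u i) (α i - s) with hG
  have hG0 : ∀ s, 0 ≤ G s := fun s => Finset.sum_nonneg fun i _ =>
    mul_nonneg (ha0 i) (qk_nonneg (hu i) _)
  have hGc : Continuous G := by
    refine continuous_finsetSum _ fun i _ => continuous_const.mul ?_
    exact (qk_continuous (hu i)).comp (by fun_prop)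
  have hG2 : ∀ s, G s ^ 2 = ∑ i, ∑ j, a i * a j * (qk (u i) (α i - s) * qk (u j) (α j - s)) := by
    intro s
    rw [sq, hG, Finset.sum_mul_sum]
    refine Finset.sum_congr rfl fun i _ => Finset.sum_congr rfl fun j _ => by ring
  have hGint : Integrable (fun s => G s ^ 2) := by
    simp_rw [hG2]
    exact integrable_finsetSum _ fun i _ => integrable_finsetSum _ fun j _ =>
      (qk_prod_integral (hu i) (hu j) _ _).1.const_mul _
  have hGle : ∫ s, G s ^ 2 ≤ 2 * Real.pi * Q := by
    simp_rw [hG2]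
    rw [integral_finsetSum _ fun i _ => integrable_finsetSum _ fun j _ =>
      (qk_prod_integral (hu i) (hu j) _ _).1.const_mul _, hQ, Finset.mul_sum]
    refine Finset.sum_le_sum fun i _ => ?_
    rw [integral_finsetSum _ fun j _ =>
      (qk_prod_integral (hu i) (hu j) _ _).1.const_mul _, Finset.mul_sum]
    refine Finset.sum_le_sum fun j _ => ?_
    rw [integral_const_mul]
    have := mul_le_mul_of_nonneg_left (qk_prod_integral (hu i) (hu j) (α i) (α j)).2
      (mul_nonneg (ha0 i) (ha0 j))
    linarith
  set X : ι → ℝ := fun j => ∑ i, a i * (u i / ((u i + u j) ^ 2 + (α i - α j) ^ 2)) with hX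
  have hX0 : ∀ j, 0 ≤ X j := fun j => Finset.sum_nonneg fun i _ =>
    mul_nonneg (ha0 i) (by have := hu i; have := hu j; positivity)
  have hXG : ∀ j, ∀ s ∈ Ioc (p j) (q j), X j ≤ K * G s := by
    intro j s hs
    rw [hX, hG, Finset.mul_sum]
    refine Finset.sum_le_sum fun i _ => ?_
    have hui := hu i
    have huj := hu j
    rw [show K * (a i * qk (u i) (α i - s)) = a i * (K * qk (u i) (α i - s)) by ring]
    refine mul_le_mul_of_nonneg_left ?_ (ha0 i)
    unfold qk
    rw [mul_div_assoc', div_le_div_iff₀ (by positivity) (by positivity)]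
    have h1 : |α j - s| ≤ L * u j := by
      rw [abs_le]; constructor <;> linarith [(hI j).1, (hI j).2, hs.1, hs.2]
    have h2 : (α j - s) ^ 2 ≤ L ^ 2 * u j ^ 2 := by
      rw [← mul_pow]; exact sq_le_sq' (by linarith [neg_abs_le (α j - s)]) (by linarith [le_abs_self (α j - s)])
    have h3 : u i ^ 2 + (α i - s) ^ 2 ≤ K * ((u i + u j) ^ 2 + (α i - α j) ^ 2) := by
      have e : (α i - s) ^ 2 ≤ 2 * (α i - α j) ^ 2 + 2 * (α j - s) ^ 2 := by
        nlinarith [sq_nonneg ((α i - α j) - (α j - s))]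
      have e2 : K * ((u i + u j) ^ 2 + (α i - α j) ^ 2) = 2 * (u i + u j) ^ 2 + 2 * (α i - α j) ^ 2 +
        2 * L ^ 2 * (u i + u j) ^ 2 + 2 * L ^ 2 * (α i - α j) ^ 2 := by rw [hK]; ring
      have e3 : L ^ 2 * u j ^ 2 ≤ L ^ 2 * (u i + u j) ^ 2 := by gcongr; linarith
      have e4 : u i ^ 2 ≤ (u i + u j) ^ 2 := by gcongr; linarith
      have e5 : 0 ≤ L ^ 2 * (α i - α j) ^ 2 := by positivity
      nlinarith
    nlinarith
  have hX2 : ∀ j, (q j - p j) * X j ^ 2 ≤ K ^ 2 * ∫ s in Ioc (p j) (q j), G s ^ 2 := by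
    intro j
    have h1 : ∫ s in Ioc (p j) (q j), X j ^ 2 ≤ ∫ s in Ioc (p j) (q j), K ^ 2 * G s ^ 2 := by
      refine setIntegral_mono_on (by simp [integrableOn_const_iff]) (hGint.integrableOn.const_mul _) measurableSet_Ioc
        fun s hs => ?_
      rw [← mul_pow]
      exact pow_le_pow_left₀ (hX0 j) (hXG j s hs) 2
    rw [integral_const_mul] at h1
    simpa [hpq j] using h1
  have hsum : ∑ j, ∫ s in Ioc (p j) (q j), G s ^ 2 ≤ ∫ s, G s ^ 2 := by
    rw [← integral_iUnion_fintype (fun i => measurableSet_Ioc) hdisj (fun i => hGint.integrableOn)]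
    exact setIntegral_le_integral hGint (Eventually.of_forall fun s => by positivity)
  have hQX : Q = 2 * ∑ j, a j * X j := by
    have e : ∀ i j, a i * a j * qk (u i + u j) (α i - α j) =
        a j * (a i * (u i / ((u i + u j) ^ 2 + (α i - α j) ^ 2))) +
        a i * (a j * (u j / ((u j + u i) ^ 2 + (α j - α i) ^ 2))) := by
      intro i j
      unfold qk
      rw [show (u j + u i) ^ 2 + (α j - α i) ^ 2 = (u i + u j) ^ 2 + (α i - α j) ^ 2 by ring]
      ring
    rw [hQ]
    simp_rw [e, Finset.sum_add_distrib]
    rw [Finset.sum_comm, two_mul]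
    simp_rw [hX, Finset.mul_sum]
  have hpi := Real.pi_pos
  set lam := 1 / (4 * Real.pi * K ^ 2) with hlam
  have hlam0 : 0 < lam := by positivity
  have hj : ∀ j, 2 * (a j * X j) ≤ lam⁻¹ * b j ^ 2 + lam * ((q j - p j) * X j ^ 2) := by
    intro j
    have hs : √(q j - p j) ^ 2 = q j - p j := Real.sq_sqrt (by linarith [hpq j])
    rw [← hs]
    have : 0 ≤ lam * (lam⁻¹ * b j - √(q j - p j) * X j) ^ 2 := by positivity
    have e : lam * (lam⁻¹ * b j - √(q j - p j) * X j) ^ 2 = lam⁻¹ * b j ^ 2 + lam * (√(q j - p j) ^ 2 * X j ^ 2)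
        - 2 * (a j * X j) := by
      rw [ha]; field_simp; ring
    linarith
  have hfin : Q ≤ lam⁻¹ * ∑ j, b j ^ 2 + lam * K ^ 2 * (2 * Real.pi * Q) := by
    calc Q = ∑ j, 2 * (a j * X j) := by rw [hQX, Finset.mul_sum]
      _ ≤ ∑ j, (lam⁻¹ * b j ^ 2 + lam * (K ^ 2 * ∫ s in Ioc (p j) (q j), G s ^ 2)) :=
          Finset.sum_le_sum fun j _ => (hj j).trans (add_le_add_right (mul_le_mul_of_nonneg_left (hX2 j) hlam0.le) _)
      _ = lam⁻¹ * ∑ j, b j ^ 2 + lam * K ^ 2 * ∑ j, ∫ s in Ioc (p j) (q j), G s ^ 2 := by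
          rw [Finset.sum_add_distrib, Finset.mul_sum, Finset.mul_sum]
          congr 1
          exact Finset.sum_congr rfl fun j _ => by ring
      _ ≤ _ := by gcongr; exact hsum.trans hGle
  have e1 : lam * K ^ 2 * (2 * Real.pi * Q) = Q / 2 := by rw [hlam]; field_simp; ring
  have e2 : lam⁻¹ = 4 * Real.pi * K ^ 2 := by rw [hlam]; simp
  rw [e1, e2] at hfin
  linarith

lemma two_re_inv_le {M v x : ℝ} (hv : 0 < v) (hvM : v ≤ 2 * M) (hx : |x| ≤ 1) :
    0 ≤ 2 * ((1 - Complex.exp (-v + x * I))⁻¹).re ∧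
    2 * ((1 - Complex.exp (-v + x * I))⁻¹).re ≤ 8 * Real.exp (4 * M) * qk v x + 1 := by
  set E := Real.exp (-v) with hE
  have hE0 : 0 < E := Real.exp_pos _
  have hE1 : E < 1 := by rw [hE]; simpa using hv
  have hre : (1 - Complex.exp (-v + x * I)).re = 1 - E * Real.cos x := by
    simp [Complex.exp_re, hE]
  have him : (1 - Complex.exp (-v + x * I)).im = - (E * Real.sin x) := by
    simp [Complex.exp_im, hE]
  have hns : Complex.normSq (1 - Complex.exp (-v + x * I)) = (1 - E) ^ 2 + 2 * E * (1 - Real.cos x) := by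
    rw [Complex.normSq_apply, hre, him]
    nlinarith [Real.sin_sq_add_cos_sq x]
  have hc1 := Real.cos_le_one x
  have hpos : 0 < (1 - E) ^ 2 + 2 * E * (1 - Real.cos x) := by
    have : 0 < (1 - E) ^ 2 := by apply pow_pos; linarith
    nlinarith [mul_nonneg hE0.le (sub_nonneg.2 hc1)]
  rw [Complex.inv_re, hns, hre]
  constructor
  · have : 0 ≤ 1 - E * Real.cos x := by nlinarith
    positivity
  have hN : Real.exp (-(4 * M)) * (v ^ 2 + x ^ 2) ≤ 4 * ((1 - E) ^ 2 + 2 * E * (1 - Real.cos x)) := by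
    have h1 : v * E ≤ 1 - E := by
      have := Real.add_one_le_exp v
      have e : E * Real.exp v = 1 := by rw [hE, ← Real.exp_add]; simp
      nlinarith
    have h2 := Real.cos_le_one_sub_mul_cos_sq (x := x) (by linarith [Real.pi_gt_three])
    have hpi : (1:ℝ) / 8 ≤ 2 / Real.pi ^ 2 := by
      rw [div_le_div_iff₀ (by norm_num) (by positivity)]
      nlinarith [Real.pi_le_four, Real.pi_pos]
    have h3 : x ^ 2 / 8 ≤ 1 - Real.cos x := by nlinarith [sq_nonneg x]
    have h4 : Real.exp (-(4 * M)) ≤ E ^ 2 := by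
      rw [hE, ← Real.exp_nat_mul]; apply Real.exp_le_exp.2; push_cast; linarith
    have h5 : E ^ 2 ≤ E := by nlinarith
    have h6 : (v * E) ^ 2 ≤ (1 - E) ^ 2 := by gcongr
    have h7 : Real.exp (-(4 * M)) * v ^ 2 ≤ E ^ 2 * v ^ 2 := by gcongr
    have h8 : Real.exp (-(4 * M)) * x ^ 2 ≤ E * x ^ 2 := by gcongr; linarith
    nlinarith
  have hE2 : 1 - E ^ 2 ≤ 2 * v := by
    have := Real.add_one_le_exp (-v)
    nlinarith
  have h3 : 2 * ((1 - E * Real.cos x) / ((1 - E) ^ 2 + 2 * E * (1 - Real.cos x))) =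
      (1 - E ^ 2) / ((1 - E) ^ 2 + 2 * E * (1 - Real.cos x)) + 1 := by
    field_simp
    ring
  rw [h3]
  gcongr
  unfold qk
  have h4 : Real.exp (-(4 * M)) * Real.exp (4 * M) = 1 := by rw [← Real.exp_add]; simp
  rw [mul_div_assoc', div_le_div_iff₀ hpos (by positivity)]
  have h5 : v ^ 2 + x ^ 2 ≤ Real.exp (4 * M) * (4 * ((1 - E) ^ 2 + 2 * E * (1 - Real.cos x))) := by
    have := mul_le_mul_of_nonneg_left hN (Real.exp_pos (4 * M)).le
    rw [← mul_assoc, mul_comm (Real.exp (4 * M)), h4, one_mul] at this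
    exact this
  calc (1 - E ^ 2) * (v ^ 2 + x ^ 2) ≤ (2 * v) * (v ^ 2 + x ^ 2) := by gcongr
    _ ≤ (2 * v) * (Real.exp (4 * M) * (4 * ((1 - E) ^ 2 + 2 * E * (1 - Real.cos x)))) := by gcongr
    _ = _ := by ring


lemma norm_sq_sum_eq {ι : Type} [Fintype ι] (a : ι → ℂ) (v : ι → H2) :
    ‖∑ i, a i • v i‖ ^ 2 = ∑ i, ∑ j, ((starRingEnd ℂ) (a i) * a j * inner ℂ (v i) (v j)).re := by
  rw [← inner_self_eq_norm_sq (𝕜 := ℂ), sum_inner, map_sum]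
  refine Finset.sum_congr rfl fun i _ => ?_
  rw [inner_sum, map_sum]
  refine Finset.sum_congr rfl fun j _ => ?_
  rw [inner_smul_left, inner_smul_right, mul_assoc]
  rfl

lemma sum_len_le {ι : Type} [Fintype ι] (p q : ι → ℝ) (A B : ℝ) (hAB : A ≤ B)
    (hpq : ∀ i, p i ≤ q i) (hA : ∀ i, A ≤ p i) (hB : ∀ i, q i ≤ B)
    (hdisj : Pairwise fun i j => Disjoint (Ioc (p i) (q i)) (Ioc (p j) (q j))) :
    ∑ i, (q i - p i) ≤ B - A := by
  have h1 : volume (⋃ i, Ioc (p i) (q i)) ≤ volume (Ioc A B) :=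
    measure_mono (iUnion_subset fun i => Ioc_subset_Ioc (hA i) (hB i))
  rw [measure_iUnion hdisj (fun i => measurableSet_Ioc), tsum_fintype, Real.volume_Ioc] at h1
  simp_rw [Real.volume_Ioc] at h1
  rw [← ENNReal.ofReal_sum_of_nonneg (fun i _ => by linarith [hpq i])] at h1
  exact (ENNReal.ofReal_le_ofReal_iff (by linarith)).1 h1

/-- Carleson embedding type lemma for finitely many points. -/
lemma carleson (L M : ℝ) (hL : 0 ≤ L) (hM : 0 ≤ M) : ∃ C : ℝ, 0 < C ∧
    ∀ (ι : Type) [Fintype ι] (u α p q : ι → ℝ), (∀ i, 0 < u i) → (∀ i, u i ≤ M) →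
    (∀ i j, |α i - α j| ≤ 1) → (∀ i, p i ≤ q i) →
    (∀ i, α i - L * u i ≤ p i ∧ q i ≤ α i + L * u i) →
    (Pairwise fun i j => Disjoint (Ioc (p i) (q i)) (Ioc (p j) (q j))) →
    ∀ c : ι → ℂ, ‖∑ i, (c i * (√(q i - p i) : ℝ)) • kerZ (Complex.exp (-(u i : ℂ) + α i * I))‖ ^ 2 ≤
      C * ∑ i, ‖c i‖ ^ 2 := by
  refine ⟨8 * Real.exp (4 * M) * (8 * Real.pi * (2 + 2 * L ^ 2) ^ 2) + (2 + 2 * (L * M)), by positivity, ?_⟩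
  intro ι _ u α p q hu huM hα hpq hI hdisj c
  rcases isEmpty_or_nonempty ι with he | ⟨⟨i0⟩⟩
  · simp
  set a : ι → ℂ := fun i => c i * (√(q i - p i) : ℝ) with ha
  set w : ι → ℂ := fun i => Complex.exp (-(u i : ℂ) + α i * I) with hw
  have hw1 : ∀ i, ‖w i‖ < 1 := by
    intro i
    rw [hw, Complex.norm_exp]
    simp [hu i]
  set S : (ι → ℂ) → ℝ := fun a => ‖∑ i, a i • kerZ (w i)‖ ^ 2 with hS
  have hin : ∀ i j, inner ℂ (kerZ (w i)) (kerZ (w j)) =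
      (1 - Complex.exp (-((u i + u j : ℝ) : ℂ) + ((α i - α j : ℝ) : ℂ) * I))⁻¹ := by
    intro i j
    rw [inner_kerZ (hw1 i) (hw1 j)]
    congr 2
    rw [hw]
    simp only
    rw [← Complex.exp_conj, ← Complex.exp_add]
    congr 1
    simp
    ring
  have hv : ∀ i j, 0 < u i + u j := fun i j => by linarith [hu i, hu j]
  have hvM : ∀ i j, u i + u j ≤ 2 * M := fun i j => by linarith [huM i, huM j]
  have hS2 : S a + S (fun i => (starRingEnd ℂ) (a i)) ≤
      ∑ i, ∑ j, ‖a i‖ * ‖a j‖ * (8 * Real.exp (4 * M) * qk (u i + u j) (α i - α j) + 1) := by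
    rw [hS]
    simp only
    rw [norm_sq_sum_eq, norm_sq_sum_eq]
    rw [Finset.sum_comm (f := fun i j => ((starRingEnd ℂ) ((starRingEnd ℂ) (a i)) * (starRingEnd ℂ) (a j) *
        inner ℂ (kerZ (w i)) (kerZ (w j))).re)]
    rw [← Finset.sum_add_distrib]
    refine Finset.sum_le_sum fun i _ => ?_
    rw [← Finset.sum_add_distrib]
    refine Finset.sum_le_sum fun j _ => ?_
    have hb := two_re_inv_le (hv i j) (hvM i j) (hα i j)
    rw [← hin] at hb
    rw [← inner_conj_symm (kerZ (w j)) (kerZ (w i))]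
    set g := inner ℂ (kerZ (w i)) (kerZ (w j)) with hg
    have e : ((starRingEnd ℂ) (a i) * a j * g).re +
        ((starRingEnd ℂ) ((starRingEnd ℂ) (a j)) * (starRingEnd ℂ) (a i) * (starRingEnd ℂ) g).re =
        ((starRingEnd ℂ) (a i) * a j).re * (2 * g.re) := by
      simp [Complex.mul_re, Complex.mul_im]
      ring
    rw [e]
    have h1 : ((starRingEnd ℂ) (a i) * a j).re ≤ ‖a i‖ * ‖a j‖ := by
      refine (Complex.re_le_norm _).trans ?_
      rw [norm_mul, RCLike.norm_conj]
    calc _ ≤ ‖a i‖ * ‖a j‖ * (2 * g.re) := mul_le_mul_of_nonneg_right h1 hb.1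
      _ ≤ _ := mul_le_mul_of_nonneg_left hb.2 (by positivity)
  have hna : ∀ i, ‖a i‖ = ‖c i‖ * √(q i - p i) := by
    intro i; rw [ha]; simp [abs_of_nonneg (Real.sqrt_nonneg _)]
  have hq := quad_bound L u α p q (fun i => ‖c i‖) hu hpq hI hdisj (fun i => norm_nonneg _)
  simp_rw [← hna] at hq
  have hsum : (∑ i, ‖a i‖) ^ 2 ≤ (2 + 2 * (L * M)) * ∑ i, ‖c i‖ ^ 2 := by
    have h1 : (∑ i, ‖a i‖) ^ 2 ≤ (∑ i, ‖c i‖ ^ 2) * ∑ i, √(q i - p i) ^ 2 := by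
      simp_rw [hna]; exact Finset.sum_mul_sq_le_sq_mul_sq _ _ _
    have h2 : ∑ i, √(q i - p i) ^ 2 ≤ 2 + 2 * (L * M) := by
      have h3 : ∀ i, √(q i - p i) ^ 2 = q i - p i := fun i => Real.sq_sqrt (by linarith [hpq i])
      simp_rw [h3]
      have hLu : ∀ i, L * u i ≤ L * M := fun i => mul_le_mul_of_nonneg_left (huM i) hL
      have hLM : 0 ≤ L * M := by positivity
      have := sum_len_le p q (α i0 - 1 - L * M) (α i0 + 1 + L * M) (by linarith) hpq
        (fun i => by have := (hI i).1; have := hLu i; have := abs_le.1 (hα i i0); linarith)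
        (fun i => by have := (hI i).2; have := hLu i; have := abs_le.1 (hα i i0); linarith) hdisj
      linarith
    calc _ ≤ _ := h1
      _ ≤ (∑ i, ‖c i‖ ^ 2) * (2 + 2 * (L * M)) := mul_le_mul_of_nonneg_left h2 (by positivity)
      _ = _ := by ring
  have hexp : ∑ i, ∑ j, ‖a i‖ * ‖a j‖ * (8 * Real.exp (4 * M) * qk (u i + u j) (α i - α j) + 1) =
      8 * Real.exp (4 * M) * (∑ i, ∑ j, ‖a i‖ * ‖a j‖ * qk (u i + u j) (α i - α j)) +
      (∑ i, ‖a i‖) ^ 2 := by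
    rw [sq, Finset.sum_mul_sum, Finset.mul_sum, ← Finset.sum_add_distrib]
    refine Finset.sum_congr rfl fun i _ => ?_
    rw [Finset.mul_sum, ← Finset.sum_add_distrib]
    refine Finset.sum_congr rfl fun j _ => by ring
  have hS0 : 0 ≤ S (fun i => (starRingEnd ℂ) (a i)) := by rw [hS]; positivity
  have hfin : S a ≤ (8 * Real.exp (4 * M) * (8 * Real.pi * (2 + 2 * L ^ 2) ^ 2) + (2 + 2 * (L * M))) * ∑ i, ‖c i‖ ^ 2 := by
    have h5 := mul_le_mul_of_nonneg_left hq (show 0 ≤ 8 * Real.exp (4 * M) by positivity)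
    nlinarith
  exact hfin

/-- dual form -/
lemma carleson_dual {ι : Type} [Fintype ι] (C : ℝ) (hC : 0 ≤ C) (w : ι → ℂ) (hw : ∀ i, ‖w i‖ < 1) (m : ι → ℝ)
    (hm : ∀ i, 0 ≤ m i)
    (h : ∀ c : ι → ℂ, ‖∑ i, (c i * (√(m i) : ℝ)) • kerZ (w i)‖ ^ 2 ≤ C * ∑ i, ‖c i‖ ^ 2) (f : H2) :
    ∑ i, m i * ‖fa f (w i)‖ ^ 2 ≤ C * ‖f‖ ^ 2 := by
  set c : ι → ℂ := fun i => (√(m i) : ℝ) * fa f (w i) with hc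
  set Y := ∑ i, m i * ‖fa f (w i)‖ ^ 2 with hY
  have hc2 : ∑ i, ‖c i‖ ^ 2 = Y := by
    refine Finset.sum_congr rfl fun i _ => ?_
    rw [hc]
    simp only [norm_mul, mul_pow, Complex.norm_real, Real.norm_eq_abs, sq_abs]
    rw [Real.sq_sqrt (hm i)]
  have hY0 : 0 ≤ Y := by rw [← hc2]; positivity
  have h1 := h c
  rw [hc2] at h1
  set g := ∑ i, (c i * (√(m i) : ℝ)) • kerZ (w i) with hg
  have h2 : inner ℂ g f = (Y : ℂ) := by
    rw [hg, sum_inner, hY]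
    push_cast
    refine Finset.sum_congr rfl fun i _ => ?_
    rw [inner_smul_left, ← fa_eq_inner f (hw i), hc]
    simp only [map_mul, conj_ofReal]
    rw [← Complex.conj_mul']
    have : ((√(m i) : ℝ) : ℂ) * ((√(m i) : ℝ) : ℂ) = (m i : ℂ) := by
      rw [← ofReal_mul, Real.mul_self_sqrt (hm i)]
    linear_combination ((starRingEnd ℂ) (fa f (w i)) * fa f (w i)) * this
  have h3 : Y ≤ ‖g‖ * ‖f‖ := by
    have := norm_inner_le_norm (𝕜 := ℂ) g f
    rwa [h2, Complex.norm_real, Real.norm_of_nonneg hY0] at this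
  have h4 : Y ^ 2 ≤ (C * Y) * ‖f‖ ^ 2 := by
    calc Y ^ 2 ≤ (‖g‖ * ‖f‖) ^ 2 := by gcongr
      _ = ‖g‖ ^ 2 * ‖f‖ ^ 2 := by ring
      _ ≤ _ := by gcongr
  rcases hY0.eq_or_lt with h5 | h5
  · rw [← h5]; positivity
  · have : Y * Y ≤ (C * ‖f‖ ^ 2) * Y := by nlinarith
    exact le_of_mul_le_mul_right this h5

def Dp (a : ℂ) : Polynomial ℂ := Polynomial.X - Polynomial.C a
def Rp (a : ℂ) : Polynomial ℂ := 1 - Polynomial.C ((starRingEnd ℂ) a) * Polynomial.X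
def evS (p : Polynomial ℂ) : H2 →L[ℂ] H2 := Polynomial.aeval Sh p

lemma evS_mul (p q : Polynomial ℂ) (x : H2) : evS (p * q) x = evS p (evS q x) := by
  simp [evS]

lemma evS_one (x : H2) : evS 1 x = x := by simp [evS]

lemma evS_D (a : ℂ) (x : H2) : evS (Dp a) x = Sh x - a • x := by
  simp [evS, Dp, Algebra.algebraMap_eq_smul_one]

lemma evS_R (a : ℂ) (x : H2) : evS (Rp a) x = x - (starRingEnd ℂ) a • Sh x := by
  simp [evS, Rp, Algebra.algebraMap_eq_smul_one]

lemma evS_swap (l1 l2 : List ℂ) (hl : l1.length = l2.length) (u v : H2) :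
    inner ℂ (evS (l1.map Dp).prod u) (evS (l2.map Dp).prod v) =
      inner ℂ (evS (l2.map Rp).prod u) (evS (l1.map Rp).prod v) := by
  induction l1 generalizing l2 u v with
  | nil =>
    cases l2 with
    | nil => simp
    | cons b l => simp at hl
  | cons a l1 ih =>
    cases l2 with
    | nil => simp at hl
    | cons b l2 =>
      simp only [List.map_cons, List.prod_cons]
      rw [evS_mul, evS_mul, evS_D, evS_D, Sh_swap, ← evS_R, ← evS_R, ← evS_mul, ← evS_mul,
        mul_comm (Rp b), mul_comm (Rp a), evS_mul, evS_mul, ih l2 (by simpa using hl),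
        ← evS_mul, ← evS_mul, mul_comm (Rp b), mul_comm (Rp a)]

lemma fa_evS_D (a : ℂ) (x : H2) {z : ℂ} (hz : ‖z‖ < 1) : fa (evS (Dp a) x) z = (z - a) * fa x z := by
  rw [evS_D, fa_sub _ _ hz, fa_Sh _ hz, fa_smul _ _ hz]; ring

lemma fa_evS_R (a : ℂ) (x : H2) {z : ℂ} (hz : ‖z‖ < 1) :
    fa (evS (Rp a) x) z = (1 - (starRingEnd ℂ) a * z) * fa x z := by
  rw [evS_R, fa_sub _ _ hz, fa_smul _ _ hz, fa_Sh _ hz]; ring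

lemma fa_evS_prodD {ι : Type} (s : Finset ι) (w : ι → ℂ) (x : H2) {z : ℂ} (hz : ‖z‖ < 1) :
    fa (evS (∏ i ∈ s, Dp (w i)) x) z = (∏ i ∈ s, (z - w i)) * fa x z := by
  classical
  induction s using Finset.induction_on with
  | empty => simp [evS_one]
  | insert a s ha ih =>
    rw [Finset.prod_insert ha, Finset.prod_insert ha, evS_mul, fa_evS_D _ _ hz, ih, mul_assoc]

lemma fa_evS_prodR {ι : Type} (s : Finset ι) (w : ι → ℂ) (x : H2) {z : ℂ} (hz : ‖z‖ < 1) :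
    fa (evS (∏ i ∈ s, Rp (w i)) x) z = (∏ i ∈ s, (1 - (starRingEnd ℂ) (w i) * z)) * fa x z := by
  classical
  induction s using Finset.induction_on with
  | empty => simp [evS_one]
  | insert a s ha ih =>
    rw [Finset.prod_insert ha, Finset.prod_insert ha, evS_mul, fa_evS_R _ _ hz, ih, mul_assoc]

lemma evS_R_bij {a : ℂ} (ha : ‖a‖ < 1) : Function.Bijective (fun x => evS (Rp a) x) := by
  obtain ⟨Q, hQ1, hQ2⟩ := oneSub_surj ha
  refine ⟨fun x y hxy => ?_, fun y => ⟨Q y, ?_⟩⟩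
  · simp only [evS_R] at hxy
    rw [← hQ2 x, hxy, hQ2 y]
  · simp only [evS_R, hQ1]

lemma evS_R_surj {ι : Type} (s : Finset ι) (w : ι → ℂ) (hw : ∀ i, ‖w i‖ < 1) (y : H2) :
    ∃ x, evS (∏ i ∈ s, Rp (w i)) x = y := by
  classical
  induction s using Finset.induction_on generalizing y with
  | empty => exact ⟨y, by simp [evS_one]⟩
  | insert a s ha ih =>
    obtain ⟨y', hy'⟩ := (evS_R_bij (hw a)).2 y
    obtain ⟨x, hx⟩ := ih y'
    exact ⟨x, by rw [Finset.prod_insert ha, evS_mul, hx]; exact hy'⟩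

lemma evS_R_ker {a : ℂ} (ha : ‖a‖ < 1) : evS (Rp a) (kerZ a) = kerZ 0 := by
  rw [evS_R]
  ext k
  change kerZ a k - (starRingEnd ℂ) a * (Sh (kerZ a)) k = kerZ 0 k
  rw [kerZ_apply ha, kerZ_apply (z := 0) (by simp)]
  cases k with
  | zero => rw [Sh_zero]; simp
  | succ k => rw [Sh_succ, kerZ_apply ha]; simp [pow_succ]; ring

lemma riesz_lower {ι : Type} [Fintype ι] [DecidableEq ι] (w : ι → ℂ) (hw : ∀ i, ‖w i‖ < 1)
    (B δ : ℝ) (hB : 0 ≤ B) (hδ : 0 < δ)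
    (hup : ∀ c : ι → ℂ, ‖∑ i, (c i * (√(1 - ‖w i‖ ^ 2) : ℝ)) • kerZ (w i)‖ ≤ B * √(∑ i, ‖c i‖ ^ 2))
    (hbl : ∀ k, δ ≤ ∏ i ∈ Finset.univ.erase k, ‖bl (w i) (w k)‖) (c : ι → ℂ) :
    δ * √(∑ i, ‖c i‖ ^ 2) ≤ B * ‖∑ i, (c i * (√(1 - ‖w i‖ ^ 2) : ℝ)) • kerZ (w i)‖ := by
  obtain ⟨r, hr⟩ := evS_R_surj Finset.univ w hw (kerZ 0)
  set y : ι → H2 := fun k => evS (∏ i ∈ Finset.univ.erase k, Dp (w i)) r with hy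
  have hg : ∀ k, evS (∏ i ∈ Finset.univ.erase k, Rp (w i)) r = kerZ (w k) := by
    intro k
    apply (evS_R_bij (hw k)).1
    simp only
    rw [evS_R_ker (hw k), ← evS_mul, Finset.mul_prod_erase _ (fun i => Rp (w i)) (Finset.mem_univ k), hr]
  have hyy : ∀ j k, inner ℂ (y j) (y k) = inner ℂ (kerZ (w k)) (kerZ (w j)) := by
    intro j k
    have := evS_swap ((Finset.univ.erase j).toList.map w) ((Finset.univ.erase k).toList.map w)
      (by simp [Finset.card_erase_of_mem]) r r
    simp only [List.map_map, Finset.prod_map_toList] at this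
    rw [← hg k, ← hg j]
    exact this
  set b : ι → ℝ := fun i => √(1 - ‖w i‖ ^ 2) with hb
  have hb2 : ∀ i, b i ^ 2 = 1 - ‖w i‖ ^ 2 := fun i => Real.sq_sqrt (by
    nlinarith [hw i, norm_nonneg (w i)])
  set β : ι → ℂ := fun k => ∏ i ∈ Finset.univ.erase k, bl (w i) (w k) with hβ
  have hβn : ∀ k, δ ≤ ‖β k‖ := fun k => by rw [hβ]; simp only [norm_prod]; exact hbl k
  have hβ0 : ∀ k, β k ≠ 0 := fun k h => by have := hβn k; rw [h, norm_zero] at this; linarith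
  have hky : ∀ i k, i ≠ k → inner ℂ (kerZ (w i)) (y k) = 0 := by
    intro i k hik
    rw [← fa_eq_inner _ (hw i), hy]
    simp only
    rw [fa_evS_prodD _ _ _ (hw i), Finset.prod_eq_zero (i := i) (by simp [hik]) (by simp), zero_mul]
  have hkk : ∀ k, (b k : ℂ) * b k * inner ℂ (kerZ (w k)) (y k) = β k := by
    intro k
    rw [← fa_eq_inner _ (hw k), hy]
    simp only
    rw [fa_evS_prodD _ _ _ (hw k)]
    have h1 : (∏ i, (1 - (starRingEnd ℂ) (w i) * w k)) * fa r (w k) = 1 := by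
      rw [← fa_evS_prodR _ _ _ (hw k), hr, fa_eq_inner _ (hw k), inner_kerZ (hw k) (by simp)]
      simp
    rw [← Finset.mul_prod_erase _ _ (Finset.mem_univ k)] at h1
    have h2 : (b k : ℂ) * b k = 1 - (starRingEnd ℂ) (w k) * w k := by
      rw [Complex.conj_mul', ← sq, ← ofReal_pow, hb2]; push_cast; ring
    have h3 : β k * ∏ i ∈ Finset.univ.erase k, (1 - (starRingEnd ℂ) (w i) * w k) =
        ∏ i ∈ Finset.univ.erase k, (w k - w i) := by
      rw [hβ]
      simp only
      rw [← Finset.prod_mul_distrib]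
      refine Finset.prod_congr rfl fun i _ => ?_
      rw [bl, div_mul_cancel₀ _ (one_sub_conj_mul_ne (hw i) (hw k))]
    rw [h2, ← h3]
    linear_combination (β k) * h1
  set a : ι → ℂ := fun k => c k / β k with ha
  set f := ∑ i, (c i * (b i : ℂ)) • kerZ (w i) with hf
  set g := ∑ k, (a k * (b k : ℂ)) • y k with hgdef
  have hgn : ‖g‖ ≤ B * √(∑ i, ‖a i‖ ^ 2) := by
    have h1 := hup (fun i => (starRingEnd ℂ) (a i))
    have h2 : ‖g‖ ^ 2 = ‖∑ i, ((starRingEnd ℂ) (a i) * (b i : ℂ)) • kerZ (w i)‖ ^ 2 := by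
      rw [hgdef, norm_sq_sum_eq, norm_sq_sum_eq, Finset.sum_comm]
      refine Finset.sum_congr rfl fun i _ => Finset.sum_congr rfl fun j _ => ?_
      rw [hyy]
      congr 1
      simp only [map_mul, conj_ofReal, Complex.conj_conj]
      ring
    rw [(pow_left_inj₀ (norm_nonneg _) (norm_nonneg _) two_ne_zero).1 h2]
    simpa using h1
  have hin : inner ℂ f g = ((∑ i, ‖c i‖ ^ 2 : ℝ) : ℂ) := by
    rw [hf, hgdef, sum_inner]
    push_cast
    refine Finset.sum_congr rfl fun i _ => ?_
    rw [inner_sum, Finset.sum_eq_single i]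
    · rw [inner_smul_left, inner_smul_right, ← Complex.conj_mul']
      have := hkk i
      rw [ha]
      simp only [map_mul, conj_ofReal]
      have h5 := hβ0 i
      field_simp
      linear_combination (c i) * (starRingEnd ℂ) (c i) * this
    · intro j _ hj
      rw [inner_smul_left, inner_smul_right, hky i j hj.symm]; simp
    · simp
  set N := ∑ i, ‖c i‖ ^ 2 with hN
  have hN0 : 0 ≤ N := by positivity
  have hle : N ≤ ‖f‖ * ‖g‖ := by
    have := norm_inner_le_norm (𝕜 := ℂ) f g
    rwa [hin, Complex.norm_real, Real.norm_of_nonneg hN0] at this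
  have hal : √(∑ i, ‖a i‖ ^ 2) ≤ √N / δ := by
    rw [le_div_iff₀ hδ]
    apply Real.le_sqrt_of_sq_le
    rw [mul_pow, Real.sq_sqrt (by positivity), Finset.sum_mul]
    refine Finset.sum_le_sum fun i _ => ?_
    rw [ha]
    simp only [norm_div]
    rw [← mul_pow]
    gcongr
    rw [div_mul_eq_mul_div, div_le_iff₀ (norm_pos_iff.2 (hβ0 i))]
    exact mul_le_mul_of_nonneg_left (hβn i) (norm_nonneg _)
  rcases hN0.eq_or_lt with h0 | h0
  · rw [← h0]; simp; positivity
  have h6 : N ≤ ‖f‖ * (B * (√N / δ)) :=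
    hle.trans (mul_le_mul_of_nonneg_left (hgn.trans (mul_le_mul_of_nonneg_left hal hB)) (norm_nonneg _))
  have h7 : 0 < √N := Real.sqrt_pos.2 h0
  have h8 : √N * √N = N := Real.mul_self_sqrt hN0
  have h9 : √N * (δ * √N) ≤ √N * (B * ‖f‖) := by
    have : ‖f‖ * (B * (√N / δ)) * δ = √N * (B * ‖f‖) := by field_simp
    nlinarith
  exact le_of_mul_le_mul_left h9 h7

lemma deriv_zero_of_re_zero (H : ℂ → ℂ) (w : ℂ) (D : ℂ) (hD : HasDerivAt H D w)
    (h : ∀ᶠ z in nhds w, (H z).re = 0) : D = 0 := by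
  have key : ∀ v : ℂ, (v * D).re = 0 := by
    intro v
    have h1 : HasDerivAt (fun s : ℝ => w + (s : ℂ) * v) v 0 := by
      have := ((Complex.ofRealCLM.hasDerivAt (x := (0:ℝ))).mul_const v).const_add w
      simpa using this
    have h2 : HasDerivAt (fun s : ℝ => H (w + (s : ℂ) * v)) (D * v) 0 := by
      have hD' : HasDerivAt H D (w + ((0:ℝ) : ℂ) * v) := by simpa using hD
      exact hD'.comp (0:ℝ) h1
    have h3 : HasDerivAt (fun s : ℝ => (H (w + (s : ℂ) * v)).re) (D * v).re 0 :=
      Complex.reCLM.hasFDerivAt.comp_hasDerivAt (0:ℝ) h2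
    have h4 : (fun s : ℝ => (H (w + (s : ℂ) * v)).re) =ᶠ[nhds 0] fun _ => 0 := by
      have hc : Tendsto (fun s : ℝ => w + (s : ℂ) * v) (nhds 0) (nhds w) := by
        have := h1.continuousAt.tendsto
        simpa using this
      exact hc.eventually h
    have h5 := (h3.congr_of_eventuallyEq h4.symm).unique (hasDerivAt_const (0:ℝ) (0:ℝ))
    rw [mul_comm]; exact h5
  apply Complex.ext
  · simpa using key 1
  · have := key I
    simp at this
    simpa using this

lemma const_of_re_zero (H : ℂ → ℂ) (hH : DifferentiableOn ℂ H (Metric.ball 0 1))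
    (h : ∀ z, ‖z‖ < 1 → (H z).re = 0) {z : ℂ} (hz : ‖z‖ < 1) : H z = H 0 := by
  have hd : ∀ w ∈ Metric.ball (0:ℂ) 1, deriv H w = 0 := by
    intro w hw
    have hn := Metric.isOpen_ball.mem_nhds hw
    refine deriv_zero_of_re_zero H w _ (hH.differentiableAt hn).hasDerivAt ?_
    filter_upwards [hn] with y hy
    exact h y (by simpa using hy)
  exact Metric.isOpen_ball.is_const_of_deriv_eq_zero
    (convex_ball (0:ℂ) 1).isPreconnected hH hd (by simpa using hz) (by simp)

/-- denominator of the Poisson kernel -/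
def Dr (r y : ℝ) : ℝ := 1 - 2 * r * Real.cos y + r ^ 2

lemma Dr_eq (r y : ℝ) : Dr r y = (1 - r) ^ 2 + 4 * r * Real.sin (y / 2) ^ 2 := by
  have : Real.cos y = 1 - 2 * Real.sin (y / 2) ^ 2 := by
    have := Real.cos_two_mul (y / 2)
    rw [show 2 * (y / 2) = y by ring] at this
    rw [this, Real.cos_sq']; ring
  rw [Dr, this]; ring

lemma Dr_pos {r : ℝ} (h0 : 0 ≤ r) (h1 : r < 1) (y : ℝ) : 0 < Dr r y := by
  rw [Dr_eq]
  have : 0 < (1 - r) ^ 2 := by apply pow_pos; linarith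
  positivity

lemma Dr_cont (r : ℝ) : Continuous (Dr r) := by unfold Dr; fun_prop

lemma Dr_neg (r y : ℝ) : Dr r (-y) = Dr r y := by simp [Dr]

/-- real and imaginary part of the derivative kernel -/
def ka (r y : ℝ) : ℝ := r * ((1 + r ^ 2) * Real.cos y - 2 * r) / Dr r y ^ 2
def kb (r y : ℝ) : ℝ := -(r * (1 - r ^ 2) * Real.sin y) / Dr r y ^ 2

lemma ka_cont {r : ℝ} (h0 : 0 ≤ r) (h1 : r < 1) : Continuous (ka r) := by
  unfold ka
  exact Continuous.div (by fun_prop) ((Dr_cont r).pow 2) fun y => (pow_pos (Dr_pos h0 h1 y) 2).ne'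

lemma kb_cont {r : ℝ} (h0 : 0 ≤ r) (h1 : r < 1) : Continuous (kb r) := by
  unfold kb
  exact Continuous.div (by fun_prop) ((Dr_cont r).pow 2) fun y => (pow_pos (Dr_pos h0 h1 y) 2).ne'

lemma ka_neg (r y : ℝ) : ka r (-y) = ka r y := by simp [ka, Dr_neg]
lemma kb_neg (r y : ℝ) : kb r (-y) = - kb r y := by simp [kb, Dr_neg, neg_div]

lemma kern_eq {r : ℝ} (h0 : 0 ≤ r) (h1 : r < 1) (y : ℝ) :
    (r : ℂ) * Complex.exp (y * I) / (Complex.exp (y * I) - r) ^ 2 = (ka r y : ℂ) + kb r y * I := by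
  have hD := Dr_pos h0 h1 y
  have hDc : (Dr r y : ℂ) ≠ 0 := by exact_mod_cast hD.ne'
  have he : Complex.exp (y * I) = Real.cos y + Real.sin y * I := by
    rw [Complex.exp_mul_I]; simp
  have hsc : (Real.sin y : ℂ) ^ 2 + (Real.cos y : ℂ) ^ 2 = 1 := by
    exact_mod_cast Real.sin_sq_add_cos_sq y
  have hI := Complex.I_sq
  have hprod : (Complex.exp (y * I) - r) * (Real.cos y - Real.sin y * I - r) = Dr r y := by
    rw [he, Dr]; push_cast
    push_cast at hsc
    linear_combination hsc - (Complex.sin y : ℂ) ^ 2 * hI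
  have hne : Complex.exp (y * I) - r ≠ 0 := fun h => by rw [h, zero_mul] at hprod; exact hDc hprod.symm
  rw [div_eq_iff (pow_ne_zero 2 hne), ka, kb]
  push_cast
  have h2 : (Complex.exp (y * I) - r) ^ 2 * ((Real.cos y - Real.sin y * I - r)) ^ 2 = (Dr r y : ℂ) ^ 2 := by
    rw [← mul_pow, hprod]
  have hne2 : ((Real.cos y - Real.sin y * I - r) : ℂ) ^ 2 ≠ 0 := fun h => by
    rw [h, mul_zero] at h2; exact pow_ne_zero 2 hDc h2.symm
  refine mul_right_cancel₀ hne2 ?_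
  rw [mul_assoc _ ((Complex.exp (y * I) - r) ^ 2), h2]
  field_simp
  rw [he]
  push_cast
  linear_combination (r * (Complex.cos y - Complex.sin y * I - 2 * r : ℂ)) *
      ((by exact_mod_cast hsc : (Complex.sin y : ℂ) ^ 2 + (Complex.cos y : ℂ) ^ 2 = 1)) +
    (-r * Complex.sin y ^ 2 * Complex.cos y + r * Complex.sin y ^ 3 * I + 2 * r ^ 2 * Complex.sin y ^ 2 : ℂ) * hI


lemma ball_repr {w : ℂ} (hw : ‖w‖ < 1) : ∃ r θ : ℝ, 0 ≤ r ∧ r < 1 ∧ w = r * Complex.exp (θ * I) :=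
  ⟨‖w‖, w.arg, norm_nonneg _, hw, (Complex.norm_mul_exp_arg_mul_I w).symm⟩

lemma norm_rexp {r : ℝ} (h0 : 0 ≤ r) (θ : ℝ) : ‖(r : ℂ) * Complex.exp (θ * I)‖ = r := by
  rw [norm_mul, Complex.norm_exp_ofReal_mul_I]; simp [abs_of_nonneg h0]

lemma U_arg {U : ℝ → ℝ} (hper : Function.Periodic U (2 * Real.pi)) (θ : ℝ) :
    U (Complex.arg (Complex.exp (θ * I))) = U θ := by
  rw [Complex.arg_exp_mul_I]
  rw [toIocMod]
  exact hper.sub_zsmul_eq _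

lemma circle_shift {E : Type} [NormedAddCommGroup E] [NormedSpace ℝ E]
    (f : ℝ → E) (hf : Function.Periodic f (2 * Real.pi)) (t : ℝ) :
    ∫ θ in (0:ℝ)..(2 * Real.pi), f θ = ∫ y in (-Real.pi)..Real.pi, f (t + y) := by
  rw [intervalIntegral.integral_comp_add_left]
  have := hf.intervalIntegral_add_eq 0 (t + -Real.pi)
  rw [zero_add] at this
  rw [this]
  congr 1
  ring

/-- derivative of `F` -/
lemma F_deriv (U : ℝ → ℝ) (hcont : Continuous U) (hper : Function.Periodic U (2 * Real.pi))
    (F : ℂ → ℂ) (hF : DifferentiableOn ℂ F (Metric.ball 0 1))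
    (hFre : ∀ r θ : ℝ, 0 ≤ r → r < 1 →
      (F ((r : ℂ) * Complex.exp (θ * Complex.I))).re = poisson U r θ)
    (r t : ℝ) (h0 : 0 ≤ r) (h1 : r < 1) :
    ∃ D : ℂ, HasDerivAt F D (r * Complex.exp (t * I)) ∧
      ((r * Complex.exp (t * I)) * D) =
        ((1 / Real.pi * ∫ y in (-Real.pi)..Real.pi, U (t + y) * ka r y : ℝ) : ℂ) +
        ((1 / Real.pi * ∫ y in (-Real.pi)..Real.pi, U (t + y) * kb r y : ℝ) : ℂ) * I := by
  set g : ℂ → ℝ := fun ζ => U ζ.arg with hg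
  have hgc : ∀ θ : ℝ, g (circleMap 0 1 θ) = U θ := by
    intro θ; simp only [hg, circleMap_zero, ofReal_one, one_mul]; exact U_arg hper θ
  have hgi : CircleIntegrable g 0 1 := by
    unfold CircleIntegrable
    simp_rw [hgc]
    exact hcont.intervalIntegrable _ _
  have hgi' : CircleIntegrable (fun ζ => (g ζ : ℂ)) 0 1 := by
    unfold CircleIntegrable
    simp_rw [hgc]
    exact (Complex.continuous_ofReal.comp hcont).intervalIntegrable _ _
  set G : ℂ → ℂ := fun w => Real.circleAverage (fun ζ => herglotzRieszKernel 0 w ζ • (g ζ : ℂ)) 0 1 with hG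
  have hGd := fun (w : ℂ) (hw : w ∈ Metric.ball (0:ℂ) 1) =>
    hasDerivAt_circleAverage_herglotzRieszKernel_smul hgi' hw
  have hGre : ∀ w : ℂ, ‖w‖ < 1 → (G w).re = (F w).re := by
    intro w hw
    obtain ⟨ρ, θ, hρ0, hρ1, rfl⟩ := ball_repr hw
    rw [hFre ρ θ hρ0 hρ1, hG]
    simp only
    rw [re_circleAverage_herglotzRieszKernel_smul hgi (by simpa using hw),
      ← poissonKernel_eq_re_herglotzRieszKernel, Real.circleAverage_def, poisson]
    have e : ∀ x : ℝ, (poissonKernel 0 (ρ * Complex.exp (θ * I)) • g) (circleMap 0 1 x) =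
        (1 - ρ ^ 2) * (U x / (1 - 2 * ρ * Real.cos (θ - x) + ρ ^ 2)) := by
      intro x
      rw [Pi.smul_apply', hgc, poissonKernel, sub_zero, sub_zero, smul_eq_mul, norm_rexp hρ0]
      rw [circleMap_zero, ofReal_one, one_mul, Complex.norm_exp_ofReal_mul_I]
      have : ‖Complex.exp (x * I) - ρ * Complex.exp (θ * I)‖ ^ 2 =
          1 - 2 * ρ * Real.cos (θ - x) + ρ ^ 2 := by
        rw [← Complex.normSq_eq_norm_sq, Complex.normSq_apply, Complex.exp_mul_I, Complex.exp_mul_I,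
          ← Complex.ofReal_cos, ← Complex.ofReal_sin, ← Complex.ofReal_cos, ← Complex.ofReal_sin, Real.cos_sub]
        simp [-Complex.ofReal_cos, -Complex.ofReal_sin]
        nlinarith [Real.sin_sq_add_cos_sq x, Real.sin_sq_add_cos_sq θ,
          congrArg (fun v => ρ ^ 2 * v) (Real.sin_sq_add_cos_sq θ)]
      rw [this]; ring
    simp_rw [e]
    rw [intervalIntegral.integral_const_mul]
    have hp : Function.Periodic (fun x => U x / (1 - 2 * ρ * Real.cos (θ - x) + ρ ^ 2)) (2 * Real.pi) := by
      intro x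
      simp only
      rw [hper, show θ - (x + 2 * Real.pi) = θ - x - 2 * Real.pi by ring, Real.cos_sub_two_pi]
    rw [circle_shift _ hp 0]
    simp only [zero_add, smul_eq_mul]
    ring
  set w : ℂ := r * Complex.exp (t * I) with hw
  have hwn : ‖w‖ < 1 := by rw [hw, norm_rexp h0]; exact h1
  have hwb : w ∈ Metric.ball (0:ℂ) 1 := by simpa using hwn
  have hn := Metric.isOpen_ball.mem_nhds hwb
  have hFd := (hF.differentiableAt hn).hasDerivAt
  have hEq : deriv F w = Real.circleAverage (fun ζ => (2 * ζ / (ζ - w) ^ 2) • (g ζ : ℂ)) 0 1 := by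
    have h3 := deriv_zero_of_re_zero _ w _ (hFd.sub (hGd w hwb)) (by
      filter_upwards [hn] with z hz
      have := hGre z (by simpa using hz)
      simp only [Pi.sub_apply, Complex.sub_re]
      rw [← this]; simp [hG])
    exact sub_eq_zero.1 h3
  refine ⟨deriv F w, hFd, ?_⟩
  rw [hEq, Real.circleAverage_def]
  have hper2 : Function.Periodic (fun θ : ℝ => (2 * circleMap 0 1 θ / (circleMap 0 1 θ - w) ^ 2) • (g (circleMap 0 1 θ) : ℂ)) (2 * Real.pi) := by
    intro θ
    simp only [(periodic_circleMap 0 1) θ]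
  rw [circle_shift _ hper2 t]
  have e : ∀ y : ℝ, (2 * circleMap 0 1 (t + y) / (circleMap 0 1 (t + y) - w) ^ 2) •
      (g (circleMap 0 1 (t + y)) : ℂ) * w =
      2 * (((U (t + y) * ka r y : ℝ) : ℂ) + ((U (t + y) * kb r y : ℝ) : ℂ) * I) := by
    intro y
    have hk := kern_eq h0 h1 y
    rw [hgc, circleMap_zero, ofReal_one, one_mul, hw]
    push_cast
    have h4 : Complex.exp ((t + y) * I) = Complex.exp (t * I) * Complex.exp (y * I) := by
      rw [← Complex.exp_add]; ring_nf
    rw [h4, smul_eq_mul]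
    have h5 : 2 * (Complex.exp (t * I) * Complex.exp (y * I)) /
        (Complex.exp (t * I) * Complex.exp (y * I) - r * Complex.exp (t * I)) ^ 2 * (U (t + y) : ℂ) *
          (r * Complex.exp (t * I)) =
        2 * U (t + y) * (r * Complex.exp (y * I) / (Complex.exp (y * I) - r) ^ 2) := by
      have h6 : Complex.exp (t * I) ≠ 0 := Complex.exp_ne_zero _
      rw [show Complex.exp (t * I) * Complex.exp (y * I) - r * Complex.exp (t * I) =
        Complex.exp (t * I) * (Complex.exp (y * I) - r) by ring, mul_pow]
      field_simp
    rw [h5, hk]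
    ring
  rw [mul_comm, smul_mul_assoc, ← intervalIntegral.integral_mul_const]
  simp_rw [e]
  have c1 : Continuous fun y => U (t + y) * ka r y :=
    (hcont.comp (by fun_prop)).mul (ka_cont h0 h1)
  have c2 : Continuous fun y => U (t + y) * kb r y :=
    (hcont.comp (by fun_prop)).mul (kb_cont h0 h1)
  rw [intervalIntegral.integral_const_mul, intervalIntegral.integral_add,
    intervalIntegral.integral_mul_const, intervalIntegral.integral_ofReal,
    intervalIntegral.integral_ofReal]
  · rw [Complex.real_smul]
    push_cast
    have : (Real.pi : ℂ) ≠ 0 := by exact_mod_cast Real.pi_ne_zero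
    field_simp
  · exact (Complex.continuous_ofReal.comp c1).intervalIntegrable _ _
  · exact ((Complex.continuous_ofReal.comp c2).mul continuous_const).intervalIntegrable _ _

lemma F_symm (U : ℝ → ℝ) (heven : ∀ t, U (-t) = U t)
    (F : ℂ → ℂ) (hF : DifferentiableOn ℂ F (Metric.ball 0 1))
    (hFre : ∀ r θ : ℝ, 0 ≤ r → r < 1 →
      (F ((r : ℂ) * Complex.exp (θ * Complex.I))).re = poisson U r θ)
    (hFim : (F 0).im = 0) {z : ℂ} (hz : ‖z‖ < 1) :
    F ((starRingEnd ℂ) z) = (starRingEnd ℂ) (F z) := by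
  have hp : ∀ r θ, poisson U r (-θ) = poisson U r θ := by
    intro r θ
    unfold poisson
    congr 1
    rw [← neg_neg Real.pi, ← intervalIntegral.integral_comp_neg]
    simp only [neg_neg]
    refine intervalIntegral.integral_congr fun x _ => ?_
    beta_reduce
    rw [heven, show -θ - -x = -(θ - x) by ring, Real.cos_neg]
  set H : ℂ → ℂ := fun z => F z - (starRingEnd ℂ) (F ((starRingEnd ℂ) z)) with hH
  have hHd : DifferentiableOn ℂ H (Metric.ball 0 1) := by
    intro w hw
    have hw' : (starRingEnd ℂ) w ∈ Metric.ball (0:ℂ) 1 := by simpa using hw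
    have h1 := hF.differentiableAt (Metric.isOpen_ball.mem_nhds hw)
    have h2 := hF.differentiableAt (Metric.isOpen_ball.mem_nhds hw')
    have h3 : DifferentiableAt ℂ ((starRingEnd ℂ) ∘ F ∘ (starRingEnd ℂ)) w := by
      have := h2.hasDerivAt.conj_conj
      simp only [Complex.conj_conj] at this
      exact this.differentiableAt
    exact (h1.sub h3).differentiableWithinAt
  have hHre : ∀ w, ‖w‖ < 1 → (H w).re = 0 := by
    intro w hw
    obtain ⟨r, θ, h0, h1, rfl⟩ := ball_repr hw
    have : (starRingEnd ℂ) (r * Complex.exp (θ * I)) = r * Complex.exp ((-θ : ℝ) * I) := by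
      rw [map_mul, ← Complex.exp_conj]; simp
    simp only [hH, Complex.sub_re, Complex.conj_re]
    rw [this, hFre r θ h0 h1, hFre r (-θ) h0 h1, hp]; ring
  have h4 := const_of_re_zero H hHd hHre hz
  have h5 : H 0 = 0 := by
    simp only [hH, map_zero]
    apply Complex.ext <;> simp [hFim]
  rw [h5] at h4
  have h6 : F z = (starRingEnd ℂ) (F ((starRingEnd ℂ) z)) := sub_eq_zero.1 h4
  rw [h6, Complex.conj_conj]

structure UD (U U' U'' : ℝ → ℝ) (C₀ : ℝ) : Prop where
  cont : Continuous U
  even : ∀ t, U (-t) = U t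
  per : Function.Periodic U (2 * Real.pi)
  zero : U 0 = 0
  mono : MonotoneOn U (Set.Icc 0 Real.pi)
  pos : ∀ t, 0 < t → t ≤ Real.pi → 0 < U t
  htop : Tendsto (fun t => hU U t) (nhdsWithin 0 (Set.Ioi 0)) atTop
  d1 : ∀ t ∈ Set.Ioc (0 : ℝ) Real.pi, HasDerivAt U (U' t) t
  d2 : ∀ t ∈ Set.Ioc (0 : ℝ) Real.pi, HasDerivAt U' (U'' t) t
  lo : Tendsto (fun t => (U t / t) / Real.log (hU U t)) (nhdsWithin 0 (Set.Ioi 0)) (nhds 0)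
  C0 : 0 < C₀
  bd : ∀ t : ℝ, 0 < t → t ≤ Real.pi / 2 → t * U' t ≤ C₀ * U t ∧ t ^ 2 * |U'' t| ≤ C₀ * U t

lemma pi_sq_le : Real.pi ^ 2 ≤ 10 := by
  nlinarith [Real.pi_lt_d2, Real.pi_pos]

lemma sin_half_sq {y : ℝ} (h0 : 0 ≤ y) (h1 : y ≤ Real.pi) :
    y ^ 2 ≤ 10 * Real.sin (y / 2) ^ 2 ∧ 4 * Real.sin (y / 2) ^ 2 ≤ y ^ 2 := by
  have hp := Real.pi_pos
  constructor
  · have h := Real.mul_le_sin (x := y / 2) (by linarith) (by linarith)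
    have h2 : 2 / Real.pi * (y / 2) = y / Real.pi := by field_simp
    rw [h2, div_le_iff₀ hp] at h
    have : y ^ 2 ≤ (Real.sin (y / 2) * Real.pi) ^ 2 := by gcongr
    rw [mul_pow] at this
    nlinarith [pi_sq_le, sq_nonneg (Real.sin (y / 2))]
  · have h := Real.sin_le (x := y / 2) (by linarith)
    have h3 : 0 ≤ Real.sin (y / 2) := Real.sin_nonneg_of_nonneg_of_le_pi (by linarith) (by linarith)
    nlinarith


lemma r_div_D {r : ℝ} (hr : 1 / 2 ≤ r) (hr1 : r < 1) {y : ℝ} (h0 : 0 < y) (h1 : y ≤ Real.pi) : r / Dr r y ≤ 5 / (2 * y ^ 2) := by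
  rw [div_le_div_iff₀ (Dr_pos (by linarith) hr1 y) (by positivity), Dr_eq]
  have := (sin_half_sq h0.le h1).1
  nlinarith [sq_nonneg (1 - r), mul_le_mul_of_nonneg_left this (show 0 ≤ r by linarith)]

lemma ka_le {r : ℝ} (hr : 1 / 2 ≤ r) (hr1 : r < 1) (y : ℝ) : |ka r y| ≤ r / Dr r y := by
  have hD := Dr_pos (by linarith : 0 ≤ r) hr1 y
  have h1 : |(1 + r ^ 2) * Real.cos y - 2 * r| ≤ Dr r y := by
    apply abs_le_of_sq_le_sq _ hD.le
    have : ((1 + r ^ 2) * Real.cos y - 2 * r) ^ 2 + ((1 - r ^ 2) * Real.sin y) ^ 2 = Dr r y ^ 2 := by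
      unfold Dr
      nlinarith [Real.sin_sq_add_cos_sq y, congrArg (fun v => (1 - r ^ 2) ^ 2 * v) (Real.sin_sq_add_cos_sq y)]
    nlinarith [sq_nonneg ((1 - r ^ 2) * Real.sin y)]
  unfold ka
  rw [abs_div, abs_mul, abs_of_nonneg (by linarith : 0 ≤ r), abs_of_nonneg (sq_nonneg (Dr r y)),
    div_le_div_iff₀ (by positivity) hD]
  calc r * |(1 + r ^ 2) * Real.cos y - 2 * r| * Dr r y ≤ r * Dr r y * Dr r y := by gcongr
    _ = _ := by ring

lemma kb_le {r : ℝ} (hr : 1 / 2 ≤ r) (hr1 : r < 1) (y : ℝ) : |kb r y| ≤ r / Dr r y := by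
  have hD := Dr_pos (by linarith : 0 ≤ r) hr1 y
  have h1 : |(1 - r ^ 2) * Real.sin y| ≤ Dr r y := by
    apply abs_le_of_sq_le_sq _ hD.le
    have : ((1 + r ^ 2) * Real.cos y - 2 * r) ^ 2 + ((1 - r ^ 2) * Real.sin y) ^ 2 = Dr r y ^ 2 := by
      unfold Dr
      nlinarith [Real.sin_sq_add_cos_sq y, congrArg (fun v => (1 - r ^ 2) ^ 2 * v) (Real.sin_sq_add_cos_sq y)]
    nlinarith [sq_nonneg ((1 + r ^ 2) * Real.cos y - 2 * r)]
  unfold kb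
  rw [abs_div, abs_neg, mul_assoc, abs_mul, abs_of_nonneg (by linarith : 0 ≤ r), abs_of_nonneg (sq_nonneg (Dr r y)),
    div_le_div_iff₀ (by positivity) hD]
  calc r * |(1 - r ^ 2) * Real.sin y| * Dr r y ≤ r * Dr r y * Dr r y := by gcongr
    _ = _ := by ring

lemma ka_far {r : ℝ} (hr : 1 / 2 ≤ r) (hr1 : r < 1) {t y : ℝ} (ht : 1 - r ≤ t / (4 * Real.pi)) (hy : t / 2 ≤ y) (h0 : 0 < y) (h1 : y ≤ Real.pi) :
    1 / (6 * y ^ 2) ≤ - ka r y := by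
  have hD := Dr_pos (by linarith : 0 ≤ r) hr1 y
  obtain ⟨hs1, hs2⟩ := sin_half_sq h0.le h1
  have hcos : Real.cos y = 1 - 2 * Real.sin (y / 2) ^ 2 := by
    have := Real.cos_two_mul (y / 2)
    rw [show 2 * (y / 2) = y by ring] at this
    rw [this, Real.cos_sq']; ring
  set S := Real.sin (y / 2) ^ 2 with hS
  have hS0 : 0 ≤ S := sq_nonneg _
  have hSpos : 0 < S := by nlinarith [pow_pos h0 2]
  have hp := Real.pi_gt_three
  have hrr : (1 - r) ^ 2 ≤ S / 3 := by
    have h3 : 1 - r ≤ y / (2 * Real.pi) := by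
      refine ht.trans ?_
      rw [div_le_div_iff₀ (by positivity) (by positivity)]; nlinarith
    have h4 : y / (2 * Real.pi) ≤ y / 6 := by gcongr; linarith
    have h5 : (1 - r) ^ 2 ≤ (y / 6) ^ 2 := by gcongr; linarith
    nlinarith
  have hDe := Dr_eq r y
  rw [← hS] at hDe
  have hDle : Dr r y ≤ S / 3 + 4 * S := by rw [hDe]; nlinarith
  have hnum : r * (5 / 3 * S) ≤ -(r * ((1 + r ^ 2) * Real.cos y - 2 * r)) := by
    rw [hcos]; nlinarith [mul_nonneg (mul_nonneg (show 0 ≤ r by linarith) (sq_nonneg r)) hS0]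
  have h6 : - ka r y = -(r * ((1 + r ^ 2) * Real.cos y - 2 * r)) / Dr r y ^ 2 := by
    unfold ka; rw [neg_div]
  rw [h6, div_le_div_iff₀ (by positivity) (by positivity), one_mul]
  have h7 : Dr r y ^ 2 ≤ (13 / 3 * S) ^ 2 := by gcongr; linarith
  have h8 : 5 / 6 * S ≤ -(r * ((1 + r ^ 2) * Real.cos y - 2 * r)) := by nlinarith
  calc Dr r y ^ 2 ≤ (13 / 3 * S) ^ 2 := h7
    _ ≤ 5 / 6 * S * (6 * (4 * S)) := by nlinarith
    _ ≤ _ := by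
      have h9 : 0 ≤ -(r * ((1 + r ^ 2) * Real.cos y - 2 * r)) := by linarith
      gcongr

lemma kb_near {r : ℝ} (hr : 1 / 2 ≤ r) (hr1 : r < 1) {y : ℝ} (h0 : 0 ≤ y) (h1 : y ≤ Real.pi) :
    y * |kb r y| ≤ 5 / 2 * ((1 - r ^ 2) / Dr r y) := by
  rcases h0.eq_or_lt with h | h
  · rw [← h, zero_mul]
    have := Dr_pos (by linarith : 0 ≤ r) hr1 0
    have : 0 ≤ 1 - r ^ 2 := by nlinarith
    positivity
  have hD := Dr_pos (by linarith : 0 ≤ r) hr1 y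
  have h2 := r_div_D hr hr1 h h1
  have hr2 : 0 ≤ 1 - r ^ 2 := by nlinarith
  have hs0 : 0 ≤ Real.sin y := Real.sin_nonneg_of_nonneg_of_le_pi h0 h1
  have hs1 : Real.sin y ≤ y := Real.sin_le h0
  unfold kb
  rw [abs_div, abs_neg, abs_of_nonneg (sq_nonneg (Dr r y)), abs_of_nonneg (by positivity)]
  have e : y * (r * (1 - r ^ 2) * Real.sin y / Dr r y ^ 2) =
      (y * Real.sin y * (r / Dr r y)) * ((1 - r ^ 2) / Dr r y) := by field_simp
  rw [e]
  refine mul_le_mul_of_nonneg_right ?_ (by positivity)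
  calc y * Real.sin y * (r / Dr r y) ≤ y * y * (5 / (2 * y ^ 2)) := by gcongr
    _ = 5 / 2 := by field_simp

lemma P_cont {r : ℝ} (hr : 1 / 2 ≤ r) (hr1 : r < 1) : Continuous fun y => (1 - r ^ 2) / Dr r y :=
  continuous_const.div (Dr_cont r) fun y => (Dr_pos (by linarith) hr1 y).ne'

lemma P_integral {r : ℝ} (hr : 1 / 2 ≤ r) (hr1 : r < 1) : ∫ y in (0:ℝ)..Real.pi, (1 - r ^ 2) / Dr r y = Real.pi := by
  have h := DiffContOnCl.circleAverage_poissonKernel_smul (f := fun _ : ℂ => (1:ℂ)) (c := 0) (R := 1)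
    (w := (r : ℂ)) diffContOnCl_const (by simp [abs_of_nonneg (by linarith : 0 ≤ r), hr1])
  rw [Real.circleAverage_def] at h
  have e : ∀ x : ℝ, (poissonKernel 0 (r : ℂ) • fun _ : ℂ => (1:ℂ)) (circleMap 0 1 x) =
      (((1 - r ^ 2) / Dr r x : ℝ) : ℂ) := by
    intro x
    rw [Pi.smul_apply', poissonKernel, sub_zero, sub_zero, circleMap_zero, ofReal_one, one_mul,
      Complex.norm_exp_ofReal_mul_I]
    have : ‖Complex.exp (x * I) - r‖ ^ 2 = Dr r x := by
      rw [← Complex.normSq_eq_norm_sq, Complex.normSq_apply, Complex.exp_mul_I,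
        ← Complex.ofReal_cos, ← Complex.ofReal_sin]
      simp [-Complex.ofReal_cos, -Complex.ofReal_sin, Dr]
      nlinarith [Real.sin_sq_add_cos_sq x]
    rw [this, Complex.norm_real, Real.norm_of_nonneg (by linarith)]
    simp
  simp_rw [e] at h
  rw [intervalIntegral.integral_ofReal, Complex.real_smul, ← ofReal_mul] at h
  have h2 : (2 * Real.pi)⁻¹ * ∫ x in (0:ℝ)..(2 * Real.pi), (1 - r ^ 2) / Dr r x = 1 := by exact_mod_cast h
  have hp : Function.Periodic (fun x => (1 - r ^ 2) / Dr r x) (2 * Real.pi) := by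
    intro x; simp [Dr]
  rw [circle_shift _ hp 0] at h2
  simp only [zero_add] at h2
  have hc := P_cont hr hr1
  rw [← intervalIntegral.integral_add_adjacent_intervals (b := 0) (hc.intervalIntegrable _ _)
    (hc.intervalIntegrable _ _)] at h2
  have h3 : ∫ x in (-Real.pi)..0, (1 - r ^ 2) / Dr r x = ∫ x in (0:ℝ)..Real.pi, (1 - r ^ 2) / Dr r x := by
    have := intervalIntegral.integral_comp_neg (a := 0) (b := Real.pi) (fun x => (1 - r ^ 2) / Dr r x)
    simp only [Dr_neg, neg_zero] at this
    exact this.symm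
  rw [h3] at h2
  have hpi := Real.pi_pos
  field_simp at h2
  linarith

lemma ka_integral {r : ℝ} (hr : 1 / 2 ≤ r) (hr1 : r < 1) : ∫ y in (0:ℝ)..Real.pi, ka r y = 0 := by
  have hd : ∀ y ∈ uIcc (0:ℝ) Real.pi, HasDerivAt (fun y => r * Real.sin y / Dr r y) (ka r y) y := by
    intro y _
    have hD := Dr_pos (by linarith : 0 ≤ r) hr1 y
    have h1 : HasDerivAt (Dr r) (2 * r * Real.sin y) y := by
      have := (((Real.hasDerivAt_cos y).const_mul (2 * r)).const_sub 1).add_const (r ^ 2)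
      refine this.congr_deriv (by ring)
    refine (((Real.hasDerivAt_sin y).const_mul r).div h1 hD.ne').congr_deriv ?_
    unfold ka
    congr 1
    unfold Dr
    linear_combination (-2 * r ^ 2) * (Real.sin_sq_add_cos_sq y)
  rw [intervalIntegral.integral_eq_sub_of_hasDerivAt hd
    ((ka_cont (by linarith) hr1).intervalIntegrable _ _)]
  simp


lemma integral_symm (f : ℝ → ℝ) (hf : Continuous f) :
    ∫ y in (-Real.pi)..Real.pi, f y = ∫ y in (0:ℝ)..Real.pi, (f y + f (-y)) := by
  have hc : Continuous fun y => f (-y) := hf.comp continuous_neg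
  rw [← intervalIntegral.integral_add_adjacent_intervals (b := 0) (hf.intervalIntegrable _ _)
    (hf.intervalIntegrable _ _), intervalIntegral.integral_add (hf.intervalIntegrable _ _)
    (hc.intervalIntegrable _ _), intervalIntegral.integral_comp_neg]
  simp [add_comm]

section basics
variable {U U' U'' : ℝ → ℝ} {C₀ : ℝ}

lemma UD.exists_rep (H : UD U U' U'' C₀) (x : ℝ) : ∃ y, 0 ≤ y ∧ y ≤ Real.pi ∧ U x = U y := by
  obtain ⟨y, hy, h⟩ := H.per.exists_mem_Ico (by positivity) x (-Real.pi)
  refine ⟨|y|, abs_nonneg _, abs_le.2 ⟨hy.1, by linarith [hy.2]⟩, ?_⟩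
  rw [h]
  rcases abs_choice y with h | h <;> rw [h]
  rw [H.even]

lemma UD.nonneg (H : UD U U' U'' C₀) (x : ℝ) : 0 ≤ U x := by
  obtain ⟨y, h0, h1, h⟩ := H.exists_rep x
  rw [h]
  rcases h0.eq_or_lt with h | h
  · rw [← h, H.zero]
  · exact (H.pos y h h1).le

lemma UD.le_pi (H : UD U U' U'' C₀) (x : ℝ) : U x ≤ U Real.pi := by
  obtain ⟨y, h0, h1, h⟩ := H.exists_rep x
  rw [h]
  exact H.mono ⟨h0, h1⟩ ⟨Real.pi_pos.le, le_rfl⟩ h1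

lemma UD.le_of_abs (H : UD U U' U'' C₀) {x y : ℝ} (h : |x| ≤ y) (hy : y ≤ Real.pi) : U x ≤ U y := by
  have : U x = U |x| := by
    rcases abs_choice x with h | h <;> rw [h]
    rw [H.even]
  rw [this]
  exact H.mono ⟨abs_nonneg _, h.trans hy⟩ ⟨(abs_nonneg _).trans h, hy⟩ h

lemma UD.log_anti (H : UD U U' U'' C₀) :
    AntitoneOn (fun t => Real.log (U t) - C₀ * Real.log t) (Ioc 0 (Real.pi / 2)) := by
  have hp := Real.pi_pos
  have hd : ∀ t ∈ Ioc 0 (Real.pi / 2), HasDerivAt (fun t => Real.log (U t) - C₀ * Real.log t)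
      (U' t / U t - C₀ * t⁻¹) t := by
    intro t ht
    have hU := H.pos t ht.1 (by linarith [ht.2])
    exact ((H.d1 t ⟨ht.1, by linarith [ht.2]⟩).log hU.ne').sub
      ((Real.hasDerivAt_log ht.1.ne').const_mul C₀)
  apply antitoneOn_of_deriv_nonpos (convex_Ioc _ _)
  · exact fun t ht => (hd t ht).continuousAt.continuousWithinAt
  · intro t ht
    rw [interior_Ioc] at ht
    exact (hd t ⟨ht.1, ht.2.le⟩).differentiableAt.differentiableWithinAt
  · intro t ht
    rw [interior_Ioc] at ht
    rw [(hd t ⟨ht.1, ht.2.le⟩).deriv]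
    have hU := H.pos t ht.1 (by linarith [ht.2])
    have := (H.bd t ht.1 ht.2.le).1
    rw [sub_nonpos, ← div_eq_mul_inv, div_le_div_iff₀ hU ht.1]
    linarith

lemma UD.doubling (H : UD U U' U'' C₀) : ∃ K : ℝ, 1 ≤ K ∧ ∀ y, 0 < y → y ≤ Real.pi → ∀ x, |x| ≤ 3 * y →
    U x ≤ K * U y := by
  have hp := Real.pi_pos
  have h6 := H.pos (Real.pi / 6) (by positivity) (by linarith)
  refine ⟨max (Real.exp (C₀ * Real.log 3)) (U Real.pi / U (Real.pi / 6)), ?_, ?_⟩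
  · apply le_max_of_le_right
    rw [one_le_div h6]
    exact H.le_pi _
  · intro y hy hy1 x hx
    have hUy := H.pos y hy hy1
    rcases le_total (Real.pi / 6) y with h | h
    · calc U x ≤ U Real.pi := H.le_pi x
        _ = U Real.pi / U (Real.pi / 6) * U (Real.pi / 6) := by field_simp
        _ ≤ U Real.pi / U (Real.pi / 6) * U y := by
            have := H.nonneg Real.pi
            have := H.mono ⟨by positivity, by linarith⟩ ⟨hy.le, hy1⟩ h
            gcongr
        _ ≤ _ := by gcongr; exact le_max_right _ _
    · have h3 : 3 * y ≤ Real.pi / 2 := by linarith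
      have hU3 := H.pos (3 * y) (by positivity) (by linarith)
      have h1 : U x ≤ U (3 * y) := H.le_of_abs hx (by linarith)
      have h2 := H.log_anti ⟨hy, by linarith⟩ ⟨by positivity, h3⟩ (by linarith : y ≤ 3 * y)
      simp only at h2
      rw [Real.log_mul (by norm_num) hy.ne'] at h2
      have h4 : Real.log (U (3 * y)) ≤ C₀ * Real.log 3 + Real.log (U y) := by linarith
      have h5 : U (3 * y) ≤ Real.exp (C₀ * Real.log 3) * U y := by
        have h7 := Real.exp_le_exp.2 h4
        rwa [Real.exp_add, Real.exp_log hU3, Real.exp_log hUy] at h7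
      calc U x ≤ _ := h1.trans h5
        _ ≤ _ := by gcongr; exact le_max_left _ _

lemma UD.ii (H : UD U U' U'' C₀) {a b : ℝ} (ha : 0 < a) (hb : 0 < b) :
    IntervalIntegrable (fun x => U x / x ^ 2) volume a b := by
  apply ContinuousOn.intervalIntegrable
  apply H.cont.continuousOn.div (by fun_prop)
  intro x hx
  have : 0 < x := lt_of_lt_of_le (lt_min ha hb) hx.1
  positivity

lemma UD.h_sub (H : UD U U' U'' C₀) {a b : ℝ} (ha : 0 < a) (hb : 0 < b) :
    hU U a - hU U b = ∫ x in a..b, U x / x ^ 2 := by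
  unfold hU
  rw [sub_eq_iff_eq_add, intervalIntegral.integral_add_adjacent_intervals (H.ii ha hb)
    (H.ii hb Real.pi_pos)]

lemma UD.h_deriv (H : UD U U' U'' C₀) {t : ℝ} (ht : 0 < t) :
    HasDerivAt (hU U) (-(U t / t ^ 2)) t := by
  unfold hU
  have hc : ContinuousOn (fun x => U x / x ^ 2) (Ioi 0) := by
    apply H.cont.continuousOn.div (by fun_prop)
    intro x hx
    have : 0 < x := hx
    positivity
  apply intervalIntegral.integral_hasDerivAt_left (H.ii ht Real.pi_pos)
  · exact hc.stronglyMeasurableAtFilter isOpen_Ioi t ht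
  · exact hc.continuousAt (Ioi_mem_nhds ht)

lemma UD.h_anti (H : UD U U' U'' C₀) {a b : ℝ} (ha : 0 < a) (hab : a ≤ b) : hU U b ≤ hU U a := by
  have := H.h_sub ha (ha.trans_le hab)
  have h2 : 0 ≤ ∫ x in a..b, U x / x ^ 2 :=
    intervalIntegral.integral_nonneg hab fun x _ => div_nonneg (H.nonneg x) (sq_nonneg x)
  linarith

lemma UD.h_nonneg (H : UD U U' U'' C₀) {a : ℝ} (_ha : 0 < a) (hp : a ≤ Real.pi) : 0 ≤ hU U a :=
  intervalIntegral.integral_nonneg hp fun x _ => div_nonneg (H.nonneg x) (sq_nonneg x)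

lemma UD.h_half (H : UD U U' U'' C₀) {t : ℝ} (ht : 0 < t) (hp : t ≤ Real.pi) :
    hU U (t / 2) ≤ hU U t + 2 * (U t / t) := by
  have h1 := H.h_sub (half_pos ht) ht
  have h2 : ∫ x in (t/2)..t, U x / x ^ 2 ≤ ∫ x in (t/2)..t, U t / (t / 2) ^ 2 := by
    apply intervalIntegral.integral_mono_on (by linarith) (H.ii (half_pos ht) ht) (by simp)
    intro x hx
    have h3 : U x ≤ U t := H.mono ⟨by linarith [hx.1], by linarith [hx.2]⟩ ⟨ht.le, hp⟩ hx.2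
    have := H.nonneg t
    have := hx.1
    gcongr
  rw [intervalIntegral.integral_const, smul_eq_mul] at h2
  have h4 : (t - t / 2) * (U t / (t / 2) ^ 2) = 2 * (U t / t) := by field_simp; ring
  linarith

lemma ev_pos {P : ℝ → Prop} (h : ∀ᶠ t in nhdsWithin (0:ℝ) (Ioi 0), P t) :
    ∃ δ > 0, ∀ t, 0 < t → t ≤ δ → P t := by
  rw [eventually_nhdsWithin_iff, Metric.eventually_nhds_iff] at h
  obtain ⟨ε, he, h⟩ := h
  refine ⟨ε / 2, by positivity, fun t h0 h1 => h ?_ h0⟩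
  rw [Real.dist_eq, sub_zero, abs_of_pos h0]; linarith

lemma UD.small (H : UD U U' U'' C₀) (ε : ℝ) (he : 0 < ε) :
    ∀ᶠ t in nhdsWithin (0:ℝ) (Ioi 0), U t / t ≤ ε * hU U t := by
  have h1 := H.lo.eventually (gt_mem_nhds he)
  have h2 := H.htop.eventually_ge_atTop (Real.exp 1)
  filter_upwards [h1, h2] with t h1 h2
  have h0 : 0 < hU U t := (Real.exp_pos _).trans_le h2
  have h3 : 1 ≤ Real.log (hU U t) := by rwa [Real.le_log_iff_exp_le h0]
  rw [div_lt_iff₀ (by linarith)] at h1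
  have := Real.log_le_sub_one_of_pos h0
  nlinarith

lemma UD.h_ii (H : UD U U' U'' C₀) {a b : ℝ} (ha : 0 < a) (hb : 0 < b) :
    IntervalIntegrable (hU U) volume a b := by
  apply ContinuousOn.intervalIntegrable
  intro x hx
  have : 0 < x := lt_of_lt_of_le (lt_min ha hb) hx.1
  exact (H.h_deriv this).continuousAt.continuousWithinAt

/-- If `U/t ≤ h/2` on `(0,b]`, the integral of `h` is controlled. -/
lemma UD.int_h (H : UD U U' U'' C₀) {a b : ℝ} (ha : 0 < a) (hab : a ≤ b) (hb : b ≤ Real.pi)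
    (hs : ∀ t, 0 < t → t ≤ b → U t / t ≤ 1 / 2 * hU U t) :
    ∫ x in a..b, hU U x ≤ 2 * (b * hU U b) := by
  have hb0 := ha.trans_le hab
  have hpos : ∀ x ∈ uIcc a b, 0 < x := fun x hx => lt_of_lt_of_le (lt_min ha hb0) hx.1
  have hd : ∀ x ∈ uIcc a b, HasDerivAt (fun x => x * hU U x) (hU U x - U x / x) x := by
    intro x hx
    have h0 := hpos x hx
    refine ((hasDerivAt_id x).mul (H.h_deriv h0)).congr_deriv ?_
    simp only [id]; field_simp
    ring
  have hi : IntervalIntegrable (fun x => U x / x) volume a b := by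
    apply ContinuousOn.intervalIntegrable
    exact H.cont.continuousOn.div (by fun_prop) fun x hx => (hpos x hx).ne'
  have h1 := intervalIntegral.integral_eq_sub_of_hasDerivAt hd ((H.h_ii ha hb0).sub hi)
  have h2 : ∫ x in a..b, 1 / 2 * hU U x ≤ ∫ x in a..b, (hU U x - U x / x) := by
    apply intervalIntegral.integral_mono_on hab ((H.h_ii ha hb0).const_mul _) ((H.h_ii ha hb0).sub hi)
    intro x hx
    have := hs x (ha.trans_le hx.1) hx.2
    linarith
  rw [intervalIntegral.integral_const_mul] at h2
  have := mul_nonneg ha.le (H.h_nonneg ha (hab.trans hb))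
  linarith

lemma UD.th_small (H : UD U U' U'' C₀) (ε : ℝ) (he : 0 < ε) :
    ∀ᶠ t in nhdsWithin (0:ℝ) (Ioi 0), t * hU U t ≤ ε := by
  have hp := Real.pi_pos
  have h1 : ∀ᶠ t in nhdsWithin (0:ℝ) (Ioi 0), U t < ε / 2 := by
    have h3 : Tendsto U (nhds 0) (nhds 0) := by
      have := H.cont.tendsto 0; rwa [H.zero] at this
    exact (h3.mono_left nhdsWithin_le_nhds).eventually (gt_mem_nhds (by positivity))
  obtain ⟨δ, hδ, h1⟩ := ev_pos h1
  set d := min δ Real.pi with hd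
  have hd0 : 0 < d := lt_min hδ hp
  have h2 : ∀ᶠ t in nhdsWithin (0:ℝ) (Ioi 0), t * hU U d < ε / 2 := by
    have h3 : Tendsto (fun t => t * hU U d) (nhds 0) (nhds 0) := by
      have : Continuous fun t : ℝ => t * hU U d := by fun_prop
      have := this.tendsto 0; simpa using this
    exact (h3.mono_left nhdsWithin_le_nhds).eventually (gt_mem_nhds (by positivity))
  have h3 : ∀ᶠ t in nhdsWithin (0:ℝ) (Ioi 0), t < d :=
    nhdsWithin_le_nhds (gt_mem_nhds hd0)
  filter_upwards [h2, h3, self_mem_nhdsWithin] with t h2 h3 h0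
  have h0 : 0 < t := h0
  have h4 := H.h_sub h0 hd0
  have h5 : ∫ x in t..d, U x / x ^ 2 ≤ ∫ x in t..d, ε / 2 * (1 / x ^ 2) := by
    apply intervalIntegral.integral_mono_on h3.le (H.ii h0 hd0)
    · apply ContinuousOn.intervalIntegrable
      apply continuousOn_const.mul
      apply continuousOn_const.div (by fun_prop)
      intro x hx
      have : 0 < x := lt_of_lt_of_le (lt_min h0 hd0) hx.1
      positivity
    · intro x hx
      have hx0 := h0.trans_le hx.1
      rw [mul_one_div]
      gcongr
      exact (h1 x hx0 (hx.2.trans (min_le_left _ _))).le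
  have h6 : ∫ x in t..d, ε / 2 * (1 / x ^ 2) = ε / 2 * (1 / t - 1 / d) := by
    rw [intervalIntegral.integral_const_mul]
    congr 1
    have hdv : ∀ x ∈ uIcc t d, HasDerivAt (fun x : ℝ => - x⁻¹) (1 / x ^ 2) x := by
      intro x hx
      have hx0 : 0 < x := lt_of_lt_of_le (lt_min h0 hd0) hx.1
      refine (hasDerivAt_inv hx0.ne').neg.congr_deriv ?_
      simp
    rw [intervalIntegral.integral_eq_sub_of_hasDerivAt hdv]
    · simp only [one_div]; ring
    · apply ContinuousOn.intervalIntegrable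
      apply continuousOn_const.div (by fun_prop)
      intro x hx
      have : 0 < x := lt_of_lt_of_le (lt_min h0 hd0) hx.1
      positivity
  have h7 : t * (ε / 2 * (1 / t - 1 / d)) ≤ ε / 2 := by
    have : t * (ε / 2 * (1 / t - 1 / d)) = ε / 2 - ε / 2 * (t / d) := by field_simp
    rw [this]
    have : 0 ≤ ε / 2 * (t / d) := by positivity
    linarith
  have h8 : t * (∫ x in t..d, U x / x ^ 2) ≤ t * (ε / 2 * (1 / t - 1 / d)) := by
    rw [← h6]; gcongr
  have h9 : hU U t = hU U d + ∫ x in t..d, U x / x ^ 2 := by linarith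
  rw [h9, mul_add]
  linarith

end basics

def Dt2 (U : ℝ → ℝ) (t y : ℝ) : ℝ := U (t + y) + U (t - y) - 2 * U t
def Dt1 (U : ℝ → ℝ) (t y : ℝ) : ℝ := U (t + y) - U (t - y)

section est
variable {U U' U'' : ℝ → ℝ} {C₀ : ℝ}

lemma Dt2_cont (hc : Continuous U) (t : ℝ) : Continuous (Dt2 U t) := by unfold Dt2; fun_prop
lemma Dt1_cont (hc : Continuous U) (t : ℝ) : Continuous (Dt1 U t) := by unfold Dt1; fun_prop

lemma A_eq (hc : Continuous U) {r : ℝ} (hr : 1 / 2 ≤ r) (hr1 : r < 1) (t : ℝ) :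
    ∫ y in (-Real.pi)..Real.pi, U (t + y) * ka r y = ∫ y in (0:ℝ)..Real.pi, Dt2 U t y * ka r y := by
  have hk := ka_cont (by linarith : 0 ≤ r) hr1
  rw [integral_symm _ (by fun_prop)]
  have e : ∀ y, U (t + y) * ka r y + U (t + -y) * ka r (-y) = Dt2 U t y * ka r y + 2 * U t * ka r y := by
    intro y
    rw [ka_neg, Dt2, ← sub_eq_add_neg]; ring
  simp_rw [e]
  have hd := Dt2_cont hc t
  rw [intervalIntegral.integral_add (Continuous.intervalIntegrable (by fun_prop) _ _)
    (Continuous.intervalIntegrable (by fun_prop) _ _), intervalIntegral.integral_const_mul,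
    ka_integral hr hr1]
  ring

lemma B_eq (hc : Continuous U) {r : ℝ} (hr : 1 / 2 ≤ r) (hr1 : r < 1) (t : ℝ) :
    ∫ y in (-Real.pi)..Real.pi, U (t + y) * kb r y = ∫ y in (0:ℝ)..Real.pi, Dt1 U t y * kb r y := by
  have hk := kb_cont (by linarith : 0 ≤ r) hr1
  rw [integral_symm _ (by fun_prop)]
  have e : ∀ y, U (t + y) * kb r y + U (t + -y) * kb r (-y) = Dt1 U t y * kb r y := by
    intro y
    rw [kb_neg, Dt1, ← sub_eq_add_neg]; ring
  simp_rw [e]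

lemma UD.Dt1_near (H : UD U U' U'' C₀) {K : ℝ}
    (hK : ∀ y, 0 < y → y ≤ Real.pi → ∀ x, |x| ≤ 3 * y → U x ≤ K * U y)
    {t y : ℝ} (ht : 0 < t) (ht1 : t ≤ Real.pi / 3) (hy : 0 ≤ y) (hy1 : y ≤ t / 2) :
    |Dt1 U t y| ≤ 2 * y * (2 * C₀ * K * (U t / t)) := by
  have hp := Real.pi_pos
  have h0 : 0 ≤ Dt1 U t y := by
    unfold Dt1
    have := H.mono (a := t - y) (b := t + y) ⟨by linarith, by linarith⟩ ⟨by linarith, by linarith⟩ (by linarith)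
    linarith
  rw [abs_of_nonneg h0]
  have hd : ∀ x ∈ Icc (t - y) (t + y), HasDerivAt U (U' x) x := fun x hx =>
    H.d1 x ⟨by linarith [hx.1], by linarith [hx.2]⟩
  have := (convex_Icc (t - y) (t + y)).image_sub_le_mul_sub_of_deriv_le (f := U)
    (fun x hx => (hd x hx).continuousAt.continuousWithinAt)
    (fun x hx => (hd x (interior_subset hx)).differentiableAt.differentiableWithinAt)
    (C := 2 * C₀ * K * (U t / t)) (by
      intro x hx
      have hx := interior_subset hx
      rw [(hd x hx).deriv]
      have hx0 : t / 2 ≤ x := by linarith [hx.1]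
      have hx00 : 0 < x := by linarith
      have h1 := (H.bd x hx00 (by linarith [hx.2])).1
      have h2 := hK t ht (by linarith) x (by rw [abs_of_pos hx00]; linarith [hx.2])
      have h3 : U' x ≤ C₀ * U x / x := by rw [le_div_iff₀ hx00]; linarith
      have := H.C0
      have h5 : 0 ≤ K * U t := (H.nonneg x).trans h2
      calc U' x ≤ C₀ * U x / x := h3
        _ ≤ C₀ * (K * U t) / (t / 2) := by gcongr
        _ = _ := by field_simp)
    (t - y) ⟨le_rfl, by linarith⟩ (t + y) ⟨by linarith, le_rfl⟩ (by linarith)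
  unfold Dt1
  linarith

lemma UD.Dt2_near (H : UD U U' U'' C₀) {K : ℝ}
    (hK : ∀ y, 0 < y → y ≤ Real.pi → ∀ x, |x| ≤ 3 * y → U x ≤ K * U y)
    {t y : ℝ} (ht : 0 < t) (ht1 : t ≤ Real.pi / 3) (hy : 0 ≤ y) (hy1 : y ≤ t / 2) :
    |Dt2 U t y| ≤ 2 * y ^ 2 * (4 * C₀ * K * (U t / t ^ 2)) := by
  have hp := Real.pi_pos
  set S := 4 * C₀ * K * (U t / t ^ 2) with hS
  have hS' : ∀ x ∈ Icc (t - y) (t + y), ‖U'' x‖ ≤ S := by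
    intro x hx
    have hx0 : t / 2 ≤ x := by linarith [hx.1]
    have hx00 : 0 < x := by linarith
    have h1 := (H.bd x hx00 (by linarith [hx.2])).2
    have h2 := hK t ht (by linarith) x (by rw [abs_of_pos hx00]; linarith [hx.2])
    have h3 : |U'' x| ≤ C₀ * U x / x ^ 2 := by rw [le_div_iff₀ (by positivity)]; linarith
    have := H.C0
    have h5 : 0 ≤ K * U t := (H.nonneg x).trans h2
    rw [Real.norm_eq_abs]
    calc |U'' x| ≤ C₀ * U x / x ^ 2 := h3
      _ ≤ C₀ * (K * U t) / (t / 2) ^ 2 := by gcongr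
      _ = _ := by rw [hS]; field_simp; ring
  have hS0 : 0 ≤ S := (norm_nonneg _).trans (hS' t ⟨by linarith, by linarith⟩)
  have hd1 : ∀ x ∈ Icc (t - y) (t + y), HasDerivAt U (U' x) x := fun x hx =>
    H.d1 x ⟨by linarith [hx.1], by linarith [hx.2]⟩
  have hd2 : ∀ x ∈ Icc (t - y) (t + y), HasDerivAt U' (U'' x) x := fun x hx =>
    H.d2 x ⟨by linarith [hx.1], by linarith [hx.2]⟩
  have hL := fun (a b : ℝ) (ha : a ∈ Icc (t - y) (t + y)) (hb : b ∈ Icc (t - y) (t + y)) =>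
    (convex_Icc (t - y) (t + y)).norm_image_sub_le_of_norm_hasDerivWithin_le (f := U')
    (fun x hx => (hd2 x hx).hasDerivWithinAt) hS' ha hb
  have hg : ∀ s ∈ Icc 0 y, HasDerivAt (fun s => U (t + s) + U (t - s)) (U' (t + s) - U' (t - s)) s := by
    intro s hs
    have h1 := (hd1 (t + s) ⟨by linarith [hs.1], by linarith [hs.2]⟩).comp_const_add t s
    have h2 := (hd1 (t - s) ⟨by linarith [hs.2], by linarith [hs.1]⟩).comp_const_sub t s
    exact (h1.add h2).congr_deriv (by ring)
  have := (convex_Icc 0 y).norm_image_sub_le_of_norm_hasDerivWithin_le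
    (f := fun s => U (t + s) + U (t - s)) (C := S * (2 * y))
    (fun x hx => (hg x hx).hasDerivWithinAt) (by
      intro s hs
      refine (hL (t - s) (t + s) ⟨by linarith [hs.2], by linarith [hs.1, hs.2]⟩
        ⟨by linarith [hs.2, hs.1], by linarith [hs.2]⟩).trans ?_
      have : t + s - (t - s) = 2 * s := by ring
      rw [this, Real.norm_eq_abs, abs_of_nonneg (by linarith [hs.1])]
      have := hs.2
      gcongr) (x := 0) (y := y) ⟨le_rfl, hy⟩ ⟨hy, le_rfl⟩
  simp only [add_zero, sub_zero, Real.norm_eq_abs, abs_of_nonneg hy] at this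
  have e : U (t + y) + U (t - y) - (U t + U t) = Dt2 U t y := by unfold Dt2; ring
  rw [e] at this
  linarith

lemma UD.far (H : UD U U' U'' C₀) {K : ℝ}
    (hK : ∀ y, 0 < y → y ≤ Real.pi → ∀ x, |x| ≤ 3 * y → U x ≤ K * U y)
    {t y : ℝ} (ht : 0 < t) (hy : t / 2 ≤ y) (hy1 : y ≤ Real.pi) :
    |Dt2 U t y| ≤ 4 * K * U y ∧ |Dt1 U t y| ≤ 4 * K * U y := by
  have h0 : 0 < y := by linarith
  have h1 := hK y h0 hy1 (t + y) (by rw [abs_of_pos (by linarith)]; linarith)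
  have h2 := hK y h0 hy1 (t - y) (abs_le.2 ⟨by linarith, by linarith⟩)
  have h3 := hK y h0 hy1 t (by rw [abs_of_pos ht]; linarith)
  have g1 := H.nonneg (t + y)
  have g2 := H.nonneg (t - y)
  have g3 := H.nonneg t
  unfold Dt1 Dt2
  constructor <;> rw [abs_le] <;> constructor <;> linarith

/-- Generic estimate for the integrals. -/
lemma UD.gen (H : UD U U' U'' C₀) {K : ℝ} {t : ℝ} (ht : 0 < t) (ht1 : t ≤ Real.pi) (f : ℝ → ℝ) (hf : Continuous f)
    (g : ℝ → ℝ) (hg : Continuous g) (_hg0 : ∀ y ∈ Icc 0 Real.pi, 0 ≤ g y)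
    (h1 : ∀ y, 0 < y → y ≤ t / 2 → |f y| ≤ g y) (h2 : ∀ y, t / 2 ≤ y → y ≤ Real.pi → |f y| ≤ K * (U y / y ^ 2)) :
    |∫ y in (0:ℝ)..Real.pi, f y| ≤ (∫ y in (0:ℝ)..(t/2), g y) + K * hU U (t / 2) ∧
    |∫ y in (0:ℝ)..(t/2), f y| ≤ ∫ y in (0:ℝ)..(t/2), g y := by
  have hp := Real.pi_pos
  have i1 : |∫ y in (0:ℝ)..(t/2), f y| ≤ ∫ y in (0:ℝ)..(t/2), g y := by
    rw [← Real.norm_eq_abs]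
    apply intervalIntegral.norm_integral_le_of_norm_le (by linarith) _ (hg.intervalIntegrable _ _)
    exact Eventually.of_forall fun y hy => h1 y hy.1 hy.2
  refine ⟨?_, i1⟩
  rw [← intervalIntegral.integral_add_adjacent_intervals (hf.intervalIntegrable 0 (t / 2))
    (hf.intervalIntegrable _ _)]
  refine (abs_add_le _ _).trans (add_le_add i1 ?_)
  unfold hU
  rw [← Real.norm_eq_abs, ← intervalIntegral.integral_const_mul]
  apply intervalIntegral.norm_integral_le_of_norm_le (by linarith) _ ((H.ii (half_pos ht) hp).const_mul _)
  exact Eventually.of_forall fun y hy => h2 y hy.1.le hy.2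

lemma UD.A_bound (H : UD U U' U'' C₀) {K : ℝ}
    (hK : ∀ y, 0 < y → y ≤ Real.pi → ∀ x, |x| ≤ 3 * y → U x ≤ K * U y) {r : ℝ} (hr : 1 / 2 ≤ r) (hr1 : r < 1)
    {t : ℝ} (ht : 0 < t) (ht1 : t ≤ Real.pi / 3) :
    |∫ y in (0:ℝ)..Real.pi, Dt2 U t y * ka r y| ≤ 10 * C₀ * K * (U t / t) + 10 * K * hU U (t / 2) ∧
    |∫ y in (0:ℝ)..(t/2), Dt2 U t y * ka r y| ≤ 10 * C₀ * K * (U t / t) := by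
  have hp := Real.pi_pos
  have hK0 : 0 ≤ K := by
    have := hK t ht (by linarith) t (by rw [abs_of_pos ht]; linarith)
    have := H.pos t ht (by linarith)
    by_contra h
    nlinarith
  have hC := H.C0
  have hUt := H.nonneg t
  have := H.gen (K := 10 * K) ht (by linarith) (fun y => Dt2 U t y * ka r y)
    ((Dt2_cont H.cont t).mul (ka_cont (by linarith) hr1)) (fun _ => 5 * (4 * C₀ * K * (U t / t ^ 2))) continuous_const
    (fun y _ => by positivity) (by
      intro y hy hy1
      rw [abs_mul]
      have h1 := H.Dt2_near hK ht ht1 hy.le hy1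
      have h2 := (ka_le hr hr1 y).trans (r_div_D hr hr1 hy (by linarith))
      calc _ ≤ 2 * y ^ 2 * (4 * C₀ * K * (U t / t ^ 2)) * (5 / (2 * y ^ 2)) := by gcongr
        _ = _ := by field_simp) (by
      intro y hy hy1
      rw [abs_mul]
      have hy0 : 0 < y := by linarith
      have h1 := (H.far hK ht hy hy1).1
      have h2 := (ka_le hr hr1 y).trans (r_div_D hr hr1 hy0 (by linarith))
      have := H.nonneg y
      calc _ ≤ 4 * K * U y * (5 / (2 * y ^ 2)) := by gcongr
        _ = _ := by field_simp; ring)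
  have e : ∫ y in (0:ℝ)..(t/2), 5 * (4 * C₀ * K * (U t / t ^ 2)) = 10 * C₀ * K * (U t / t) := by
    rw [intervalIntegral.integral_const, smul_eq_mul]; field_simp; ring
  rw [e] at this
  exact this

lemma UD.B_bound (H : UD U U' U'' C₀) {K : ℝ}
    (hK : ∀ y, 0 < y → y ≤ Real.pi → ∀ x, |x| ≤ 3 * y → U x ≤ K * U y) {r : ℝ} (hr : 1 / 2 ≤ r) (hr1 : r < 1)
    {t : ℝ} (ht : 0 < t) (ht1 : t ≤ Real.pi / 3) :
    |∫ y in (0:ℝ)..Real.pi, Dt1 U t y * kb r y| ≤ 10 * Real.pi * C₀ * K * (U t / t) + 10 * K * hU U (t / 2) := by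
  have hp := Real.pi_pos
  have hK0 : 0 ≤ K := by
    have := hK t ht (by linarith) t (by rw [abs_of_pos ht]; linarith)
    have := H.pos t ht (by linarith)
    by_contra h
    nlinarith
  have hC := H.C0
  have hUt := H.nonneg t
  have hr2 : 0 ≤ 1 - r ^ 2 := by nlinarith
  have hP0 : ∀ y, 0 ≤ (1 - r ^ 2) / Dr r y := fun y =>
    div_nonneg hr2 (Dr_pos (by linarith) hr1 y).le
  have hPc := P_cont hr hr1
  have := (H.gen (K := 10 * K) ht (by linarith) (fun y => Dt1 U t y * kb r y)
    ((Dt1_cont H.cont t).mul (kb_cont (by linarith) hr1))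
    (fun y => 10 * C₀ * K * (U t / t) * ((1 - r ^ 2) / Dr r y)) (by fun_prop)
    (fun y _ => mul_nonneg (by positivity) (hP0 y)) (by
      intro y hy hy1
      rw [abs_mul]
      have h1 := H.Dt1_near hK ht ht1 hy.le hy1
      have h2 := kb_near hr hr1 hy.le (by linarith : y ≤ Real.pi)
      calc _ ≤ 2 * y * (2 * C₀ * K * (U t / t)) * |kb r y| := by gcongr
        _ = 2 * (2 * C₀ * K * (U t / t)) * (y * |kb r y|) := by ring
        _ ≤ 2 * (2 * C₀ * K * (U t / t)) * (5 / 2 * ((1 - r ^ 2) / Dr r y)) := by gcongr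
        _ = _ := by ring) (by
      intro y hy hy1
      rw [abs_mul]
      have hy0 : 0 < y := by linarith
      have h1 := (H.far hK ht hy hy1).2
      have h2 := (kb_le hr hr1 y).trans (r_div_D hr hr1 hy0 (by linarith))
      have := H.nonneg y
      calc _ ≤ 4 * K * U y * (5 / (2 * y ^ 2)) := by gcongr
        _ = _ := by field_simp; ring)).1
  have e : ∫ y in (0:ℝ)..(t/2), 10 * C₀ * K * (U t / t) * ((1 - r ^ 2) / Dr r y) ≤
      10 * Real.pi * C₀ * K * (U t / t) := by
    rw [intervalIntegral.integral_const_mul]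
    have h3 : ∫ y in (0:ℝ)..(t/2), (1 - r ^ 2) / Dr r y ≤ ∫ y in (0:ℝ)..Real.pi, (1 - r ^ 2) / Dr r y := by
      apply intervalIntegral.integral_mono_interval le_rfl (by linarith) (by linarith) _
        (hPc.intervalIntegrable _ _)
      exact Eventually.of_forall hP0
    rw [P_integral hr hr1] at h3
    calc _ ≤ 10 * C₀ * K * (U t / t) * Real.pi := by gcongr
      _ = _ := by ring
  linarith

lemma inv_sq_int {a b : ℝ} (ha : 0 < a) (hab : a ≤ b) : ∫ x in a..b, 1 / x ^ 2 ≤ 1 / a ∧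
    IntervalIntegrable (fun x : ℝ => 1 / x ^ 2) volume a b := by
  have hb := ha.trans_le hab
  have hpos : ∀ x ∈ uIcc a b, 0 < x := fun x hx => lt_of_lt_of_le (lt_min ha hb) hx.1
  have hi : IntervalIntegrable (fun x : ℝ => 1 / x ^ 2) volume a b := by
    apply ContinuousOn.intervalIntegrable
    apply continuousOn_const.div (by fun_prop)
    intro x hx
    have := hpos x hx
    positivity
  refine ⟨?_, hi⟩
  have hdv : ∀ x ∈ uIcc a b, HasDerivAt (fun x : ℝ => - x⁻¹) (1 / x ^ 2) x := by
    intro x hx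
    refine (hasDerivAt_inv (hpos x hx).ne').neg.congr_deriv ?_
    simp
  rw [intervalIntegral.integral_eq_sub_of_hasDerivAt hdv hi]
  have : 0 < b⁻¹ := by positivity
  simp only [one_div]; linarith

lemma UD.A_lower (H : UD U U' U'' C₀) {K : ℝ}
    (hK : ∀ y, 0 < y → y ≤ Real.pi → ∀ x, |x| ≤ 3 * y → U x ≤ K * U y) {r : ℝ} (hr : 1 / 2 ≤ r) (hr1 : r < 1)
    {t : ℝ} (ht : 0 < t) (ht1 : t ≤ Real.pi / 3) (hrt : 1 - r ≤ t / (4 * Real.pi)) :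
    (hU U t - hU U (Real.pi / 2)) / 6 - (10 * C₀ * K + 10) * (U t / t) ≤
      - ∫ y in (0:ℝ)..Real.pi, Dt2 U t y * ka r y := by
  have hp := Real.pi_pos
  have hc : Continuous fun y => Dt2 U t y * ka r y :=
    (Dt2_cont H.cont t).mul (ka_cont (by linarith) hr1)
  have h1 := (abs_le.1 (H.A_bound hK hr hr1 ht ht1).2).2
  rw [← intervalIntegral.integral_add_adjacent_intervals (hc.intervalIntegrable 0 (t / 2))
    (hc.intervalIntegrable _ _), neg_add]
  have hi : IntervalIntegrable (fun y => - (Dt2 U t y * ka r y) + 5 * U t * (1 / y ^ 2)) volume (t / 2) Real.pi :=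
    (hc.neg.intervalIntegrable _ _).add (((inv_sq_int (half_pos ht) (by linarith)).2).const_mul _)
  have key : ∀ y, t / 2 ≤ y → y ≤ Real.pi → 0 ≤ - ka r y ∧ - ka r y ≤ 5 / (2 * y ^ 2) ∧ 1 / (6 * y ^ 2) ≤ - ka r y := by
    intro y hy hy1
    have h0 : 0 < y := by linarith
    have h2 := ka_far hr hr1 hrt hy h0 hy1
    refine ⟨le_trans (by positivity) h2, ?_, h2⟩
    exact (neg_le_abs _).trans ((ka_le hr hr1 y).trans (r_div_D hr hr1 h0 hy1))
  have hUt := H.nonneg t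
  have h2 : ∫ y in t..(Real.pi / 2), 1 / 6 * (U y / y ^ 2) ≤
      ∫ y in t..(Real.pi / 2), (- (Dt2 U t y * ka r y) + 5 * U t * (1 / y ^ 2)) := by
    apply intervalIntegral.integral_mono_on (by linarith) ((H.ii ht (by linarith)).const_mul _)
    · apply hi.mono_set
      rw [uIcc_of_le (by linarith), uIcc_of_le (by linarith)]
      exact Icc_subset_Icc (by linarith) (by linarith)
    · intro y hy
      have h0 : 0 < y := ht.trans_le hy.1
      obtain ⟨k1, k2, k3⟩ := key y (by linarith [hy.1]) (by linarith [hy.2])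
      have h3 : U y ≤ U (t + y) := H.mono ⟨h0.le, by linarith [hy.2]⟩ ⟨by linarith, by linarith [hy.2]⟩ (by linarith)
      have h4 : U y - 2 * U t ≤ Dt2 U t y := by unfold Dt2; linarith [H.nonneg (t - y)]
      have h5 : (U y - 2 * U t) * (- ka r y) ≤ Dt2 U t y * (- ka r y) := by gcongr
      have h6 : U y * (1 / (6 * y ^ 2)) ≤ U y * (- ka r y) := by
        have := H.nonneg y
        gcongr
      have h7 : U t * (- ka r y) ≤ U t * (5 / (2 * y ^ 2)) := by gcongr
      have e1 : 1 / 6 * (U y / y ^ 2) = U y * (1 / (6 * y ^ 2)) := by field_simp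
      have e2 : 5 * U t * (1 / y ^ 2) = 2 * (U t * (5 / (2 * y ^ 2))) := by field_simp
      rw [e1, e2]
      linarith
  have h3 : ∫ y in t..(Real.pi / 2), (- (Dt2 U t y * ka r y) + 5 * U t * (1 / y ^ 2)) ≤
      ∫ y in (t/2)..Real.pi, (- (Dt2 U t y * ka r y) + 5 * U t * (1 / y ^ 2)) := by
    apply intervalIntegral.integral_mono_interval (by linarith) (by linarith) (by linarith) _ hi
    refine (ae_restrict_iff' measurableSet_Ioc).2 (Eventually.of_forall fun y hy => ?_)
    have h0 : 0 < y := by linarith [hy.1]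
    obtain ⟨k1, k2, k3⟩ := key y hy.1.le hy.2
    have h4 : - 2 * U t ≤ Dt2 U t y := by unfold Dt2; linarith [H.nonneg (t - y), H.nonneg (t + y)]
    have h5 : (- 2 * U t) * (- ka r y) ≤ Dt2 U t y * (- ka r y) := by gcongr
    have h7 : U t * (- ka r y) ≤ U t * (5 / (2 * y ^ 2)) := by gcongr
    have e2 : 5 * U t * (1 / y ^ 2) = 2 * (U t * (5 / (2 * y ^ 2))) := by field_simp
    simp only [Pi.zero_apply]
    rw [e2]
    linarith
  have hcn : Continuous fun y => - (Dt2 U t y * ka r y) := hc.neg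
  rw [intervalIntegral.integral_add (hcn.intervalIntegrable _ _)
    (((inv_sq_int (half_pos ht) (by linarith)).2).const_mul _), intervalIntegral.integral_neg,
    intervalIntegral.integral_const_mul] at h3
  rw [intervalIntegral.integral_const_mul, ← H.h_sub ht (by linarith)] at h2
  have h4 : 5 * U t * (∫ x in (t/2)..Real.pi, 1 / x ^ 2) ≤ 5 * U t * (1 / (t / 2)) := by
    gcongr
    exact (inv_sq_int (half_pos ht) (by linarith)).1
  have e3 : 5 * U t * (1 / (t / 2)) = 10 * (U t / t) := by field_simp; ring
  linarith

end est

section est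
variable {U U' U'' : ℝ → ℝ} {C₀ : ℝ}

lemma UD.poisson_pos (H : UD U U' U'' C₀) {r : ℝ} (h0 : 0 ≤ r) (h1 : r < 1) (θ : ℝ) : 0 < poisson U r θ := by
  have hp := Real.pi_pos
  unfold poisson
  have hD : ∀ x, 0 < 1 - 2 * r * Real.cos (θ - x) + r ^ 2 := fun x => Dr_pos h0 h1 (θ - x)
  apply mul_pos
  · apply div_pos _ (by positivity)
    nlinarith
  · apply intervalIntegral.integral_pos (by linarith)
    · apply Continuous.continuousOn
      exact H.cont.div (by fun_prop) fun x => (hD x).ne'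
    · intro x _
      exact div_nonneg (H.nonneg x) (hD x).le
    · exact ⟨Real.pi, ⟨by linarith, le_rfl⟩, div_pos (H.pos _ hp le_rfl) (hD _)⟩

lemma UD.poisson_eq (H : UD U U' U'' C₀) {r : ℝ} (hr : 1 / 2 ≤ r) (h1 : r < 1) (t : ℝ) :
    poisson U r t = 1 / (2 * Real.pi) *
      ∫ y in (0:ℝ)..Real.pi, (U (t + y) + U (t - y)) * ((1 - r ^ 2) / Dr r y) := by
  have hP := P_cont hr h1
  have hc := H.cont
  have hper : Function.Periodic (fun x => U x * ((1 - r ^ 2) / Dr r (t - x))) (2 * Real.pi) := by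
    intro x
    simp only [H.per x]
    congr 2
    unfold Dr
    rw [show t - (x + 2 * Real.pi) = t - x - 2 * Real.pi by ring, Real.cos_sub_two_pi]
  have h2 := circle_shift _ hper t
  have h3 := circle_shift _ hper 0
  simp only [zero_add] at h3
  rw [h3] at h2
  have e1 : poisson U r t = 1 / (2 * Real.pi) *
      ∫ x in (-Real.pi)..Real.pi, U x * ((1 - r ^ 2) / Dr r (t - x)) := by
    unfold poisson
    rw [← intervalIntegral.integral_const_mul, ← intervalIntegral.integral_const_mul]
    congr 1
    ext x
    unfold Dr
    ring
  rw [e1, h2, integral_symm]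
  · congr 2
    ext y
    simp only [Dr_neg, sub_add_cancel_left, ← sub_eq_add_neg, sub_sub_cancel]
    ring
  · have e : ∀ y : ℝ, t - (t + y) = - y := fun y => by ring
    simp only [e, Dr_neg]
    fun_prop

lemma P_nonneg {r : ℝ} (hr : 1 / 2 ≤ r) (hr1 : r < 1) (y : ℝ) : 0 ≤ (1 - r ^ 2) / Dr r y :=
  div_nonneg (by nlinarith) (Dr_pos (by linarith) hr1 y).le

lemma UD.poisson_low (H : UD U U' U'' C₀) {r : ℝ} (hr : 1 / 2 ≤ r) (h1 : r < 1) (t m : ℝ) (hm : 0 ≤ m)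
    (h : ∀ y, 0 ≤ y → y ≤ 1 / 2 → m ≤ U (t + y) + U (t - y)) : m / (4 * Real.pi) ≤ poisson U r t := by
  have hp := Real.pi_gt_three
  have hP := P_cont hr h1
  have hc := H.cont
  rw [H.poisson_eq hr h1]
  have hi : Continuous fun y => (U (t + y) + U (t - y)) * ((1 - r ^ 2) / Dr r y) := by fun_prop
  have i1 : ∫ y in (0:ℝ)..(1 - r), (U (t + y) + U (t - y)) * ((1 - r ^ 2) / Dr r y) ≤
      ∫ y in (0:ℝ)..Real.pi, (U (t + y) + U (t - y)) * ((1 - r ^ 2) / Dr r y) := by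
    apply intervalIntegral.integral_mono_interval le_rfl (by linarith) (by linarith) _
      (hi.intervalIntegrable _ _)
    exact Eventually.of_forall fun y => mul_nonneg (add_nonneg (H.nonneg _) (H.nonneg _)) (P_nonneg hr h1 y)
  have i2 : ∫ y in (0:ℝ)..(1 - r), m * (1 / (2 * (1 - r))) ≤
      ∫ y in (0:ℝ)..(1 - r), (U (t + y) + U (t - y)) * ((1 - r ^ 2) / Dr r y) := by
    apply intervalIntegral.integral_mono_on (by linarith) (by simp) (hi.intervalIntegrable _ _)
    intro y hy
    have h3 := h y hy.1 (by linarith [hy.2])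
    have hD := Dr_pos (by linarith : 0 ≤ r) h1 y
    have h4 : 1 / (2 * (1 - r)) ≤ (1 - r ^ 2) / Dr r y := by
      rw [div_le_div_iff₀ (by linarith) hD, Dr_eq]
      have h5 := (sin_half_sq hy.1 (by linarith [hy.2])).2
      have h6 : y ^ 2 ≤ (1 - r) ^ 2 := by
        have := hy.1; have := hy.2
        gcongr
      have h7 : r * (4 * Real.sin (y / 2) ^ 2) ≤ 1 * (1 - r) ^ 2 := by
        have h8 : 4 * Real.sin (y / 2) ^ 2 ≤ (1 - r) ^ 2 := h5.trans h6
        gcongr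
      nlinarith [sq_nonneg (1 - r)]
    have h5 : 0 ≤ 1 / (2 * (1 - r)) := by
      have : 0 < 1 - r := by linarith
      positivity
    have h6 : 0 ≤ U (t + y) + U (t - y) := hm.trans h3
    gcongr
  rw [intervalIntegral.integral_const, smul_eq_mul] at i2
  have e : (1 - r - 0) * (m * (1 / (2 * (1 - r)))) = m / 2 := by
    have : 1 - r ≠ 0 := by linarith
    field_simp; ring
  rw [e] at i2
  calc m / (4 * Real.pi) = 1 / (2 * Real.pi) * (m / 2) := by field_simp; ring
    _ ≤ _ := by gcongr; linarith

lemma UD.poisson_up (H : UD U U' U'' C₀) {r : ℝ} (hr : 1 / 2 ≤ r) (h1 : r < 1) (t : ℝ) :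
    poisson U r t ≤ U Real.pi := by
  have hp := Real.pi_gt_three
  have hP := P_cont hr h1
  have hc := H.cont
  rw [H.poisson_eq hr h1]
  have hi : Continuous fun y => (U (t + y) + U (t - y)) * ((1 - r ^ 2) / Dr r y) := by fun_prop
  have i2 : ∫ y in (0:ℝ)..Real.pi, (U (t + y) + U (t - y)) * ((1 - r ^ 2) / Dr r y) ≤
      ∫ y in (0:ℝ)..Real.pi, 2 * U Real.pi * ((1 - r ^ 2) / Dr r y) := by
    apply intervalIntegral.integral_mono_on (by linarith) (hi.intervalIntegrable _ _)
      (Continuous.intervalIntegrable (by fun_prop) _ _)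
    intro y hy
    have := P_nonneg hr h1 y
    have := H.le_pi (t + y)
    have := H.le_pi (t - y)
    gcongr
    linarith
  rw [intervalIntegral.integral_const_mul, P_integral hr h1] at i2
  calc _ ≤ 1 / (2 * Real.pi) * (2 * U Real.pi * Real.pi) := by gcongr
    _ = _ := by field_simp

lemma UD.poisson_up2 (H : UD U U' U'' C₀) {K : ℝ} (hK1 : 1 ≤ K)
    (hK : ∀ y, 0 < y → y ≤ Real.pi → ∀ x, |x| ≤ 3 * y → U x ≤ K * U y)
    {r : ℝ} (hr : 1 / 2 ≤ r) (h1 : r < 1) {t : ℝ} (ht : 0 < t) (ht1 : t ≤ Real.pi / 3) :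
    poisson U r t ≤ K * U t + 4 * K * ((1 - r) * hU U (t / 2)) := by
  have hp := Real.pi_gt_three
  have hP := P_cont hr h1
  have hc := H.cont
  have hUt := H.nonneg t
  rw [H.poisson_eq hr h1]
  have hi : Continuous fun y => (U (t + y) + U (t - y)) * ((1 - r ^ 2) / Dr r y) := by fun_prop
  have i2 := (H.gen (K := 20 * K * (1 - r)) ht (by linarith)
    (fun y => (U (t + y) + U (t - y)) * ((1 - r ^ 2) / Dr r y)) hi
    (fun y => 2 * K * U t * ((1 - r ^ 2) / Dr r y)) (by fun_prop)
    (fun y _ => mul_nonneg (by positivity) (P_nonneg hr h1 y)) (by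
      intro y hy hy1
      have h3 := P_nonneg hr h1 y
      rw [abs_of_nonneg (mul_nonneg (add_nonneg (H.nonneg _) (H.nonneg _)) h3)]
      have h4 := hK t ht (by linarith) (t + y) (by rw [abs_of_pos (by linarith)]; linarith)
      have h5 := hK t ht (by linarith) (t - y) (by rw [abs_of_pos (by linarith)]; linarith)
      gcongr
      linarith) (by
      intro y hy hy1
      have h0 : 0 < y := by linarith
      have h3 := P_nonneg hr h1 y
      rw [abs_of_nonneg (mul_nonneg (add_nonneg (H.nonneg _) (H.nonneg _)) h3)]
      have h4 := hK y h0 hy1 (t + y) (by rw [abs_of_pos (by linarith)]; linarith)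
      have h5 := hK y h0 hy1 (t - y) (abs_le.2 ⟨by linarith, by linarith⟩)
      have hD := Dr_pos (by linarith : 0 ≤ r) h1 y
      have h6 := r_div_D hr h1 h0 hy1
      have h7 : (1 - r ^ 2) / Dr r y ≤ 4 * (1 - r) * (r / Dr r y) := by
        rw [← mul_div_assoc]
        gcongr
        nlinarith
      have h8 : 4 * (1 - r) * (r / Dr r y) ≤ 4 * (1 - r) * (5 / (2 * y ^ 2)) := by
        gcongr
      have := H.nonneg y
      calc _ ≤ (K * U y + K * U y) * (4 * (1 - r) * (5 / (2 * y ^ 2))) := by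
            gcongr
            exact h7.trans h8
        _ = _ := by field_simp; ring)).1
  have e : ∫ y in (0:ℝ)..(t/2), 2 * K * U t * ((1 - r ^ 2) / Dr r y) ≤ 2 * K * U t * Real.pi := by
    rw [intervalIntegral.integral_const_mul]
    have h3 : ∫ y in (0:ℝ)..(t/2), (1 - r ^ 2) / Dr r y ≤ ∫ y in (0:ℝ)..Real.pi, (1 - r ^ 2) / Dr r y := by
      apply intervalIntegral.integral_mono_interval le_rfl (by linarith) (by linarith) _
        (hP.intervalIntegrable _ _)
      exact Eventually.of_forall (P_nonneg hr h1)
    rw [P_integral hr h1] at h3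
    gcongr
  have h3 := (le_abs_self _).trans (i2.trans (add_le_add_left e _))
  have hh := H.h_nonneg (half_pos ht) (by linarith)
  calc _ ≤ 1 / (2 * Real.pi) * (2 * K * U t * Real.pi + 20 * K * (1 - r) * hU U (t / 2)) := by gcongr
    _ = K * U t + 10 / Real.pi * (K * ((1 - r) * hU U (t / 2))) := by field_simp; ring
    _ ≤ K * U t + 4 * (K * ((1 - r) * hU U (t / 2))) := by
        have : 10 / Real.pi ≤ 4 := by rw [div_le_iff₀ (by linarith)]; linarith
        have : 0 ≤ K * ((1 - r) * hU U (t / 2)) := by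
          have : 0 ≤ 1 - r := by linarith
          positivity
        gcongr
    _ = _ := by ring

end est

/-- primitive of `h` -/
def Hh (U : ℝ → ℝ) (t : ℝ) : ℝ := ∫ x in (1:ℝ)..t, hU U x

/-- polar form of `F` -/
def Fp (F : ℂ → ℂ) (r t : ℝ) : ℂ := F ((r : ℂ) * Complex.exp (t * I))

structure FD (U : ℝ → ℝ) (F : ℂ → ℂ) (δ K c : ℝ) : Prop where
  d0 : 0 < δ
  d1 : δ ≤ 1
  K1 : 1 ≤ K
  c0 : 0 < c
  arc : ∀ r a b, 1 / 2 ≤ r → r < 1 → 0 < a → a ≤ b → b ≤ δ → ‖Fp F r b - Fp F r a‖ ≤ K * (Hh U b - Hh U a)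
  arcl : ∀ r a b, 1 / 2 ≤ r → r < 1 → 0 < a → a ≤ b → b ≤ δ → 1 - r ≤ a / (4 * Real.pi) →
    (Hh U b - Hh U a) ≤ K * ((Fp F r a).im - (Fp F r b).im)
  rad : ∀ r r' t, 1 / 2 ≤ r → r < 1 → 1 / 2 ≤ r' → r' < 1 → 0 < t → t ≤ δ →
    ‖Fp F r t - Fp F r' t‖ ≤ K * hU U t * |r - r'|
  ulow : ∀ r t, 1 / 2 ≤ r → r < 1 → 0 < t → t ≤ δ → U t ≤ K * (Fp F r t).re
  uup : ∀ r t, 1 / 2 ≤ r → r < 1 → 0 < t → t ≤ δ → (Fp F r t).re ≤ K * (U t + (1 - r) * hU U t)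
  ufar : ∀ r t, 1 / 2 ≤ r → r < 1 → δ ≤ t → t ≤ Real.pi → c ≤ (Fp F r t).re
  uM : ∀ r t, 1 / 2 ≤ r → r < 1 → (Fp F r t).re ≤ K
  upos : ∀ z, ‖z‖ < 1 → 0 < (F z).re
  symm : ∀ r t, 0 ≤ r → r < 1 → Fp F r (-t) = (starRingEnd ℂ) (Fp F r t)
  osc : ∀ a b, 0 < a → a ≤ b → b ≤ δ → K * (Hh U b - Hh U a) ≤ 1 / 2
  Uh : ∀ t, 0 < t → t ≤ δ → U t / t ≤ hU U t
  h1 : ∀ t, 0 < t → t ≤ δ → 1 ≤ hU U t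

section est
variable {U U' U'' : ℝ → ℝ} {C₀ : ℝ}

lemma UD.Hh_deriv (H : UD U U' U'' C₀) {t : ℝ} (ht : 0 < t) : HasDerivAt (Hh U) (hU U t) t := by
  unfold Hh
  have hc : ContinuousOn (hU U) (Ioi 0) := fun x hx => (H.h_deriv hx).continuousAt.continuousWithinAt
  apply intervalIntegral.integral_hasDerivAt_right (H.h_ii one_pos ht)
  · exact hc.stronglyMeasurableAtFilter isOpen_Ioi t ht
  · exact hc.continuousAt (Ioi_mem_nhds ht)

lemma UD.Hh_sub (H : UD U U' U'' C₀) {a b : ℝ} (ha : 0 < a) (hb : 0 < b) :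
    Hh U b - Hh U a = ∫ x in a..b, hU U x := by
  unfold Hh
  rw [intervalIntegral.integral_interval_sub_left (H.h_ii one_pos hb) (H.h_ii one_pos ha)]

/-- Derivatives of `F` in polar coordinates and their bounds. -/
lemma UD.FD_deriv (H : UD U U' U'' C₀) (F : ℂ → ℂ) (hF : DifferentiableOn ℂ F (Metric.ball 0 1))
    (hFre : ∀ r θ : ℝ, 0 ≤ r → r < 1 →
      (F ((r : ℂ) * Complex.exp (θ * Complex.I))).re = poisson U r θ) :
    ∃ δ K : ℝ, 0 < δ ∧ δ ≤ 1 ∧ 1 ≤ K ∧ ∀ r t, 1 / 2 ≤ r → r < 1 → 0 < t → t ≤ δ → ∃ W : ℂ,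
      HasDerivAt (fun s : ℝ => Fp F r s) (I * W) t ∧
      HasDerivAt (fun s : ℝ => Fp F s t) (W / r) r ∧
      ‖W‖ ≤ K * hU U t ∧ (1 - r ≤ t / (4 * Real.pi) → hU U t ≤ K * (- W.re)) ∧
      (Fp F r t).re ≤ K * (U t + (1 - r) * hU U t) ∧ U t / t ≤ 1 / 2 * hU U t ∧ 1 ≤ hU U t := by
  have hp := Real.pi_gt_three
  obtain ⟨K, hK1, hK⟩ := H.doubling
  have hC := H.C0
  set E := 10 * C₀ * K + 10 with hE
  have hE0 : 0 < E := by positivity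
  obtain ⟨δ, hδ, hs⟩ := ev_pos ((H.small (1 / (24 * E)) (by positivity)).and
    ((H.small (1 / 2) (by positivity)).and ((H.htop.eventually_ge_atTop 1).and
    (H.htop.eventually_ge_atTop (4 * hU U (Real.pi / 2))))))
  set K2 := 10 * C₀ * K * 2 + 100 * K + 200 * K * C₀ with hK2
  refine ⟨min δ 1, max K2 (max (24 * Real.pi) (K * 12)), lt_min hδ one_pos, min_le_right _ _, ?_, ?_⟩
  · apply le_max_of_le_right (le_max_of_le_left (by linarith))
  intro r t hr hr1 ht ht1
  have ht3 : t ≤ Real.pi / 3 := (ht1.trans (min_le_right _ _)).trans (by linarith)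
  obtain ⟨s1, s2, s3, s4⟩ := hs t ht (ht1.trans (min_le_left _ _))
  obtain ⟨D, hD, hDe⟩ := F_deriv U H.cont H.per F hF hFre r t (by linarith) hr1
  set W := (r : ℂ) * Complex.exp (t * I) * D with hW
  rw [A_eq H.cont hr hr1, B_eq H.cont hr hr1] at hDe
  have hA := (H.A_bound hK hr hr1 ht ht3).1
  have hB := H.B_bound hK hr hr1 ht ht3
  have hAl := H.A_lower hK hr hr1 ht ht3
  set A := ∫ y in (0:ℝ)..Real.pi, Dt2 U t y * ka r y with hAd
  set B := ∫ y in (0:ℝ)..Real.pi, Dt1 U t y * kb r y with hBd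
  have hh2 := H.h_half ht (by linarith)
  have hhp : 0 < hU U t := by linarith
  have hUt := H.nonneg t
  have hUt' : 0 ≤ U t / t := by positivity
  have hhalf : hU U (t / 2) ≤ 2 * hU U t := by linarith
  have hWre : W.re = 1 / Real.pi * A := by rw [hDe]; simp
  have hr0 : (r : ℂ) ≠ 0 := by
    have : r ≠ 0 := by linarith
    exact_mod_cast this
  refine ⟨W, ?_, ?_, ?_, ?_, ?_, s2, s3⟩
  · have h1 : HasDerivAt (fun s : ℝ => (r : ℂ) * Complex.exp (s * I)) (r * (Complex.exp (t * I) * (1 * I))) t := by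
      have : HasDerivAt (fun s : ℝ => (s : ℂ) * I) (1 * I) t := (Complex.ofRealCLM.hasDerivAt (x := t)).mul_const I
      exact (this.cexp).const_mul _
    have h2 := HasDerivAt.comp t hD h1
    refine h2.congr_deriv ?_
    rw [hW]; ring
  · have h1 : HasDerivAt (fun s : ℝ => (s : ℂ) * Complex.exp (t * I)) (1 * Complex.exp (t * I)) r :=
      (Complex.ofRealCLM.hasDerivAt (x := r)).mul_const _
    have h2 := HasDerivAt.comp r hD h1
    refine h2.congr_deriv ?_
    rw [hW]; field_simp
  · have hpi0 : 0 < 1 / Real.pi := by positivity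
    have h1 : ‖W‖ ≤ 1 / Real.pi * |A| + 1 / Real.pi * |B| := by
      rw [hDe]
      refine (norm_add_le _ _).trans ?_
      rw [norm_mul, norm_I, mul_one, Complex.norm_real, Complex.norm_real, Real.norm_eq_abs, Real.norm_eq_abs,
        abs_mul, abs_mul, abs_of_pos hpi0]
    have h2 : 1 / Real.pi ≤ 1 := by rw [div_le_one (by linarith)]; linarith
    have h3 : ‖W‖ ≤ |A| + |B| := by nlinarith [abs_nonneg A, abs_nonneg B]
    refine h3.trans (le_trans ?_ (mul_le_mul_of_nonneg_right (le_max_left _ _) hhp.le))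
    have hp4 := Real.pi_le_four
    have e1 : 10 * C₀ * K * (U t / t) ≤ 10 * C₀ * K * hU U t := by gcongr; linarith
    have e2 : 10 * Real.pi * C₀ * K * (U t / t) ≤ 10 * 4 * C₀ * K * hU U t := by gcongr; linarith
    have e3 : 10 * K * hU U (t / 2) ≤ 10 * K * (2 * hU U t) := by gcongr
    have e4 : 0 ≤ C₀ * K * hU U t := by positivity
    have e5 : 0 ≤ K * hU U t := by positivity
    rw [hK2]
    nlinarith
  · intro hrt
    have h1 := hAl hrt
    have h2 : E * (U t / t) ≤ E * (1 / (24 * E) * hU U t) := by gcongr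
    have h3 : E * (1 / (24 * E) * hU U t) = hU U t / 24 := by field_simp
    have h4 : hU U t / 12 ≤ - A := by linarith
    have h5 : - W.re = 1 / Real.pi * (- A) := by rw [hWre]; ring
    have h6 : 0 ≤ - W.re := by
      rw [h5]; have : 0 ≤ -A := by linarith
      positivity
    refine le_trans ?_ (mul_le_mul_of_nonneg_right ((le_max_left _ _).trans (le_max_right _ _)) h6)
    rw [h5]
    have : 24 * Real.pi * (1 / Real.pi * (-A)) = 24 * (-A) := by field_simp
    rw [this]; linarith
  · have h1 := H.poisson_up2 hK1 hK hr hr1 ht ht3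
    unfold Fp
    rw [hFre r t (by linarith) hr1]
    have h0 : 0 ≤ 1 - r := by linarith
    have h2 : (1 - r) * hU U (t / 2) ≤ (1 - r) * (2 * hU U t) := by gcongr
    refine le_trans ?_ (mul_le_mul_of_nonneg_right ((le_max_right _ _).trans (le_max_right _ _)) (by positivity))
    have h3 : 0 ≤ (1 - r) * hU U t := by positivity
    nlinarith

theorem UD.toFD (H : UD U U' U'' C₀) (F : ℂ → ℂ) (hF : DifferentiableOn ℂ F (Metric.ball 0 1))
    (hFre : ∀ r θ : ℝ, 0 ≤ r → r < 1 →
      (F ((r : ℂ) * Complex.exp (θ * Complex.I))).re = poisson U r θ) (hFim : (F 0).im = 0) :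
    ∃ δ K c : ℝ, FD U F δ K c := by
  have hp := Real.pi_gt_three
  obtain ⟨δ1, K1, hδ1, hδ1', hK1, hd⟩ := H.FD_deriv F hF hFre
  set K := K1 * 2 + 4 * Real.pi + U Real.pi with hK
  have hUp := H.nonneg Real.pi
  have hK1' : K1 * 2 ≤ K := by linarith
  have hK0 : 0 < K := by linarith
  obtain ⟨δ2, hδ2, h2⟩ := ev_pos (H.th_small (1 / (4 * K)) (by positivity))
  set δ := min δ1 δ2 with hδ
  have hδ0 : 0 < δ := lt_min hδ1 hδ2
  have hδδ1 : δ ≤ δ1 := min_le_left _ _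
  have hδle1 : δ ≤ 1 := hδδ1.trans hδ1'
  have hhpos : ∀ t, 0 < t → t ≤ δ → 1 ≤ hU U t := fun t h0 h1 => by
    obtain ⟨W, _, _, _, _, _, _, h⟩ := hd (1/2) t le_rfl (by norm_num) h0 (h1.trans hδδ1)
    exact h
  have hsm : ∀ t, 0 < t → t ≤ δ → U t / t ≤ 1 / 2 * hU U t := fun t h0 h1 => by
    obtain ⟨W, _, _, _, _, _, h, _⟩ := hd (1/2) t le_rfl (by norm_num) h0 (h1.trans hδδ1)
    exact h
  refine ⟨δ, K, min (U δ) (U (1 / 2)) / (4 * Real.pi), ?_⟩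
  refine ⟨hδ0, hδle1, by linarith, ?_, ?_, ?_, ?_, ?_, ?_, ?_, ?_, ?_, ?_, ?_, ?_, hhpos⟩
  · have := H.pos δ hδ0 (by linarith)
    have := H.pos (1/2) (by norm_num) (by linarith)
    have : 0 < min (U δ) (U (1 / 2)) := lt_min ‹_› ‹_›
    positivity
  · intro r a b hr hr1 ha hab hb
    have hW : ∀ t, ∃ W : ℂ, 0 < t → t ≤ δ → HasDerivAt (fun s : ℝ => Fp F r s) (I * W) t ∧ ‖W‖ ≤ K1 * hU U t := by
      intro t
      by_cases h : 0 < t ∧ t ≤ δ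
      · obtain ⟨W, h1, _, h2, _⟩ := hd r t hr hr1 h.1 (h.2.trans hδδ1)
        exact ⟨W, fun _ _ => ⟨h1, h2⟩⟩
      · exact ⟨0, fun h1 h2 => absurd ⟨h1, h2⟩ h⟩
    choose W hW using hW
    have := image_norm_le_of_norm_deriv_right_le_deriv_boundary' (a := a) (b := b)
      (f := fun s : ℝ => Fp F r s - Fp F r a) (f' := fun t => I * W t)
      (B := fun x => K1 * (Hh U x - Hh U a)) (B' := fun x => K1 * hU U x)
      (fun t ht => ((hW t (ha.trans_le ht.1) (ht.2.trans hb)).1.sub_const _).continuousAt.continuousWithinAt)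
      (fun t ht => ((hW t (ha.trans_le ht.1) (ht.2.le.trans hb)).1.sub_const _).hasDerivWithinAt)
      (by simp)
      (fun t ht => (((H.Hh_deriv (ha.trans_le ht.1)).sub_const _).const_mul _).continuousAt.continuousWithinAt)
      (fun t ht => (((H.Hh_deriv (ha.trans_le ht.1)).sub_const _).const_mul _).hasDerivWithinAt)
      (fun t ht => by
        rw [norm_mul, norm_I, one_mul]
        exact (hW t (ha.trans_le ht.1) (ht.2.le.trans hb)).2)
      (x := b) ⟨hab, le_rfl⟩
    refine this.trans ?_
    have h3 : 0 ≤ Hh U b - Hh U a := by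
      rw [H.Hh_sub ha (ha.trans_le hab)]
      exact intervalIntegral.integral_nonneg hab fun x hx => by
        linarith [hhpos x (ha.trans_le hx.1) (hx.2.trans hb)]
    gcongr; linarith
  · intro r a b hr hr1 ha hab hb hrt
    have hW : ∀ t, ∃ W : ℂ, 0 < t → t ≤ δ → a ≤ t → HasDerivAt (fun s : ℝ => Fp F r s) (I * W) t ∧ hU U t ≤ K1 * (- W.re) := by
      intro t
      by_cases h : 0 < t ∧ t ≤ δ
      · obtain ⟨W, h1, _, _, h2, _⟩ := hd r t hr hr1 h.1 (h.2.trans hδδ1)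
        exact ⟨W, fun _ _ hat => ⟨h1, h2 (hrt.trans (by gcongr))⟩⟩
      · exact ⟨0, fun h1 h2 _ => absurd ⟨h1, h2⟩ h⟩
    choose W hW using hW
    have hg : ∀ t ∈ Icc a b, HasDerivAt (fun t => - K1 * (Fp F r t).im - Hh U t) (- K1 * (W t).re - hU U t) t := by
      intro t ht
      have h0 := ha.trans_le ht.1
      have h1 := (hW t h0 (ht.2.trans hb) ht.1).1
      have h2 : HasDerivAt (fun t => (Fp F r t).im) ((I * W t).im) t := by
        have := (Complex.imCLM.hasFDerivAt (x := Fp F r t)).comp_hasDerivAt t h1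
        exact this
      refine ((h2.const_mul (- K1)).sub (H.Hh_deriv h0)).congr_deriv ?_
      simp
    have hm : MonotoneOn (fun t => - K1 * (Fp F r t).im - Hh U t) (Icc a b) := by
      apply monotoneOn_of_deriv_nonneg (convex_Icc a b)
      · exact fun t ht => (hg t ht).continuousAt.continuousWithinAt
      · exact fun t ht => (hg t (interior_subset ht)).differentiableAt.differentiableWithinAt
      · intro t ht
        have ht := interior_subset ht
        rw [(hg t ht).deriv]
        have := (hW t (ha.trans_le ht.1) (ht.2.trans hb) ht.1).2
        linarith
    have h1 := hm ⟨le_rfl, hab⟩ ⟨hab, le_rfl⟩ hab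
    simp only at h1
    have h3 : 0 ≤ Hh U b - Hh U a := by
      rw [H.Hh_sub ha (ha.trans_le hab)]
      exact intervalIntegral.integral_nonneg hab fun x hx => by
        linarith [hhpos x (ha.trans_le hx.1) (hx.2.trans hb)]
    have h4 : Hh U b - Hh U a ≤ K1 * ((Fp F r a).im - (Fp F r b).im) := by linarith
    have h5 : 0 ≤ (Fp F r a).im - (Fp F r b).im := by
      by_contra h; push Not at h; nlinarith
    refine h4.trans ?_
    gcongr; linarith
  · intro r r' t hr hr1 hr' hr1' ht ht1
    have hh := hhpos t ht ht1
    have hW : ∀ s : ℝ, ∃ W : ℂ, 1 / 2 ≤ s → s < 1 → HasDerivAt (fun s : ℝ => Fp F s t) W s ∧ ‖W‖ ≤ K * hU U t := by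
      intro s
      by_cases h : 1 / 2 ≤ s ∧ s < 1
      · obtain ⟨W, _, h1, h2, _⟩ := hd s t h.1 h.2 ht (ht1.trans hδδ1)
        refine ⟨W / s, fun _ _ => ⟨h1, ?_⟩⟩
        have hs0 : 0 < s := by linarith [h.1]
        rw [norm_div, Complex.norm_real, Real.norm_of_nonneg hs0.le, div_le_iff₀ hs0]
        have h3 : K1 * hU U t ≤ K1 * 2 * s * hU U t := by
          have : K1 * 1 ≤ K1 * (2 * s) := by gcongr; linarith [h.1]
          have : K1 ≤ K1 * 2 * s := by linarith
          gcongr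
        have h4 : K1 * 2 * s * hU U t ≤ K * s * hU U t := by gcongr
        linarith
      · exact ⟨0, fun h1 h2 => absurd ⟨h1, h2⟩ h⟩
    choose W hW using hW
    have := (convex_Ico (1/2 : ℝ) 1).norm_image_sub_le_of_norm_hasDerivWithin_le (C := K * hU U t)
      (f := fun s : ℝ => Fp F s t) (f' := W) (fun s hs => (hW s hs.1 hs.2).1.hasDerivWithinAt)
      (fun s hs => (hW s hs.1 hs.2).2) (x := r') (y := r) ⟨hr', hr1'⟩ ⟨hr, hr1⟩
    rwa [Real.norm_eq_abs] at this
  · intro r t hr hr1 ht ht1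
    have := H.poisson_low hr hr1 t (U t) (H.nonneg t) (by
      intro y hy hy1
      have := H.mono (a := t) (b := t + y) ⟨ht.le, by linarith⟩ ⟨by linarith, by linarith⟩ (by linarith)
      linarith [H.nonneg (t - y)])
    unfold Fp
    rw [hFre r t (by linarith) hr1]
    rw [div_le_iff₀ (by positivity)] at this
    have hpp := (H.poisson_pos (by linarith : 0 ≤ r) hr1 t).le
    nlinarith
  · intro r t hr hr1 ht ht1
    obtain ⟨W, _, _, _, _, h, _⟩ := hd r t hr hr1 ht (ht1.trans hδδ1)
    refine h.trans ?_
    have := H.nonneg t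
    have := hhpos t ht ht1
    have : 0 ≤ (1 - r) * hU U t := mul_nonneg (by linarith) (by linarith)
    gcongr; linarith
  · intro r t hr hr1 ht ht1
    unfold Fp
    rw [hFre r t (by linarith) hr1]
    apply H.poisson_low hr hr1 t
    · exact le_min (H.nonneg _) (H.nonneg _)
    · intro y hy hy1
      rcases le_total t 1 with h | h
      · have := H.mono (a := δ) (b := t + y) ⟨hδ0.le, by linarith⟩ ⟨by linarith, by linarith⟩ (by linarith)
        linarith [H.nonneg (t - y), min_le_left (U δ) (U (1/2))]
      · have := H.mono (a := 1/2) (b := t - y) ⟨by norm_num, by linarith⟩ ⟨by linarith, by linarith⟩ (by linarith)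
        linarith [H.nonneg (t + y), min_le_right (U δ) (U (1/2))]
  · intro r t hr hr1
    unfold Fp
    rw [hFre r t (by linarith) hr1]
    linarith [H.poisson_up hr hr1 t]
  · intro z hz
    have h1 := hFre ‖z‖ z.arg (norm_nonneg _) hz
    rw [Complex.norm_mul_exp_arg_mul_I] at h1
    rw [h1]
    exact H.poisson_pos (norm_nonneg _) hz _
  · intro r t hr hr1
    unfold Fp
    have h1 : ‖(r : ℂ) * Complex.exp (t * I)‖ < 1 := by rw [norm_rexp hr]; exact hr1
    rw [← F_symm U H.even F hF hFre hFim h1]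
    congr 1
    rw [map_mul, Complex.conj_ofReal, ← Complex.exp_conj]
    simp
  · intro a b ha hab hb
    rw [H.Hh_sub ha (ha.trans_le hab)]
    have h1 := H.int_h ha hab (by linarith) (fun t h0 h1 => hsm t h0 (h1.trans hb))
    have h2 := h2 b (ha.trans_le hab) (hb.trans (min_le_right _ _))
    have : K * (∫ x in a..b, hU U x) ≤ K * (2 * (1 / (4 * K))) := by gcongr; linarith
    have e : K * (2 * (1 / (4 * K))) = 1 / 2 := by field_simp; ring
    linarith
  · intro t h0 h1
    linarith [hsm t h0 h1, hhpos t h0 h1]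

end est

lemma log_near {B : ℝ} (hB : 0 ≤ B) {κ i : ℕ} (hi : 1 ≤ i) (hik : i ≤ κ) :
    Real.log (1 + B * (κ:ℝ) ^ 2 / (i:ℝ) ^ 2) ≤ B + 8 * √(κ:ℝ) * (√(i:ℝ) - √((i:ℝ) - 1)) := by
  have hi0 : (1:ℝ) ≤ i := by exact_mod_cast hi
  have hik' : (i:ℝ) ≤ κ := by exact_mod_cast hik
  set x : ℝ := κ / i with hx
  have hx1 : 1 ≤ x := by rw [hx, one_le_div (by linarith)]; exact hik'
  have e : B * (κ:ℝ) ^ 2 / (i:ℝ) ^ 2 = B * x ^ 2 := by rw [hx]; field_simp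
  rw [e]
  have h1 : 1 + B * x ^ 2 ≤ (1 + B) * x ^ 2 := by nlinarith
  have h2 : Real.log (1 + B * x ^ 2) ≤ Real.log ((1 + B) * x ^ 2) := Real.log_le_log (by positivity) h1
  rw [Real.log_mul (by positivity) (by positivity), Real.log_pow] at h2
  have h3 : Real.log (1 + B) ≤ B := by
    have := Real.log_le_sub_one_of_pos (by linarith : 0 < 1 + B); linarith
  have h4 : Real.log x ≤ 2 * √x := by
    have h5 : Real.log (√x) ≤ √x := by
      have := Real.log_le_sub_one_of_pos (Real.sqrt_pos.2 (by linarith : 0 < x)); linarith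
    rw [Real.log_sqrt (by linarith)] at h5
    linarith
  have h6 : √x = √(κ:ℝ) / √(i:ℝ) := Real.sqrt_div (by positivity) _
  have hsi : 0 < √(i:ℝ) := Real.sqrt_pos.2 (by linarith)
  have h7 : 1 / √(i:ℝ) ≤ 2 * (√(i:ℝ) - √((i:ℝ) - 1)) := by
    rw [div_le_iff₀ hsi]
    have h8 := Real.sq_sqrt (by linarith : 0 ≤ (i:ℝ))
    have h9 := Real.sq_sqrt (by linarith : 0 ≤ (i:ℝ) - 1)
    nlinarith [sq_nonneg (√(i:ℝ) - √((i:ℝ) - 1))]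
  have h8 : √x ≤ √(κ:ℝ) * (2 * (√(i:ℝ) - √((i:ℝ) - 1))) := by
    rw [h6, div_eq_mul_one_div]; gcongr
  push_cast at h2
  linarith

lemma tele {B Q : ℝ} (hB : 0 ≤ B) {κ m : ℕ} (g R : ℕ → ℝ)
    (h1 : ∀ i, 1 ≤ i → i ≤ m → i ≤ κ → g i ≤ Real.log (1 + B * (κ:ℝ) ^ 2 / (i:ℝ) ^ 2))
    (h2 : ∀ i, κ < i → i ≤ m → g i ≤ R (i - 1) - R i) (h3 : ∀ i, κ ≤ i → i ≤ m → 0 ≤ R i)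
    (h4 : κ ≤ m → R κ ≤ Q * κ) (hQ : 0 ≤ Q) : ∑ i ∈ Finset.Icc 1 m, g i ≤ (B + 8 + Q) * κ := by
  have A1 : ∀ k, k ≤ m → k ≤ κ → ∑ i ∈ Finset.Icc 1 k, g i ≤ k * B + 8 * √(κ:ℝ) * √(k:ℝ) := by
    intro k
    induction k with
    | zero => simp
    | succ k ih =>
      intro hk hk2
      rw [Finset.sum_Icc_succ_top (by omega)]
      have a1 := ih (by omega) (by omega)
      have a2 := (h1 (k + 1) (by omega) hk hk2).trans (log_near hB (by omega) hk2)
      push_cast at a2 ⊢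
      rw [add_sub_cancel_right] at a2
      linarith
  have hk : 8 * √(κ:ℝ) * √(κ:ℝ) = 8 * κ := by rw [mul_assoc, Real.mul_self_sqrt (by positivity)]
  rcases le_total m κ with h | h
  · have a1 := A1 m le_rfl h
    have h5 : √(m:ℝ) ≤ √(κ:ℝ) := Real.sqrt_le_sqrt (by exact_mod_cast h)
    have h6 : (m:ℝ) ≤ κ := by exact_mod_cast h
    have h7 : 8 * √(κ:ℝ) * √(m:ℝ) ≤ 8 * √(κ:ℝ) * √(κ:ℝ) := by gcongr
    have h8 : (m:ℝ) * B ≤ κ * B := by gcongr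
    have h9 : 0 ≤ Q * κ := by positivity
    nlinarith
  · have A2 : ∀ k, κ ≤ k → k ≤ m → ∑ i ∈ Finset.Icc 1 k, g i ≤ (B + 8) * κ + R κ - R k := by
      intro k hk0
      induction k, hk0 using Nat.le_induction with
      | base =>
        intro _
        have := A1 κ h le_rfl
        linarith
      | succ k hk ih =>
        intro hk2
        rw [Finset.sum_Icc_succ_top (by omega)]
        have a1 := ih (by omega)
        have a2 := h2 (k + 1) (by omega) hk2
        rw [Nat.add_sub_cancel] at a2
        linarith
    have a1 := A2 m h le_rfl
    have a2 := h3 m h le_rfl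
    have a3 := h4 h
    linarith

/-- The product estimate. -/
lemma prod_est {A E : ℝ} (hA : 0 ≤ A) (hE : 1 ≤ E) {κ n : ℕ} (hκ : 1 ≤ κ) (V X : ℕ → ℝ)
    (hV : ∀ j, 0 < V j) (hVa : Antitone V) (hVE : ∀ j k, j ≤ k → k ≤ j + κ → V j ≤ E * V k)
    (hX : ∀ j, V (j + 1) ≤ κ * (X (j + 1) - X j)) (k : ℕ) (hk : k < n) :
    ∑ j ∈ (Finset.range n).erase k, Real.log (1 + A * (V j * V k) / (X j - X k) ^ 2) ≤
      (4 * A * E + 16) * κ := by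
  have hκ0 : (0:ℝ) < κ := by exact_mod_cast hκ
  have hXd : ∀ j i : ℕ, (i:ℝ) * V (j + i) ≤ κ * (X (j + i) - X j) := by
    intro j i
    induction i with
    | zero => simp
    | succ i ih =>
      have a1 := hX (j + i)
      have a2 := hVa (by omega : j + i ≤ j + (i + 1))
      have a3 : (i:ℝ) * V (j + (i + 1)) ≤ i * V (j + i) := by gcongr
      rw [← add_assoc] at *
      push_cast
      linarith
  have hXm : StrictMono X := strictMono_nat_of_lt_succ fun j => by
    have := hX j
    have := hV (j + 1)
    by_contra h
    push Not at h
    nlinarith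
  set f : ℕ → ℝ := fun j => Real.log (1 + A * (V j * V k) / (X j - X k) ^ 2) with hf
  have hf0 : ∀ j, 0 ≤ f j := fun j => Real.log_nonneg (by
    have : 0 ≤ A * (V j * V k) / (X j - X k) ^ 2 := by
      have := (hV j).le; have := (hV k).le
      positivity
    linarith)
  have hAE : 0 ≤ A * E := by positivity
  -- upper part
  have up : ∑ i ∈ Finset.Icc 1 n, f (k + i) ≤ (A * E + 8 + A * E) * κ := by
    apply tele hAE (fun i => f (k + i)) (fun i => A * V k * κ * (1 / (X (k + i) - X k)))
    · intro i hi _ hik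
      apply Real.log_le_log (by have := (hV (k+i)).le; have := (hV k).le; positivity)
      have hi0 : (0:ℝ) < i := by exact_mod_cast hi
      have a1 := hXd k i
      have hd : 0 < X (k + i) - X k := sub_pos.2 (hXm (by omega))
      have a2 := hVE k (k + i) (by omega) (by omega)
      have v1 := hV (k + i); have v2 := hV k
      have a3 : ((i:ℝ) * V (k + i)) ^ 2 ≤ (κ * (X (k + i) - X k)) ^ 2 := pow_le_pow_left₀ (by positivity) a1 2
      gcongr 1 + ?_
      rw [div_le_div_iff₀ (by positivity) (by positivity)]
      calc A * (V (k + i) * V k) * (i:ℝ) ^ 2 ≤ A * (V (k + i) * (E * V (k + i))) * (i:ℝ) ^ 2 := by gcongr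
        _ = A * E * ((i:ℝ) * V (k + i)) ^ 2 := by ring
        _ ≤ A * E * (κ * (X (k + i) - X k)) ^ 2 := by gcongr
        _ = _ := by ring
    · intro i hi _
      have hd : 0 < X (k + i) - X k := sub_pos.2 (hXm (by omega))
      have hd' : 0 < X (k + (i - 1)) - X k := sub_pos.2 (hXm (by omega))
      have v1 := hV (k + i); have v2 := hV k
      have a1 := hX (k + (i - 1))
      rw [show k + (i - 1) + 1 = k + i by omega] at a1
      have a0 : f (k + i) ≤ A * (V (k + i) * V k) / (X (k + i) - X k) ^ 2 := by
        have := Real.log_le_sub_one_of_pos (by positivity : 0 < 1 + A * (V (k + i) * V k) / (X (k + i) - X k) ^ 2)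
        simp only [hf]
        linarith
      refine a0.trans ?_
      rw [← mul_sub, div_sub_div _ _ hd'.ne' hd.ne', one_mul, mul_one]
      have e : X (k + i) - X k - (X (k + (i - 1)) - X k) = X (k + i) - X (k + (i - 1)) := by ring
      rw [e, ← mul_div_assoc]
      have a4 : 0 < X (k + i) - X (k + (i - 1)) := sub_pos.2 (hXm (by omega))
      have a3 : (X (k + (i - 1)) - X k) * (X (k + i) - X k) ≤ (X (k + i) - X k) ^ 2 := by
        rw [sq]; gcongr; linarith
      apply div_le_div₀ (by positivity) _ (by positivity) a3
      calc A * (V (k + i) * V k) ≤ A * ((κ * (X (k + i) - X (k + (i - 1)))) * V k) := by gcongr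
        _ = _ := by ring
    · intro i hi _
      have hd : 0 < X (k + i) - X k := sub_pos.2 (hXm (by omega))
      have v2 := hV k
      positivity
    · intro _
      have a1 := hXd k κ
      have a2 : V (k + κ) ≤ X (k + κ) - X k := by
        by_contra h; push Not at h; nlinarith
      have a3 := hVE k (k + κ) (by omega) le_rfl
      have hd : 0 < X (k + κ) - X k := sub_pos.2 (hXm (by omega))
      rw [mul_one_div, div_le_iff₀ hd]
      have : V k ≤ E * (X (k + κ) - X k) := a3.trans (by gcongr)
      calc A * V k * κ ≤ A * (E * (X (k + κ) - X k)) * κ := by gcongr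
        _ = _ := by ring
    · exact hAE
  -- lower part
  have lo : ∑ i ∈ Finset.Icc 1 k, f (k - i) ≤ (A * E + 8 + A * E) * κ := by
    apply tele hAE (fun i => f (k - i)) (fun i => A * V k * (E * κ) * (1 / (X k - X (k - i))))
    · intro i hi him hik
      obtain ⟨j, rfl⟩ : ∃ j, k = j + i := ⟨k - i, by omega⟩
      simp only [Nat.add_sub_cancel, hf]
      apply Real.log_le_log (by have := (hV (j+i)).le; have := (hV j).le; positivity)
      have hi0 : (0:ℝ) < i := by exact_mod_cast hi
      have a1 := hXd j i
      have hd : 0 < X (j + i) - X j := sub_pos.2 (hXm (by omega))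
      have a2 := hVE j (j + i) (by omega) (by omega)
      have v1 := hV (j + i); have v2 := hV j
      have a3 : ((i:ℝ) * V (j + i)) ^ 2 ≤ (κ * (X (j + i) - X j)) ^ 2 := pow_le_pow_left₀ (by positivity) a1 2
      gcongr 1 + ?_
      rw [show (X j - X (j + i)) ^ 2 = (X (j + i) - X j) ^ 2 by ring]
      rw [div_le_div_iff₀ (by positivity) (by positivity)]
      calc A * (V j * V (j + i)) * (i:ℝ) ^ 2 ≤ A * ((E * V (j + i)) * V (j + i)) * (i:ℝ) ^ 2 := by gcongr
        _ = A * E * ((i:ℝ) * V (j + i)) ^ 2 := by ring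
        _ ≤ A * E * (κ * (X (j + i) - X j)) ^ 2 := by gcongr
        _ = _ := by ring
    · intro i hi him
      obtain ⟨j, hj⟩ : ∃ j, k = j + i := ⟨k - i, by omega⟩
      have e1 : k - i = j := by omega
      have e2 : k - (i - 1) = j + 1 := by omega
      simp only [e1, e2]
      have hd : 0 < X k - X j := sub_pos.2 (hXm (by omega))
      have hd' : 0 < X k - X (j + 1) := sub_pos.2 (hXm (by omega))
      have v1 := hV j; have v2 := hV k
      have a1 := hX j
      have a5 := hVE j (j + 1) (by omega) (by omega)
      have a0 : f j ≤ A * (V j * V k) / (X j - X k) ^ 2 := by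
        have h9 : X j - X k ≠ 0 := by linarith
        have := Real.log_le_sub_one_of_pos (by positivity : 0 < 1 + A * (V j * V k) / (X j - X k) ^ 2)
        simp only [hf]
        linarith
      refine a0.trans ?_
      rw [← mul_sub, div_sub_div _ _ hd'.ne' hd.ne', one_mul, mul_one]
      have e : X k - X j - (X k - X (j + 1)) = X (j + 1) - X j := by ring
      rw [e, ← mul_div_assoc, show (X j - X k) ^ 2 = (X k - X j) ^ 2 by ring]
      have a4 : 0 < X (j + 1) - X j := sub_pos.2 (hXm (by omega))
      have a3 : (X k - X (j + 1)) * (X k - X j) ≤ (X k - X j) ^ 2 := by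
        rw [sq]; gcongr; linarith
      apply div_le_div₀ (by positivity) _ (by positivity) a3
      calc A * (V j * V k) ≤ A * ((E * (κ * (X (j + 1) - X j))) * V k) := by
            gcongr; exact a5.trans (by gcongr)
        _ = _ := by ring
    · intro i hi him
      have hd : 0 < X k - X (k - i) := sub_pos.2 (hXm (by omega))
      have v2 := hV k
      positivity
    · intro hkm
      obtain ⟨j, hj⟩ : ∃ j, k = j + κ := ⟨k - κ, by omega⟩
      have e1 : k - κ = j := by omega
      simp only [e1]
      have a1 := hXd j κ
      rw [← hj] at a1
      have a2 : V k ≤ X k - X j := by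
        by_contra h; push Not at h; nlinarith
      have hd : 0 < X k - X j := sub_pos.2 (hXm (by omega))
      rw [mul_one_div, div_le_iff₀ hd]
      calc A * V k * (E * κ) ≤ A * (X k - X j) * (E * κ) := by gcongr
        _ = _ := by ring
    · exact hAE
  have split : ∑ j ∈ (Finset.range n).erase k, f j ≤
      ∑ i ∈ Finset.Icc 1 n, f (k + i) + ∑ i ∈ Finset.Icc 1 k, f (k - i) := by
    have e1 : ∑ i ∈ Finset.Icc 1 n, f (k + i) = ∑ j ∈ (Finset.Icc 1 n).image (fun i => k + i), f j := by
      rw [Finset.sum_image]; intro a _ b _ h; simpa using h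
    have e2 : ∑ i ∈ Finset.Icc 1 k, f (k - i) = ∑ j ∈ (Finset.Icc 1 k).image (fun i => k - i), f j := by
      rw [Finset.sum_image]; intro a ha b hb h
      simp only [Finset.coe_Icc, mem_Icc] at ha hb h
      omega
    rw [e1, e2, ← Finset.sum_union]
    · apply Finset.sum_le_sum_of_subset_of_nonneg
      · intro j hj
        simp only [Finset.mem_erase, Finset.mem_range, Finset.mem_union, Finset.mem_image, Finset.mem_Icc] at *
        rcases lt_or_gt_of_ne hj.1 with h | h
        · right; exact ⟨k - j, by omega, by omega⟩
        · left; exact ⟨j - k, by omega, by omega⟩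
      · intro j _ _; exact hf0 j
    · rw [Finset.disjoint_left]
      intro j h1 h2
      simp only [Finset.mem_image, Finset.mem_Icc] at h1 h2
      omega
  nlinarith

def Gg (U : ℝ → ℝ) (t : ℝ) : ℝ := ∫ x in t..(1 : ℝ), hU U x / U x

section est
variable {U U' U'' : ℝ → ℝ} {C₀ : ℝ} {F : ℂ → ℂ} {δ K c : ℝ}

lemma UD.hdU_cont (H : UD U U' U'' C₀) : ContinuousOn (fun x => hU U x / U x) (Ioc 0 Real.pi) := by
  intro x hx
  have h1 : ContinuousAt (fun x => hU U x / U x) x :=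
    (H.h_deriv hx.1).continuousAt.div H.cont.continuousAt (H.pos x hx.1 hx.2).ne'
  exact h1.continuousWithinAt

lemma UD.hdU_ii (H : UD U U' U'' C₀) {a b : ℝ} (ha : 0 < a) (hb : 0 < b) (ha1 : a ≤ Real.pi) (hb1 : b ≤ Real.pi) :
    IntervalIntegrable (fun x => hU U x / U x) volume a b := by
  apply ContinuousOn.intervalIntegrable
  apply H.hdU_cont.mono
  intro x hx
  exact ⟨lt_of_lt_of_le (lt_min ha hb) hx.1, hx.2.trans (max_le ha1 hb1)⟩

lemma UD.Gg_sub (H : UD U U' U'' C₀) {a b : ℝ} (ha : 0 < a) (hb : 0 < b) (ha1 : a ≤ Real.pi) (hb1 : b ≤ Real.pi) :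
    Gg U a - Gg U b = ∫ x in a..b, hU U x / U x := by
  have hp := Real.pi_gt_three
  unfold Gg
  rw [sub_eq_iff_eq_add, intervalIntegral.integral_add_adjacent_intervals (H.hdU_ii ha hb ha1 hb1)
    (H.hdU_ii hb one_pos hb1 (by linarith))]

lemma UD.Gg_cont (H : UD U U' U'' C₀) : ContinuousOn (Gg U) (Ioc 0 1) := by
  have hp := Real.pi_gt_three
  intro t ht
  have h1 : HasDerivAt (Gg U) (-(hU U t / U t)) t := by
    unfold Gg
    have hc : ContinuousOn (fun x => hU U x / U x) (Ioo 0 Real.pi) := H.hdU_cont.mono Ioo_subset_Ioc_self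
    have hm : t ∈ Ioo 0 Real.pi := ⟨ht.1, by linarith [ht.2]⟩
    apply intervalIntegral.integral_hasDerivAt_left (H.hdU_ii ht.1 one_pos hm.2.le (by linarith))
    · exact hc.stronglyMeasurableAtFilter isOpen_Ioo t hm
    · exact hc.continuousAt (isOpen_Ioo.mem_nhds hm)
  exact h1.continuousAt.continuousWithinAt

lemma FD.g123 (H : UD U U' U'' C₀) (D : FD U F δ K c) {s t : ℝ} (hs : 0 < s) (hst : s ≤ t) (ht : t ≤ δ) :
    U s * (Gg U s - Gg U t) ≤ Hh U t - Hh U s ∧ Hh U t - Hh U s ≤ U t * (Gg U s - Gg U t) ∧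
    Real.log t - Real.log s ≤ Gg U s - Gg U t ∧ U t ≤ Real.exp (C₀ * (Gg U s - Gg U t)) * U s := by
  have hp := Real.pi_gt_three
  have d1 := D.d1
  have ht0 := hs.trans_le hst
  have hii := H.hdU_ii hs ht0 (by linarith) (by linarith)
  have hpos : ∀ x ∈ Icc s t, 0 < x ∧ 0 < U x ∧ U s ≤ U x ∧ U x ≤ U t ∧ 0 ≤ hU U x ∧ U x / x ≤ hU U x := by
    intro x hx
    have h0 := hs.trans_le hx.1
    refine ⟨h0, H.pos x h0 (by linarith [hx.2]), ?_, ?_, ?_, D.Uh x h0 (hx.2.trans ht)⟩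
    · exact H.mono ⟨hs.le, by linarith⟩ ⟨h0.le, by linarith [hx.2]⟩ hx.1
    · exact H.mono ⟨h0.le, by linarith [hx.2]⟩ ⟨ht0.le, by linarith⟩ hx.2
    · exact H.h_nonneg h0 (by linarith [hx.2])
  rw [H.Gg_sub hs ht0 (by linarith) (by linarith), H.Hh_sub hs ht0]
  have k3 : Real.log t - Real.log s ≤ ∫ x in s..t, hU U x / U x := by
    rw [← Real.log_div ht0.ne' hs.ne', ← integral_inv_of_pos hs ht0]
    apply intervalIntegral.integral_mono_on hst _ hii
    · intro x hx
      obtain ⟨h0, hU, _, _, _, h⟩ := hpos x hx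
      rw [div_le_iff₀ h0] at h
      rw [inv_eq_one_div, div_le_div_iff₀ h0 hU]; linarith
    · rw [intervalIntegrable_inv_iff]; right
      rw [uIcc_of_le hst]; intro h; linarith [h.1]
  refine ⟨?_, ?_, k3, ?_⟩
  · rw [← intervalIntegral.integral_const_mul]
    apply intervalIntegral.integral_mono_on hst (hii.const_mul _) (H.h_ii hs ht0)
    intro x hx
    obtain ⟨h0, hU, h1, _, h2, h⟩ := hpos x hx
    rw [← mul_div_assoc, div_le_iff₀ hU]
    nlinarith
  · rw [← intervalIntegral.integral_const_mul]
    apply intervalIntegral.integral_mono_on hst (H.h_ii hs ht0) (hii.const_mul _)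
    intro x hx
    obtain ⟨h0, hU, h1, h3, h2, h⟩ := hpos x hx
    rw [← mul_div_assoc, le_div_iff₀ hU]
    nlinarith
  · have h1 := H.log_anti ⟨hs, by linarith⟩ ⟨ht0, by linarith⟩ hst
    simp only at h1
    have hUs := H.pos s hs (by linarith)
    have hUt := H.pos t ht0 (by linarith)
    have hC := H.C0
    have h2 : C₀ * (Real.log t - Real.log s) ≤ C₀ * ∫ x in s..t, hU U x / U x := by gcongr
    have h3 : Real.log (U t) ≤ (C₀ * ∫ x in s..t, hU U x / U x) + Real.log (U s) := by linarith
    have h7 := Real.exp_le_exp.2 h3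
    rwa [Real.exp_add, Real.exp_log hUs, Real.exp_log hUt] at h7

lemma FD.exists_tau (H : UD U U' U'' C₀) (D : FD U F δ K c) : ∃ τ : ℝ → ℝ, ∀ y, 0 ≤ y →
    0 < τ y ∧ τ y ≤ δ ∧ Gg U (τ y) = Gg U δ + y := by
  have d0 := D.d0
  have d1 := D.d1
  have : ∀ y : ℝ, ∃ t : ℝ, 0 ≤ y → 0 < t ∧ t ≤ δ ∧ Gg U t = Gg U δ + y := by
    intro y
    by_cases hy : 0 ≤ y
    · set s := δ * Real.exp (-y) with hs
      have hs0 : 0 < s := by positivity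
      have hsd : s ≤ δ := by
        rw [hs]; have : Real.exp (-y) ≤ 1 := Real.exp_le_one_iff.2 (by linarith)
        nlinarith
      have h3 := (D.g123 H hs0 hsd le_rfl).2.2.1
      rw [hs, Real.log_mul d0.ne' (Real.exp_pos _).ne', Real.log_exp, ← hs] at h3
      have hc : ContinuousOn (Gg U) (Icc s δ) := H.Gg_cont.mono fun x hx => ⟨hs0.trans_le hx.1, hx.2.trans d1⟩
      obtain ⟨t, ht, h⟩ := intermediate_value_Icc' hsd hc (⟨by linarith, by linarith⟩ : Gg U δ + y ∈ Icc (Gg U δ) (Gg U s))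
      exact ⟨t, fun _ => ⟨hs0.trans_le ht.1, ht.2, h⟩⟩
    · exact ⟨0, fun h => absurd h hy⟩
  choose τ hτ using this
  exact ⟨τ, hτ⟩

lemma FD.Gg_strict (H : UD U U' U'' C₀) (D : FD U F δ K c) {s t : ℝ} (hs : 0 < s) (hst : s < t) (ht : t ≤ δ) :
    Gg U t < Gg U s := by
  have h3 := (D.g123 H hs hst.le ht).2.2.1
  have := Real.log_lt_log hs hst
  linarith

lemma FD.Gg_le_iff (H : UD U U' U'' C₀) (D : FD U F δ K c) {s t : ℝ} (hs : 0 < s) (hs1 : s ≤ δ) (ht0 : 0 < t) (ht : t ≤ δ) :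
    Gg U t ≤ Gg U s ↔ s ≤ t := by
  constructor
  · intro h; by_contra h2; push Not at h2
    linarith [D.Gg_strict H ht0 h2 hs1]
  · intro h
    rcases h.eq_or_lt with h | h
    · rw [h]
    · exact (D.Gg_strict H hs h ht).le

end est

lemma norm_one_sub_sq (w z : ℂ) : ‖1 - (starRingEnd ℂ) w * z‖ ^ 2 = ‖z - w‖ ^ 2 + (1 - ‖w‖ ^ 2) * (1 - ‖z‖ ^ 2) := by
  rw [Complex.sq_norm, Complex.sq_norm, Complex.sq_norm, Complex.sq_norm]
  simp only [Complex.normSq_apply, Complex.sub_re, Complex.sub_im, Complex.mul_re, Complex.mul_im,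
    Complex.conj_re, Complex.conj_im, Complex.one_re, Complex.one_im]
  ring

lemma bl_norm_sq {w z : ℂ} (hw : ‖w‖ < 1) (hz : ‖z‖ < 1) :
    ‖bl w z‖ ^ 2 = ‖z - w‖ ^ 2 / (‖z - w‖ ^ 2 + (1 - ‖w‖ ^ 2) * (1 - ‖z‖ ^ 2)) := by
  unfold bl
  rw [norm_div, div_pow, norm_one_sub_sq]

lemma one_sub_sq_pos {w : ℂ} (hw : ‖w‖ < 1) : 0 < 1 - ‖w‖ ^ 2 := by
  nlinarith [norm_nonneg w]

lemma bl_low {w z : ℂ} (hw : ‖w‖ < 1) (hz : ‖z‖ < 1) {q : ℝ} (hq : 0 ≤ q) 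
    (h : (1 - ‖w‖ ^ 2) * (1 - ‖z‖ ^ 2) ≤ q * ‖z - w‖ ^ 2) :
    Real.exp (-(1 / 2) * Real.log (1 + q)) ≤ ‖bl w z‖ := by
  have h1 := one_sub_sq_pos hw
  have h2 := one_sub_sq_pos hz
  have h3 : 0 < (1 - ‖w‖ ^ 2) * (1 - ‖z‖ ^ 2) := mul_pos h1 h2
  apply le_of_sq_le_sq _ (norm_nonneg _)
  rw [bl_norm_sq hw hz, ← Real.exp_nat_mul]
  have e : ((2 : ℕ) : ℝ) * (-(1 / 2) * Real.log (1 + q)) = -Real.log (1 + q) := by push_cast; ring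
  rw [e, Real.exp_neg, Real.exp_log (by linarith), le_div_iff₀ (by positivity), inv_mul_le_iff₀ (by linarith)]
  nlinarith

lemma polar_dist {M u1 u2 x1 x2 : ℝ} (h1 : u1 ≤ M) (h2 : u2 ≤ M) (hx : |x1 - x2| ≤ 1) :
    (2 / 5) * Real.exp (-(2 * M)) * (x1 - x2) ^ 2 ≤
      ‖Complex.exp (-(u1 : ℂ) + x1 * I) - Complex.exp (-(u2 : ℂ) + x2 * I)‖ ^ 2 := by
  have e : ‖Complex.exp (-(u1 : ℂ) + x1 * I) - Complex.exp (-(u2 : ℂ) + x2 * I)‖ ^ 2 =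
      (Real.exp (-u1) - Real.exp (-u2)) ^ 2 + Real.exp (-u1) * Real.exp (-u2) * (2 - 2 * Real.cos (x1 - x2)) := by
    rw [Complex.sq_norm, Complex.normSq_apply]
    simp only [Complex.sub_re, Complex.sub_im, Complex.exp_re, Complex.exp_im]
    simp
    rw [Real.cos_sub]
    linear_combination (Real.exp (-u1)) ^ 2 * Real.sin_sq_add_cos_sq x1 + (Real.exp (-u2)) ^ 2 * Real.sin_sq_add_cos_sq x2
  rw [e]
  have hp := Real.pi_gt_three
  have hs := (sin_half_sq (abs_nonneg (x1 - x2)) (by linarith)).1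
  have hc : Real.cos (x1 - x2) = 1 - 2 * Real.sin (|x1 - x2| / 2) ^ 2 := by
    rw [← Real.cos_abs (x1 - x2), Real.sin_sq_eq_half_sub]
    have : 2 * (|x1 - x2| / 2) = |x1 - x2| := by ring
    rw [this]; ring
  rw [sq_abs] at hs
  have he : Real.exp (-(2 * M)) ≤ Real.exp (-u1) * Real.exp (-u2) := by
    rw [← Real.exp_add]; exact Real.exp_le_exp.2 (by linarith)
  have h3 : (2 / 5) * (x1 - x2) ^ 2 ≤ 2 - 2 * Real.cos (x1 - x2) := by rw [hc]; linarith
  have h4 : Real.exp (-(2 * M)) * ((2 / 5) * (x1 - x2) ^ 2) ≤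
      Real.exp (-u1) * Real.exp (-u2) * (2 - 2 * Real.cos (x1 - x2)) :=
    mul_le_mul he h3 (by positivity) (by positivity)
  nlinarith [sq_nonneg (Real.exp (-u1) - Real.exp (-u2))]

section est
variable {U U' U'' : ℝ → ℝ} {C₀ : ℝ} {F : ℂ → ℂ} {δ K c : ℝ}

lemma UD.Hh_le (H : UD U U' U'' C₀) {a b : ℝ} (ha : 0 < a) (hab : a ≤ b) (hb : b ≤ Real.pi) :
    Hh U b - Hh U a ≤ hU U a * (b - a) ∧ hU U b * (b - a) ≤ Hh U b - Hh U a := by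
  have hb0 := ha.trans_le hab
  rw [H.Hh_sub ha hb0]
  constructor
  · calc ∫ x in a..b, hU U x ≤ ∫ x in a..b, hU U a := by
          apply intervalIntegral.integral_mono_on hab (H.h_ii ha hb0) (by simp)
          intro x hx
          exact H.h_anti ha hx.1
      _ = _ := by simp; ring
  · calc hU U b * (b - a) = ∫ x in a..b, hU U b := by simp; ring
      _ ≤ _ := by
          apply intervalIntegral.integral_mono_on hab (by simp) (H.h_ii ha hb0)
          intro x hx
          exact H.h_anti (ha.trans_le hx.1) hx.2

lemma FD.pts (H : UD U U' U'' C₀) (D : FD U F δ K c) {n κ : ℕ} {s : ℝ} (hκ : 1 ≤ κ) (hs : 0 < s) (hsδ : s ≤ δ)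
    (hn : (n : ℝ) ≤ κ * (Gg U s - Gg U δ)) : ∃ t : ℕ → ℝ, (∀ j, 0 < t j ∧ t j ≤ δ) ∧ (∀ j < n, s ≤ t j) ∧
    Antitone t ∧ (∀ j, U (t (j + 1)) ≤ κ * (Hh U (t j) - Hh U (t (j + 1)))) ∧
    (∀ j k, j ≤ k → k ≤ j + κ → U (t j) ≤ Real.exp C₀ * U (t k)) := by
  obtain ⟨τ, hτ⟩ := D.exists_tau H
  have hκ0 : (0 : ℝ) < κ := by exact_mod_cast hκ
  have ht : ∀ j : ℕ, 0 < τ (j / κ) ∧ τ (j / κ) ≤ δ ∧ Gg U (τ (j / κ)) = Gg U δ + j / κ :=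
    fun j => hτ _ (by positivity)
  have hanti : Antitone (fun j : ℕ => τ ((j : ℝ) / κ)) := by
    intro i j hij
    rw [← D.Gg_le_iff H (ht j).1 (ht j).2.1 (ht i).1 (ht i).2.1, (ht i).2.2, (ht j).2.2]
    gcongr
  refine ⟨fun j : ℕ => τ (j / κ), fun j => ⟨(ht j).1, (ht j).2.1⟩, ?_, hanti, ?_, ?_⟩
  · intro j hj
    rw [← D.Gg_le_iff H hs hsδ (ht j).1 (ht j).2.1, (ht j).2.2]
    have : (j : ℝ) / κ ≤ Gg U s - Gg U δ := by
      rw [div_le_iff₀ hκ0]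
      have : (j : ℝ) ≤ n := by exact_mod_cast hj.le
      linarith
    linarith
  · intro j
    have h := (D.g123 H (ht (j + 1)).1 (hanti (Nat.le_succ j)) (ht j).2.1).1
    rw [(ht j).2.2, (ht (j + 1)).2.2] at h
    have e : Gg U δ + ((j + 1 : ℕ) : ℝ) / κ - (Gg U δ + (j : ℝ) / κ) = 1 / κ := by push_cast; field_simp; ring
    rw [e, mul_one_div, div_le_iff₀ hκ0] at h
    simpa [mul_comm] using h
  · intro j k hjk hk
    have h := (D.g123 H (ht k).1 (hanti hjk) (ht j).2.1).2.2.2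
    rw [(ht j).2.2, (ht k).2.2] at h
    refine h.trans ?_
    have hU0 := H.pos _ (ht k).1 (by linarith [(ht k).2.1, D.d1, Real.pi_gt_three])
    gcongr
    have : (k : ℝ) / κ ≤ j / κ + 1 := by
      rw [div_add_one hκ0.ne']; gcongr; exact_mod_cast hk
    nlinarith [H.C0]

lemma re_parts (z : ℂ) : Complex.exp (-z) = Complex.exp (-((z.re : ℝ) : ℂ) + ((-z.im : ℝ) : ℂ) * I) := by
  congr 1
  apply Complex.ext <;> simp

end est

section est
variable {U U' U'' : ℝ → ℝ} {C₀ : ℝ} {F : ℂ → ℂ} {δ K c : ℝ}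

set_option maxHeartbeats 1000000 in
lemma FD.lower_pts (H : UD U U' U'' C₀) (D : FD U F δ K c) : ∃ η : ℝ, 0 < η ∧ η ≤ 1 ∧ ∀ (n κ : ℕ) (s : ℝ),
    1 ≤ κ → 0 < s → s ≤ δ → (n : ℝ) ≤ κ * (Gg U s - Gg U δ) → ∃ ε t u x V X : ℕ → ℝ,
    (∀ j, 0 < ε j ∧ ε j ≤ 1) ∧ (∀ j, 0 < t j ∧ t j ≤ 1) ∧ (∀ j k, j < k → t k + ε k ≤ t j) ∧
    (∀ j, F (Complex.exp (-(ε j : ℂ) + t j * I)) = u j - x j * I) ∧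
    (∀ j, 0 < V j) ∧ Antitone V ∧ (∀ j k, j ≤ k → k ≤ j + κ → V j ≤ Real.exp C₀ * V k) ∧
    (∀ j, V (j + 1) ≤ κ * (X (j + 1) - X j)) ∧
    (∀ j, V j ≤ K * u j ∧ u j ≤ 2 * K * V j ∧ u j ≤ K) ∧
    (∀ j k, j < k → (X k - X j) / (2 * K) ≤ x j - x k ∧ x j - x k ≤ 1) ∧
    (∀ j < n, η * V j ≤ κ * hU U s * ε j) := by
  have hp := Real.pi_gt_three
  have hp4 := Real.pi_lt_four
  have hE0 : 0 < Real.exp C₀ := Real.exp_pos _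
  have hE1 : 1 ≤ Real.exp C₀ := Real.one_le_exp H.C0.le
  have K1 := D.K1
  have K0 : 0 < K := by linarith
  set E := Real.exp C₀ with hEdef
  refine ⟨min (1 / 16) (1 / (4 * K ^ 2 * E)), by positivity, (min_le_left _ _).trans (by norm_num), ?_⟩
  set η := min (1 / 16) (1 / (4 * K ^ 2 * E)) with hη
  have hη0 : 0 < η := by positivity
  have hη1 : η ≤ 1 / 16 := min_le_left _ _
  have hη2 : η * (4 * K ^ 2 * E) ≤ 1 := by
    have := min_le_right (1 / 16) (1 / (4 * K ^ 2 * E))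
    rwa [← hη, le_div_iff₀ (by positivity)] at this
  intro n κ s hκ hs hsδ hn
  obtain ⟨t, ht, hts, hta, hX, hVE⟩ := D.pts H hκ hs hsδ hn
  have hκ1 : (1 : ℝ) ≤ κ := by exact_mod_cast hκ
  have hκ0 : (0 : ℝ) < κ := by linarith
  have d1 := D.d1
  have hV0 : ∀ j, 0 < U (t j) := fun j => H.pos _ (ht j).1 (by linarith [(ht j).2])
  have hh1 : ∀ j, 1 ≤ hU U (t j) := fun j => D.h1 _ (ht j).1 (ht j).2
  have hVa : Antitone (fun j => U (t j)) := by
    intro i j hij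
    exact H.mono ⟨(ht j).1.le, by linarith [(ht j).2]⟩ ⟨(ht i).1.le, by linarith [(ht i).2]⟩ (hta hij)
  set ε : ℕ → ℝ := fun j => η * U (t j) / (κ * hU U (t j)) with hε
  have hε0 : ∀ j, 0 < ε j := by
    intro j
    have h1 := hh1 j
    have h2 := hV0 j
    simp only [hε]; positivity
  have hεh : ∀ j, κ * (hU U (t j) * ε j) = η * U (t j) := by
    intro j
    have h1 := hh1 j
    have h2 : hU U (t j) ≠ 0 := by linarith
    simp only [hε]; field_simp
  have hεt : ∀ j, ε j ≤ η * t j := by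
    intro j
    have h1 := D.Uh _ (ht j).1 (ht j).2
    rw [div_le_iff₀ (ht j).1] at h1
    have h3 := hh1 j
    have h2 := hεh j
    have h4 : hU U (t j) * ε j ≤ hU U (t j) * (η * t j) := by
      have : hU U (t j) * ε j ≤ κ * (hU U (t j) * ε j) := by
        have : 0 ≤ hU U (t j) * ε j := mul_nonneg (by linarith) (hε0 j).le
        nlinarith
      nlinarith
    exact le_of_mul_le_mul_left h4 (by linarith)
  set r : ℕ → ℝ := fun j => Real.exp (-ε j) with hr
  have hr1 : ∀ j, r j < 1 := fun j => by simp only [hr]; exact Real.exp_lt_one_iff.2 (by linarith [hε0 j])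
  have hrε : ∀ j, 1 - r j ≤ ε j := fun j => by
    simp only [hr]; linarith [Real.add_one_le_exp (-ε j)]
  have hεs : ∀ j, ε j ≤ 1 / 16 := fun j => by
    have h1 := hεt j
    have h2 : t j ≤ 1 := (ht j).2.trans d1
    nlinarith [(ht j).1]
  have hr2 : ∀ j, 1 / 2 ≤ r j := fun j => by linarith [hrε j, hεs j]
  have hrad : ∀ j r', r j ≤ r' → r' < 1 → |(Fp F r' (t j)).im - (Fp F (r j) (t j)).im| ≤ K * (η * U (t j)) / κ := by
    intro j r' h1 h2
    have h3 := D.rad r' (r j) (t j) ((hr2 j).trans h1) h2 (hr2 j) (hr1 j) (ht j).1 (ht j).2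
    rw [abs_of_nonneg (by linarith)] at h3
    have h4 := Complex.abs_im_le_norm (Fp F r' (t j) - Fp F (r j) (t j))
    rw [Complex.sub_im] at h4
    refine h4.trans (h3.trans ?_)
    rw [le_div_iff₀ hκ0, ← hεh j]
    have h5 : r' - r j ≤ ε j := by linarith [hrε j]
    have h6 : 0 ≤ K * hU U (t j) * κ := by have := hh1 j; positivity
    nlinarith
  refine ⟨ε, t, fun j => (Fp F (r j) (t j)).re, fun j => -(Fp F (r j) (t j)).im, fun j => U (t j),
    fun j => - Hh U (t j), fun j => ⟨hε0 j, by linarith [hεs j]⟩, fun j => ⟨(ht j).1, (ht j).2.trans d1⟩, ?_, ?_,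
    hV0, hVa, hVE, ?_, ?_, ?_, ?_⟩
  · intro j k hjk
    obtain ⟨m, rfl⟩ : ∃ m, k = m + 1 := ⟨k - 1, by omega⟩
    have h1 : t m ≤ t j := hta (by omega)
    have h2 := (H.Hh_le (ht (m + 1)).1 (hta (Nat.le_succ m)) (by linarith [(ht m).2])).1
    have h3 := hX m
    have h4 := hεh (m + 1)
    have h5 : 0 < hU U (t (m + 1)) := by linarith [hh1 (m + 1)]
    have h6 := hV0 (m + 1)
    have h7 : κ * hU U (t (m + 1)) * ε (m + 1) ≤ κ * hU U (t (m + 1)) * (t m - t (m + 1)) := by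
      have h9 : κ * (Hh U (t m) - Hh U (t (m + 1))) ≤ κ * (hU U (t (m + 1)) * (t m - t (m + 1))) := by gcongr
      nlinarith
    have h8 := le_of_mul_le_mul_left h7 (by positivity)
    linarith
  · intro j
    have : Complex.exp (-(ε j : ℂ) + t j * I) = (r j : ℂ) * Complex.exp (t j * I) := by
      rw [Complex.exp_add]; simp [hr]
    rw [this]
    change Fp F (r j) (t j) = _
    apply Complex.ext <;> simp
  · intro j
    have := hX j
    dsimp only
    linarith
  · intro j
    refine ⟨D.ulow _ _ (hr2 j) (hr1 j) (ht j).1 (ht j).2, ?_, D.uM _ _ (hr2 j) (hr1 j)⟩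
    refine (D.uup _ _ (hr2 j) (hr1 j) (ht j).1 (ht j).2).trans ?_
    have h1 := hh1 j
    have h2 : (1 - r j) * hU U (t j) ≤ U (t j) := by
      have h3 : (1 - r j) * hU U (t j) ≤ ε j * hU U (t j) := by gcongr; exact hrε j
      have h4 := hεh j
      have h5 : 0 ≤ hU U (t j) * ε j := mul_nonneg (by linarith) (hε0 j).le
      have h6 := hV0 j
      nlinarith
    nlinarith
  · intro j k hjk
    dsimp only
    set R := max (r j) (r k) with hR
    have hRj : r j ≤ R := le_max_left _ _
    have hRk : r k ≤ R := le_max_right _ _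
    have hR1 : R < 1 := max_lt (hr1 j) (hr1 k)
    have hR2 : 1 / 2 ≤ R := (hr2 j).trans hRj
    have htjk := hta hjk.le
    have a1 := D.arcl R (t k) (t j) hR2 hR1 (ht k).1 htjk (ht j).2 (by
      rw [le_div_iff₀ (by positivity)]
      have h1 : 1 - R ≤ η * t k := by linarith [hrε k, hεt k]
      have h2 : 0 ≤ 1 - R := by linarith
      have := (ht k).1
      have h3 : 1 - R ≤ t k / 16 := by nlinarith
      nlinarith)
    have a2 := D.arc R (t k) (t j) hR2 hR1 (ht k).1 htjk (ht j).2
    have a3 := D.osc (t k) (t j) (ht k).1 htjk (ht j).2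
    have a4 := Complex.abs_im_le_norm (Fp F R (t j) - Fp F R (t k))
    rw [Complex.sub_im] at a4
    have b1 := abs_le.1 (hrad j R hRj hR1)
    have b2 := abs_le.1 (hrad k R hRk hR1)
    have b3 := abs_le.1 a4
    have hVjk : U (t k) ≤ U (t j) := hVa hjk.le
    have hV1 : U (t j) ≤ E * (κ * (Hh U (t j) - Hh U (t k))) := by
      refine (hVE j (j + 1) (by omega) (by omega)).trans ?_
      gcongr
      refine (hX j).trans ?_
      gcongr
      have := (H.Hh_le (ht k).1 (hta (show j + 1 ≤ k by omega)) (by linarith [(ht (j + 1)).2])).2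
      have h5 := hh1 (j + 1)
      have h6 := hta (show j + 1 ≤ k by omega)
      nlinarith
    set Δ := Hh U (t j) - Hh U (t k) with hΔ
    have c1 : K * (η * U (t j)) / κ ≤ Δ / (4 * K) := by
      rw [div_le_div_iff₀ hκ0 (by positivity)]
      have h1 : 0 ≤ Δ * κ := by
        have h2 : 0 < E * (κ * Δ) := lt_of_lt_of_le (hV0 j) hV1
        rw [mul_comm]
        exact (pos_of_mul_pos_right h2 hE0.le).le
      calc K * (η * U (t j)) * (4 * K) = (η * (4 * K ^ 2)) * U (t j) := by ring
        _ ≤ (η * (4 * K ^ 2)) * (E * (κ * Δ)) := by gcongr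
        _ = (η * (4 * K ^ 2 * E)) * (Δ * κ) := by ring
        _ ≤ 1 * (Δ * κ) := by gcongr
        _ = _ := by ring
    have c2 : K * (η * U (t k)) / κ ≤ K * (η * U (t j)) / κ := by gcongr
    have e1 : -Hh U (t k) - -Hh U (t j) = Δ := by rw [hΔ]; ring
    rw [e1]
    have e2 : Δ / (2 * K) = Δ / K - 2 * (Δ / (4 * K)) := by field_simp; ring
    have e3 : Δ / K ≤ (Fp F R (t k)).im - (Fp F R (t j)).im := by
      rw [div_le_iff₀ K0]; linarith
    constructor
    · rw [e2]; linarith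
    · have e4 : Δ / (4 * K) ≤ 1 / 8 := by
        rw [div_le_iff₀ (by positivity)]
        nlinarith
      linarith
  · intro j hj
    have h1 := hεh j
    have h2 := H.h_anti hs (hts j hj)
    have h3 := hε0 j
    dsimp only
    rw [← h1]
    have : hU U (t j) * ε j ≤ hU U s * ε j := by gcongr
    nlinarith

end est

lemma norm_expu (u x : ℝ) : ‖Complex.exp (-(u : ℂ) + x * I)‖ = Real.exp (-u) := by
  rw [Complex.norm_exp]; simp

lemma wt_bound {u : ℝ} : 1 - (Real.exp (-u)) ^ 2 ≤ 2 * u := by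
  rw [← Real.exp_nat_mul]
  have := Real.add_one_le_exp (((2 : ℕ) : ℝ) * -u)
  push_cast at this ⊢
  linarith

lemma sum_erase_fin {n : ℕ} (k : Fin n) (f : ℕ → ℝ) :
    ∑ i ∈ Finset.univ.erase k, f (i : ℕ) = ∑ j ∈ (Finset.range n).erase (k : ℕ), f j := by
  rw [Finset.sum_erase_eq_sub (Finset.mem_univ k), Finset.sum_erase_eq_sub (Finset.mem_range.2 k.2),
    Fin.sum_univ_eq_sum_range]

/-- Reweighting. -/
lemma reweight {ι : Type} [Fintype ι] (w : ι → ℂ) (a b : ι → ℝ) (ha : ∀ i, 0 < a i) (hb : ∀ i, 0 ≤ b i) (c : ι → ℂ) :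
    ∑ i, (c i * (√(b i) : ℝ)) • kerZ (w i) =
      ∑ i, ((c i * (√(b i / a i) : ℝ)) * (√(a i) : ℝ)) • kerZ (w i) := by
  apply Finset.sum_congr rfl
  intro i _
  congr 1
  rw [mul_assoc, ← Complex.ofReal_mul, ← Real.sqrt_mul (div_nonneg (hb i) (ha i).le), div_mul_cancel₀ _ (ha i).ne']

lemma norm_reweight (c : ℂ) {m : ℝ} (hm : 0 ≤ m) : ‖c * (√m : ℝ)‖ ^ 2 = m * ‖c‖ ^ 2 := by
  rw [norm_mul, Complex.norm_real, mul_pow, Real.norm_of_nonneg (Real.sqrt_nonneg _), Real.sq_sqrt hm, mul_comm]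

section est
variable {U U' U'' : ℝ → ℝ} {C₀ : ℝ} {F : ℂ → ℂ} {δ K c : ℝ}

/-- The Blaschke product of the points `w_j` is bounded below. -/
lemma blaschke_low (hK : 1 ≤ K) {E : ℝ} (hE : 1 ≤ E) {n κ : ℕ} (hκ : 1 ≤ κ) (u x V X : ℕ → ℝ)
    (hV : ∀ j, 0 < V j) (hVa : Antitone V) (hVE : ∀ j k, j ≤ k → k ≤ j + κ → V j ≤ E * V k)
    (hX : ∀ j, V (j + 1) ≤ κ * (X (j + 1) - X j))
    (hu : ∀ j, V j ≤ K * u j ∧ u j ≤ 2 * K * V j ∧ u j ≤ K)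
    (hx : ∀ j k, j < k → (X k - X j) / (2 * K) ≤ x j - x k ∧ x j - x k ≤ 1) (k : Fin n) :
    Real.exp (-(1 / 2) * ((4 * (160 * K ^ 4 * Real.exp (2 * K)) * E + 16) * κ)) ≤
      ∏ i ∈ Finset.univ.erase k, ‖bl (Complex.exp (-(u (i : ℕ) : ℂ) + x (i : ℕ) * I))
        (Complex.exp (-(u (k : ℕ) : ℂ) + x (k : ℕ) * I))‖ := by
  have K0 : 0 < K := by linarith
  have hκ0 : (0 : ℝ) < κ := by exact_mod_cast hκ
  set A : ℝ := 160 * K ^ 4 * Real.exp (2 * K) with hA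
  have hA0 : 0 ≤ A := by positivity
  have hu0 : ∀ j, 0 < u j := fun j => pos_of_mul_pos_right (lt_of_lt_of_le (hV j) (hu j).1) K0.le
  have hw1 : ∀ j, ‖Complex.exp (-(u j : ℂ) + x j * I)‖ < 1 := fun j => by
    rw [norm_expu]; exact Real.exp_lt_one_iff.2 (by linarith [hu0 j])
  have hXs : ∀ j, X j < X (j + 1) := fun j => by
    have h1 := lt_of_lt_of_le (hV (j + 1)) (hX j)
    have := pos_of_mul_pos_right h1 hκ0.le
    linarith
  have hXm : StrictMono X := strictMono_nat_of_lt_succ hXs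
  have key : ∀ j i, j ≠ i → 0 < (X j - X i) ^ 2 ∧ (X j - X i) ^ 2 ≤ 4 * K ^ 2 * (x j - x i) ^ 2 ∧ |x j - x i| ≤ 1 := by
    have base : ∀ j i, j < i → 0 < (X j - X i) ^ 2 ∧ (X j - X i) ^ 2 ≤ 4 * K ^ 2 * (x j - x i) ^ 2 ∧ |x j - x i| ≤ 1 := by
      intro j i hji
      have h0 : 0 < X i - X j := by linarith [hXm hji]
      obtain ⟨h1, h2⟩ := hx j i hji
      rw [div_le_iff₀ (by positivity)] at h1
      have h3 : 0 < x j - x i := by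
        by_contra hh
        push Not at hh
        nlinarith
      refine ⟨by nlinarith, ?_, ?_⟩
      · have : (X i - X j) ^ 2 ≤ ((x j - x i) * (2 * K)) ^ 2 := by gcongr
        nlinarith
      · rw [abs_of_pos h3]; exact h2
    intro j i hji
    rcases lt_or_gt_of_ne hji with h | h
    · exact base j i h
    · obtain ⟨h1, h2, h3⟩ := base i j h
      refine ⟨by nlinarith, by nlinarith, by rwa [abs_sub_comm]⟩
  have hfac : ∀ i : Fin n, i ∈ Finset.univ.erase k →
      Real.exp (-(1 / 2) * Real.log (1 + A * (V i * V k) / (X i - X k) ^ 2)) ≤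
        ‖bl (Complex.exp (-(u (i : ℕ) : ℂ) + x (i : ℕ) * I))
        (Complex.exp (-(u (k : ℕ) : ℂ) + x (k : ℕ) * I))‖ := by
    intro i hi
    have hik : (i : ℕ) ≠ (k : ℕ) := fun h => (Finset.ne_of_mem_erase hi) (Fin.ext h)
    obtain ⟨h1, h2, h3⟩ := key i k hik
    apply bl_low (hw1 i) (hw1 k) (by have := hV i; have := hV k; positivity)
    have h4 := polar_dist (hu i).2.2 (hu k).2.2 h3
    rw [norm_sub_rev] at h4
    have h5 : ∀ j : ℕ, 1 - ‖Complex.exp (-(u j : ℂ) + x j * I)‖ ^ 2 ≤ 4 * K * V j := fun j => by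
      rw [norm_expu]; linarith [@wt_bound (u j), (hu j).2.1]
    have h6 : (1 - ‖Complex.exp (-(u (i : ℕ) : ℂ) + x (i : ℕ) * I)‖ ^ 2) * (1 - ‖Complex.exp (-(u (k : ℕ) : ℂ) + x (k : ℕ) * I)‖ ^ 2)
        ≤ (4 * K * V i) * (4 * K * V k) :=
      mul_le_mul (h5 i) (h5 k) (one_sub_sq_pos (hw1 k)).le (by have := hV i; positivity)
    refine h6.trans ?_
    have h7 : A * (V i * V k) / (X i - X k) ^ 2 * (2 / 5 * Real.exp (-(2 * K)) * (x i - x k) ^ 2) ≤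
        A * (V i * V k) / (X i - X k) ^ 2 * ‖Complex.exp (-(u (k : ℕ) : ℂ) + x (k : ℕ) * I) - Complex.exp (-(u (i : ℕ) : ℂ) + x (i : ℕ) * I)‖ ^ 2 := by
      have := hV i; have := hV k
      gcongr
    refine le_trans ?_ h7
    rw [div_mul_eq_mul_div, le_div_iff₀ h1]
    have h8 : Real.exp (2 * K) * Real.exp (-(2 * K)) = 1 := by rw [← Real.exp_add]; simp
    have e : A * (V i * V k) * (2 / 5 * Real.exp (-(2 * K)) * (x i - x k) ^ 2) =
        (4 * K * V i) * (4 * K * V k) * (4 * K ^ 2 * (x i - x k) ^ 2) := by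
      rw [hA]
      linear_combination (64 * K ^ 4 * (V i * V k) * (x i - x k) ^ 2) * h8
    rw [e]
    have := hV i; have := hV k
    gcongr
  refine le_trans ?_ (Finset.prod_le_prod (fun i _ => (Real.exp_pos _).le) hfac)
  rw [← Real.exp_sum, ← Finset.mul_sum]
  apply Real.exp_le_exp.2
  have h1 := prod_est hA0 hE hκ V X hV hVa hVE hX k.val k.2
  rw [sum_erase_fin k (fun j => Real.log (1 + A * (V j * V k) / (X j - X k) ^ 2))]
  linarith

lemma FD.lower_main (H : UD U U' U'' C₀) (D : FD U F δ K c) (φ : ℂ → ℂ) (hφ : ∀ z, φ z = Complex.exp (-F z))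
    (T : H2 →L[ℂ] H2) (hT : ∀ (a : H2) (z : ℂ), ‖z‖ < 1 → fa (T a) z = fa a (φ z)) :
    ∃ c1 C1 : ℝ, 0 < c1 ∧ 0 < C1 ∧ ∀ (n κ : ℕ) (s : ℝ), 1 ≤ n → 1 ≤ κ → 0 < s → s ≤ δ →
      (n : ℝ) ≤ κ * (Gg U s - Gg U δ) → c1 * (√(hU U s))⁻¹ * Real.exp (-(C1 * κ)) ≤ approxNum T n := by
  have K1 := D.K1
  have K0 : 0 < K := by linarith
  have hE1 : 1 ≤ Real.exp C₀ := Real.one_le_exp H.C0.le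
  obtain ⟨η, hη0, hη1, hpts⟩ := D.lower_pts H
  obtain ⟨Ca, hCa, hcara⟩ := carleson 1 1 zero_le_one zero_le_one
  obtain ⟨Cb, hCb, hcarb⟩ := carleson K K K0.le K0.le
  set E := Real.exp C₀ with hEdef
  set Q : ℝ := (1 / 2) * (4 * (160 * K ^ 4 * Real.exp (2 * K)) * E + 16) with hQ
  refine ⟨√η / (√(4 * K) * (√(Cb * (8 * K ^ 2 * E)) * √Ca)), Q + 1, by positivity, by positivity, ?_⟩
  intro n κ s hn hκ hs hsδ hnκ
  obtain ⟨ε, t, u, x, V, X, hε, ht, htε, hFz, hV, hVa, hVE, hX, hu, hx, hηV⟩ := hpts n κ s hκ hs hsδ hnκ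
  have hκ0 : (0 : ℝ) < κ := by exact_mod_cast hκ
  have hh1 : 1 ≤ hU U s := D.h1 _ hs hsδ
  have hh0 : 0 < hU U s := by linarith
  have hu0 : ∀ j, 0 < u j := fun j => pos_of_mul_pos_right (lt_of_lt_of_le (hV j) (hu j).1) K0.le
  set w : ℕ → ℂ := fun j => Complex.exp (-(u j : ℂ) + x j * I) with hw
  set z : ℕ → ℂ := fun j => Complex.exp (-(ε j : ℂ) + t j * I) with hz
  have hw1 : ∀ j, ‖w j‖ < 1 := fun j => by
    simp only [hw]; rw [norm_expu]; exact Real.exp_lt_one_iff.2 (by linarith [hu0 j])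
  have hz1 : ∀ j, ‖z j‖ < 1 := fun j => by
    simp only [hz]; rw [norm_expu]; exact Real.exp_lt_one_iff.2 (by linarith [(hε j).1])
  have hzw : ∀ j, φ (z j) = w j := fun j => by
    rw [hφ, hFz j]; simp only [hw]; congr 1; ring
  have hadj : ∀ j, ContinuousLinearMap.adjoint T (kerZ (z j)) = kerZ (w j) := fun j => by
    have := adjoint_ker T (hz1 j) (hw1 j) (b := 1) (fun a => by rw [hT a _ (hz1 j), hzw j, one_mul])
    simpa using this
  -- upper estimate for the `z` system
  have hA : ∀ c : Fin n → ℂ, ‖∑ i : Fin n, (c i * (√(ε i) : ℝ)) • kerZ (z i)‖ ≤ √Ca * √(∑ i, ‖c i‖ ^ 2) := by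
    intro c
    have h1 := hcara (Fin n) (fun i => ε i) (fun i => t i) (fun i => t i) (fun i => t i + ε i)
      (fun i => (hε i).1) (fun i => (hε i).2) (fun i j => by
        rw [abs_le]; constructor <;> linarith [(ht i).1, (ht i).2, (ht j).1, (ht j).2])
      (fun i => by linarith [(hε i).1]) (fun i => by constructor <;> linarith [(hε i).1])
      (fun i j hij => by
        refine Set.disjoint_left.2 ?_
        rintro y ⟨h1, h2⟩ ⟨h3, h4⟩
        rcases lt_or_gt_of_ne (fun h => hij (Fin.ext h) : (i : ℕ) ≠ j) with h | h
        · linarith [htε _ _ h]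
        · linarith [htε _ _ h]) c
    simp only [add_sub_cancel_left] at h1
    rw [← Real.sqrt_mul hCa.le]
    exact Real.le_sqrt_of_sq_le h1
  -- upper estimate for the `w` system
  have hE0 : 0 < E := by linarith
  set B := √(Cb * (8 * K ^ 2 * E) * κ) with hB
  have hB0 : 0 < B := by positivity
  set ℓ : ℕ → ℝ := fun j => V j / (2 * K * E * κ) with hℓ
  have hℓ0 : ∀ j, 0 < ℓ j := fun j => by have := hV j; simp only [hℓ]; positivity
  have hXmono : Monotone X := monotone_nat_of_le_succ fun j => by
    have h1 := lt_of_lt_of_le (hV (j + 1)) (hX j)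
    have := pos_of_mul_pos_right h1 hκ0.le
    linarith
  have hℓx : ∀ j k, j < k → ℓ j ≤ x j - x k := fun j k hjk => by
    refine le_trans ?_ (hx j k hjk).1
    simp only [hℓ]
    rw [div_le_div_iff₀ (by positivity) (by positivity)]
    have h1 := hVE j (j + 1) (by omega) (by omega)
    have h2 := hX j
    have h3 := hXmono (show j + 1 ≤ k by omega)
    have h4 : V j ≤ E * (κ * (X k - X j)) := by
      refine h1.trans ?_
      gcongr
      refine h2.trans ?_
      gcongr
    calc V j * (2 * K) ≤ E * (κ * (X k - X j)) * (2 * K) := by gcongr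
      _ = _ := by ring
  have hwpos : ∀ j, 0 < 1 - ‖w j‖ ^ 2 := fun j => one_sub_sq_pos (hw1 j)
  have hwV : ∀ j, 1 - ‖w j‖ ^ 2 ≤ 4 * K * V j := fun j => by
    simp only [hw]; rw [norm_expu]; linarith [@wt_bound (u j), (hu j).2.1]
  have hBup : ∀ c : Fin n → ℂ, ‖∑ i : Fin n, (c i * (√(1 - ‖w i‖ ^ 2) : ℝ)) • kerZ (w i)‖ ≤ B * √(∑ i, ‖c i‖ ^ 2) := by
    intro c
    rw [reweight (fun i : Fin n => w i) (fun i => ℓ i) (fun i => 1 - ‖w i‖ ^ 2) (fun i => hℓ0 i) (fun i => (hwpos i).le)]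
    have h1 := hcarb (Fin n) (fun i => u i) (fun i => x i) (fun i => x i - ℓ i) (fun i => x i)
      (fun i => hu0 i) (fun i => (hu i).2.2) (fun i j => by
        rcases lt_trichotomy (i : ℕ) j with h | h | h
        · rw [abs_of_pos (by linarith [hℓx _ _ h, hℓ0 i])]; exact (hx _ _ h).2
        · rw [h]; simp
        · rw [abs_sub_comm, abs_of_pos (by linarith [hℓx _ _ h, hℓ0 j])]; exact (hx _ _ h).2)
      (fun i => by linarith [hℓ0 i]) (fun i => by
        have h3 : ℓ i ≤ V i := by
          simp only [hℓ]
          have hκ1 : (1 : ℝ) ≤ κ := by exact_mod_cast hκ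
          apply div_le_self (hV i).le
          have : (1 : ℝ) ≤ K * E * κ := one_le_mul_of_one_le_of_one_le (one_le_mul_of_one_le_of_one_le K1 hE1) hκ1
          nlinarith
        have h2 := (hu i).1
        constructor <;> nlinarith [hu0 i])
      (fun i j hij => by
        refine Set.disjoint_left.2 ?_
        rintro y ⟨h1, h2⟩ ⟨h3, h4⟩
        rcases lt_or_gt_of_ne (fun h => hij (Fin.ext h) : (i : ℕ) ≠ j) with h | h
        · linarith [hℓx _ _ h]
        · linarith [hℓx _ _ h]) (fun i => c i * (√((1 - ‖w i‖ ^ 2) / ℓ i) : ℝ))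
    simp only [sub_sub_cancel] at h1
    rw [hB, ← Real.sqrt_mul (by positivity)]
    apply Real.le_sqrt_of_sq_le
    refine h1.trans ?_
    rw [mul_assoc Cb, mul_assoc Cb, Finset.mul_sum (a := 8 * K ^ 2 * E * κ)]
    gcongr with i _
    rw [norm_reweight _ (div_nonneg (hwpos i).le (hℓ0 i).le)]
    gcongr
    rw [div_le_iff₀ (hℓ0 i)]
    refine (hwV i).trans (le_of_eq ?_)
    simp only [hℓ]; field_simp; ring
  have hriesz := riesz_lower (fun i : Fin n => w i) (fun i => hw1 i) B (Real.exp (-(Q * κ))) hB0.le (Real.exp_pos _) hBup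
    (fun k => by
      have := blaschke_low K1 hE1 hκ u x V X hV hVa hVE hX hu hx k
      refine le_trans (le_of_eq ?_) this
      rw [hQ]; congr 1; ring)
  set m : ℝ := η / (4 * K * κ * hU U s) with hm
  have hm0 : 0 < m := by positivity
  have hlow := le_approxNum T n hn (fun i => ((√(ε i) : ℝ) : ℂ) • kerZ (z i)) (Real.exp (-(Q * κ)) * √m / B) (by positivity)
    (√Ca) (by positivity) (fun c => by simpa only [smul_smul] using hA c) (fun c => by
      simp only [map_smulₛₗ, hadj, Complex.conj_ofReal, smul_smul, starRingEnd_apply, RingHom.id_apply, map_smul]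
      rw [reweight (fun i : Fin n => w i) (fun i => 1 - ‖w i‖ ^ 2) (fun i => ε i) (fun i => hwpos i) (fun i => (hε i).1.le)]
      have h1 := hriesz (fun i => c i * (√(ε i / (1 - ‖w i‖ ^ 2)) : ℝ))
      rw [div_mul_eq_mul_div, div_le_iff₀ hB0, mul_comm _ B]
      refine le_trans ?_ h1
      rw [mul_assoc, ← Real.sqrt_mul hm0.le]
      gcongr
      rw [Finset.mul_sum]
      gcongr with i _
      rw [norm_reweight _ (div_nonneg (hε i).1.le (hwpos i).le)]
      gcongr
      rw [hm, div_le_div_iff₀ (by positivity) (hwpos i)]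
      have h2 := hηV i i.2
      calc η * (1 - ‖w i‖ ^ 2) ≤ η * (4 * K * V i) := by gcongr; exact hwV i
        _ = 4 * K * (η * V i) := by ring
        _ ≤ 4 * K * (κ * hU U s * ε i) := by gcongr
        _ = _ := by ring)
  refine le_trans ?_ hlow
  have hκe : (κ : ℝ) ≤ Real.exp κ := by linarith [Real.add_one_le_exp (κ : ℝ)]
  have e1 : √m = √η / (√(4 * K) * √κ * √(hU U s)) := by
    rw [hm, Real.sqrt_div hη0.le, Real.sqrt_mul (by positivity), Real.sqrt_mul (by positivity)]
  have e2 : B = √(Cb * (8 * K ^ 2 * E)) * √κ := by rw [hB, Real.sqrt_mul (by positivity)]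
  have e3 : √(κ : ℝ) * √(κ : ℝ) = κ := Real.mul_self_sqrt hκ0.le
  have e4 : Real.exp (-(Q * κ)) * √m / B / √Ca =
      √η / (√(4 * K) * (√(Cb * (8 * K ^ 2 * E)) * √Ca)) * (√(hU U s))⁻¹ * (Real.exp (-(Q * κ)) * (κ : ℝ)⁻¹) := by
    rw [e1, e2]
    have hsk : 0 < √(κ : ℝ) := by positivity
    have hkk : (κ : ℝ)⁻¹ = (√(κ : ℝ))⁻¹ * (√(κ : ℝ))⁻¹ := by rw [← mul_inv, e3]
    rw [hkk]
    field_simp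
  rw [e4]
  gcongr
  rw [show -((Q + 1) * (κ : ℝ)) = -(Q * κ) + -κ by ring, Real.exp_add, Real.exp_neg (κ : ℝ)]
  gcongr

end est

section est
variable {U U' U'' : ℝ → ℝ} {C₀ : ℝ} {F : ℂ → ℂ} {δ K c : ℝ}

lemma FD.good (H : UD U U' U'' C₀) (D : FD U F δ K c) : ∃ s0 : ℝ, 0 < s0 ∧ s0 ≤ δ ∧ ∀ s, 0 < s → s ≤ s0 →
    1 ≤ Gg U s ∧ Gg U s / 2 ≤ Gg U s - Gg U δ ∧ 1 ≤ Real.log (hU U s) ∧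
    Real.log (hU U s) / 2 ≤ Real.log (hU U s) - Real.log (hU U 1) ∧
    Real.log (hU U s) - Real.log (hU U 1) ≤ 2 * Real.log (hU U s) := by
  obtain ⟨d, hd, hd2⟩ := ev_pos (H.htop.eventually (eventually_ge_atTop (Real.exp (1 + 2 * |Real.log (hU U 1)|))))
  have d0 := D.d0
  refine ⟨min d (min δ (δ * Real.exp (-(|Gg U δ| + 1 - Gg U δ) - 2 * |Gg U δ|))), by positivity, ?_, ?_⟩
  · exact (min_le_right _ _).trans (min_le_left _ _)
  intro s hs hs0
  have hsd : s ≤ d := hs0.trans (min_le_left _ _)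
  have hsδ : s ≤ δ := hs0.trans ((min_le_right _ _).trans (min_le_left _ _))
  have hse : s ≤ δ * Real.exp (-(|Gg U δ| + 1 - Gg U δ) - 2 * |Gg U δ|) := hs0.trans ((min_le_right _ _).trans (min_le_right _ _))
  have h1 := (D.g123 H hs hsδ le_rfl).2.2.1
  have h2 : Real.log s ≤ Real.log δ + (-(|Gg U δ| + 1 - Gg U δ) - 2 * |Gg U δ|) := by
    have := Real.log_le_log hs hse
    rwa [Real.log_mul d0.ne' (Real.exp_pos _).ne', Real.log_exp] at this
  have h3 := hd2 s hs hsd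
  have h4 : 1 + 2 * |Real.log (hU U 1)| ≤ Real.log (hU U s) := by
    rw [Real.le_log_iff_exp_le (lt_of_lt_of_le (Real.exp_pos _) h3)]
    exact h3
  have a1 := abs_nonneg (Gg U δ)
  have a2 := le_abs_self (Gg U δ)
  have a3 := neg_abs_le (Gg U δ)
  have b1 := abs_nonneg (Real.log (hU U 1))
  have b2 := le_abs_self (Real.log (hU U 1))
  have b3 := neg_abs_le (Real.log (hU U 1))
  refine ⟨by linarith, by linarith, by linarith, by linarith, by linarith⟩

lemma FD.lower_final (H : UD U U' U'' C₀) (D : FD U F δ K c) (φ : ℂ → ℂ) (hφ : ∀ z, φ z = Complex.exp (-F z))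
    (T : H2 →L[ℂ] H2) (hT : ∀ (a : H2) (z : ℂ), ‖z‖ < 1 → fa (T a) z = fa a (φ z)) :
    ∃ c c₁ : ℝ, 0 < c ∧ 0 < c₁ ∧ ∃ N : ℕ, ∀ n : ℕ, N ≤ n →
      c₁ * (hU U (Real.exp (-Real.sqrt n))) ^
          (-(1 / 2 + c * n / gammaU U (Real.exp (-Real.sqrt n)))) ≤ approxNum T n := by
  obtain ⟨c1, C1, hc1, hC1, hmain⟩ := D.lower_main H φ hφ T hT
  obtain ⟨s0, hs0, hs0δ, hgood⟩ := D.good H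
  refine ⟨4 * C1, c1 * Real.exp (-(2 * C1)), by positivity, by positivity, ?_⟩
  have hlim : Tendsto (fun n : ℕ => Real.exp (-Real.sqrt n)) atTop (nhds 0) := by
    apply Real.tendsto_exp_neg_atTop_nhds_zero.comp
    exact Real.tendsto_sqrt_atTop.comp tendsto_natCast_atTop_atTop
  obtain ⟨N, hN⟩ := eventually_atTop.1 (hlim.eventually_le_const hs0)
  refine ⟨max N 1, fun n hn => ?_⟩
  have hn1 : 1 ≤ n := (le_max_right _ _).trans hn
  have hsn := hN n ((le_max_left _ _).trans hn)
  set s := Real.exp (-Real.sqrt n) with hs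
  have hs00 : 0 < s := Real.exp_pos _
  obtain ⟨g1, g2, g3, g4, g5⟩ := hgood s hs00 hsn
  set h := hU U s with hh
  set L := Real.log h - Real.log (hU U 1) with hL
  set κ : ℕ := ⌈(n : ℝ) / (Gg U s - Gg U δ)⌉₊ + 1 with hκ
  have hG : 0 < Gg U s - Gg U δ := by linarith
  have hk1 : (n : ℝ) ≤ κ * (Gg U s - Gg U δ) := by
    rw [← div_le_iff₀ hG, hκ]
    push_cast
    linarith [Nat.le_ceil ((n : ℝ) / (Gg U s - Gg U δ))]
  have hk2 : (κ : ℝ) ≤ n / (Gg U s - Gg U δ) + 2 := by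
    have := (Nat.ceil_lt_add_one (show 0 ≤ (n : ℝ) / (Gg U s - Gg U δ) by positivity)).le
    rw [hκ]; push_cast; linarith
  have hmm := hmain n κ s hn1 (by omega) hs00 (hsn.trans hs0δ) hk1
  refine le_trans ?_ hmm
  have hγ : gammaU U s = Gg U s * L := rfl
  have hh1 : 0 < h := by
    have := D.h1 s hs00 (hsn.trans hs0δ)
    linarith
  have hG0 : 0 < Gg U s := by linarith
  have hL0 : 0 < L := by linarith
  have hk3 : (κ : ℝ) ≤ 4 * (n / gammaU U s) * Real.log h + 2 := by
    have e1 : (n : ℝ) / (Gg U s - Gg U δ) ≤ n / (Gg U s / 2) := by gcongr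
    have e2 : (n : ℝ) / (Gg U s / 2) = 2 * (n / gammaU U s) * L := by
      rw [hγ]; field_simp
    have e3 : 2 * (n / gammaU U s) * L ≤ 2 * (n / gammaU U s) * (2 * Real.log h) := by
      have : 0 ≤ (n : ℝ) / gammaU U s := by rw [hγ]; positivity
      gcongr
    linarith
  have e5 : h ^ (-(1 / 2 + 4 * C1 * n / gammaU U s)) = (√h)⁻¹ * Real.exp (-(4 * C1 * (n / gammaU U s) * Real.log h)) := by
    rw [neg_add, Real.rpow_add hh1, Real.sqrt_eq_rpow, ← Real.rpow_neg hh1.le]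
    congr 1
    rw [Real.rpow_def_of_pos hh1]
    congr 1
    ring
  rw [e5]
  calc c1 * Real.exp (-(2 * C1)) * ((√h)⁻¹ * Real.exp (-(4 * C1 * (n / gammaU U s) * Real.log h)))
      = c1 * (√h)⁻¹ * Real.exp (-(2 * C1) + -(4 * C1 * (n / gammaU U s) * Real.log h)) := by
        rw [Real.exp_add]; ring
    _ ≤ _ := by
        gcongr
        nlinarith

end est

lemma circle_cont (g : H2) {r : ℝ} (hr : 0 ≤ r) (hr1 : r < 1) :
    Continuous (fun θ : ℝ => fa g (r * Complex.exp (θ * I))) := by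
  have hg : ∀ k, ‖g k‖ ≤ ‖g‖ := fun k => lp.norm_apply_le_norm (by norm_num) g k
  have e : (fun θ : ℝ => fa g (r * Complex.exp (θ * I))) =
      fun θ : ℝ => ∑' k : ℕ, (g k * r ^ k) * Complex.exp (k * θ * I) := by
    funext θ
    exact (fa_circle g hr hr1 θ).tsum_eq.symm
  rw [e]
  refine continuous_tsum (fun k => by fun_prop) ((summable_geometric_of_lt_one hr hr1).mul_left ‖g‖) ?_
  intro k θ
  rw [norm_mul, norm_mul, norm_pow, show (k : ℂ) * θ * I = ((k * θ : ℝ) : ℂ) * I by push_cast; ring,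
      Complex.norm_exp_ofReal_mul_I, Complex.norm_of_nonneg hr, mul_one]
  gcongr
  exact hg k

lemma mean_le (g : H2) {r : ℝ} (hr : 0 ≤ r) (hr1 : r < 1) :
    ∫ θ in (-Real.pi)..Real.pi, ‖fa g (r * Complex.exp (θ * I))‖ ^ 2 ≤ 2 * Real.pi * ‖g‖ ^ 2 := by
  have hg : ∀ k, ‖g k‖ ≤ ‖g‖ := fun k => lp.norm_apply_le_norm (by norm_num) g k
  have hsum : Summable (fun k : ℕ => ‖g‖ * r ^ k) :=
    (summable_geometric_of_lt_one hr hr1).mul_left _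
  set B := ∑' k : ℕ, ‖g‖ * r ^ k with hB
  have hbound : ∀ M (θ : ℝ), ‖∑ k ∈ Finset.range M, (g k * (r:ℂ) ^ k) * Complex.exp (k * θ * I)‖ ≤ B := by
    intro M θ
    refine (norm_sum_le _ _).trans ?_
    refine le_trans (Finset.sum_le_sum (g := fun k => ‖g‖ * r ^ k) fun k _ => ?_)
      (hsum.sum_le_tsum _ (fun k _ => by positivity))
    rw [norm_mul, norm_mul, norm_pow, show (k : ℂ) * θ * I = ((k * θ : ℝ) : ℂ) * I by push_cast; ring,
      Complex.norm_exp_ofReal_mul_I, Complex.norm_of_nonneg hr, mul_one]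
    gcongr
    exact hg k
  have hlim : Tendsto (fun M => ∫ θ in (-Real.pi)..Real.pi,
      ‖∑ k ∈ Finset.range M, (g k * (r:ℂ) ^ k) * Complex.exp (k * θ * I)‖ ^ 2) atTop
      (nhds (∫ θ in (-Real.pi)..Real.pi, ‖fa g (r * Complex.exp (θ * I))‖ ^ 2)) := by
    refine intervalIntegral.tendsto_integral_filter_of_dominated_convergence (fun _ => B ^ 2) ?_ ?_ ?_ ?_
    · refine Eventually.of_forall fun M => ?_
      apply Continuous.aestronglyMeasurable; fun_prop
    · refine Eventually.of_forall fun M => Eventually.of_forall fun θ _ => ?_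
      rw [Real.norm_of_nonneg (by positivity)]
      gcongr
      exact hbound M θ
    · simp
    · refine Eventually.of_forall fun θ _ => ?_
      exact ((fa_circle g hr hr1 θ).tendsto_sum_nat.norm).pow 2
  refine le_of_tendsto hlim (Eventually.of_forall fun M => ?_)
  rw [integral_trig_poly]
  gcongr
  refine le_trans (Finset.sum_le_sum (g := fun k => ‖g k‖ ^ 2) fun k _ => ?_)
    (sum_le_hasSum (Finset.range M) (fun k _ => by positivity) (norm_sq_eq g))
  gcongr
  rw [norm_mul, norm_pow, Complex.norm_of_nonneg hr]
  exact mul_le_of_le_one_right (norm_nonneg _) (pow_le_one₀ hr hr1.le)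

lemma approxNum_le_blaschke_bdd (T : H2 →L[ℂ] H2) (n : ℕ) (l : List ℂ) (hl : ∀ a ∈ l, ‖a‖ < 1)
    (hn : l.length ≤ n - 1) (K : ℝ) (hK : 0 ≤ K)
    (h : ∀ y x : H2, (∃ B, ∀ z, ‖z‖ < 1 → ‖fa x z‖ ≤ B) →
      (∀ z, ‖z‖ < 1 → fa y z = (l.map (fun a => bl a z)).prod * fa x z) →
      ‖T y‖ ≤ K * ‖x‖) :
    approxNum T n ≤ K := by
  obtain ⟨V, W, h1, h2, h3, X, hX, hXf, hXm⟩ := exists_V_list l hl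
  refine (approxNum_le_of_rank T (T * (1 - V * W)) n
    ⟨X.map T.toLinearMap, inferInstance, ?_, fun x => Submodule.mem_map_of_mem (hXm x)⟩).trans ?_
  · exact ((Submodule.finrank_map_le _ _).trans hXf).trans hn
  · refine ContinuousLinearMap.opNorm_le_bound _ hK fun x => ?_
    have : (T - T * (1 - V * W)) x = (T * V) (W x) := by simp
    rw [this]
    refine (bound_of_bounded (T * V) K (fun x' hx' => ?_) (W x)).trans ?_
    · exact h _ _ hx' (h3 x')
    gcongr
    exact h2 x

lemma mid_abs (M : ℝ) (hM : 0 ≤ M) : ∃ C : ℝ, 0 < C ∧ ∀ (x : H2) (u α f : ℝ → ℝ) (a b u0 k Q : ℝ), a ≤ b → 0 < u0 → 0 < k →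
    0 ≤ Q → (∀ θ ∈ Icc a b, u0 ≤ u θ ∧ u θ ≤ M) →
    (∀ θ1 θ2, a ≤ θ1 → θ1 ≤ θ2 → θ2 ≤ b → k * (θ2 - θ1) ≤ |α θ2 - α θ1| ∧ |α θ2 - α θ1| ≤ Q * (θ2 - θ1) ∧
      |α θ2 - α θ1| ≤ 1) → (MonotoneOn α (Icc a b) ∨ AntitoneOn α (Icc a b)) → Continuous f →
    (∀ θ ∈ Icc a b, f θ = ‖fa x (Complex.exp (-(u θ : ℂ) + α θ * I))‖ ^ 2) →
    ∫ θ in a..b, f θ ≤ C / k * ‖x‖ ^ 2 := by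
  obtain ⟨C, hC, hcar⟩ := carleson 1 M zero_le_one hM
  refine ⟨C, hC, ?_⟩
  intro x u α f a b u0 k Q hab hu0 hk hQ hu hα hmono hf hfe
  set N : ℕ := ⌈Q * (b - a) / u0⌉₊ + 1 with hN
  have hN0 : (0 : ℝ) < N := by rw [hN]; positivity
  set d : ℝ := (b - a) / N with hd
  have hd0 : 0 ≤ d := div_nonneg (by linarith) hN0.le
  have hQd : Q * d ≤ u0 := by
    rw [hd, ← mul_div_assoc, div_le_iff₀ hN0, mul_comm u0, ← div_le_iff₀ hu0, hN]
    push_cast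
    linarith [Nat.le_ceil (Q * (b - a) / u0)]
  set P : ℕ → ℝ := fun i => a + i * d with hP
  have hPs : ∀ i, P (i + 1) = P i + d := fun i => by simp only [hP]; push_cast; ring
  have hPm : Monotone P := monotone_nat_of_le_succ fun i => by rw [hPs]; linarith
  have hP0 : P 0 = a := by simp [hP]
  have hPN : P N = b := by simp only [hP, hd]; field_simp; ring
  have hmem : ∀ i, i ≤ N → P i ∈ Icc a b := fun i hi =>
    ⟨hP0 ▸ hPm (Nat.zero_le i), hPN ▸ hPm hi⟩
  have hex : ∀ i, ∃ t ∈ Icc (P i) (P (i + 1)), ∀ y ∈ Icc (P i) (P (i + 1)), f y ≤ f t := fun i => by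
    obtain ⟨t, ht, ht2⟩ := isCompact_Icc.exists_isMaxOn (nonempty_Icc.2 (hPm (Nat.le_succ i))) hf.continuousOn
    exact ⟨t, ht, fun y hy => ht2 hy⟩
  choose t ht htm using hex
  have htab : ∀ i, i < N → t i ∈ Icc a b := fun i hi =>
    ⟨(hmem i hi.le).1.trans (ht i).1, (ht i).2.trans (hmem (i + 1) hi).2⟩
  have habs : ∀ i j, i < N → j < N → |α (t i) - α (t j)| ≤ 1 := by
    intro i j hi hj
    rcases le_total (t i) (t j) with h | h
    · rw [abs_sub_comm]; exact (hα _ _ (htab i hi).1 h (htab j hj).2).2.2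
    · exact (hα _ _ (htab j hj).1 h (htab i hi).2).2.2
  have hcar1 := fun c => hcar (Fin N) (fun i => u (t i)) (fun i => α (t i))
    (fun i => min (α (P i)) (α (P (i + 1)))) (fun i => max (α (P i)) (α (P (i + 1))))
    (fun i => lt_of_lt_of_le hu0 (hu _ (htab i i.2)).1) (fun i => (hu _ (htab i i.2)).2)
    (fun i j => habs i j i.2 j.2) (fun i => min_le_max) (fun i => by
      have h1 := (hu _ (htab i i.2)).1
      have h2 := (hα _ _ (hmem i i.2.le).1 (ht i).1 (htab i i.2).2).2.1
      have h3 := (hα _ _ (htab i i.2).1 (ht i).2 (hmem (i + 1) i.2).2).2.1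
      have h4 := (ht i).1
      have h5 := (ht i).2
      rw [hPs] at h5 h3
      have h6 : Q * (t i - P i) ≤ Q * d := by gcongr; linarith
      have h7 : Q * (P i + d - t i) ≤ Q * d := by gcongr; linarith
      have h8 := abs_le.1 h2
      have h9 := abs_le.1 h3
      rw [hPs]
      constructor
      · apply le_min <;> linarith
      · apply max_le <;> linarith) (fun i j hij => by
      have base : ∀ i j : ℕ, i < j → j < N → Disjoint (Ioc (min (α (P i)) (α (P (i + 1)))) (max (α (P i)) (α (P (i + 1)))))
          (Ioc (min (α (P j)) (α (P (j + 1)))) (max (α (P j)) (α (P (j + 1))))) := by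
        intro i j hij hj
        have m1 := hmem i (by omega)
        have m2 := hmem (i + 1) (by omega)
        have m3 := hmem j (by omega)
        have m4 := hmem (j + 1) (by omega)
        have o1 := hPm (Nat.le_succ i)
        have o2 := hPm (show i + 1 ≤ j by omega)
        have o3 := hPm (Nat.le_succ j)
        refine Set.disjoint_left.2 ?_
        rintro y ⟨h1, h2⟩ ⟨h3, h4⟩
        rcases hmono with hm | hm
        · have a1 := hm m1 m2 o1
          have a2 := hm m2 m3 o2
          have a3 := hm m3 m4 o3
          rw [max_eq_right a1] at h2
          rw [min_eq_left a3] at h3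
          linarith
        · have a1 := hm m1 m2 o1
          have a2 := hm m2 m3 o2
          have a3 := hm m3 m4 o3
          rw [min_eq_right a1] at h1
          rw [max_eq_left a3] at h4
          linarith
      rcases lt_or_gt_of_ne (fun h => hij (Fin.ext h) : (i : ℕ) ≠ j) with h | h
      · exact base i j h j.2
      · exact (base j i h i.2).symm) c
  have hdual := carleson_dual C hC.le (fun i : Fin N => Complex.exp (-(u (t i) : ℂ) + α (t i) * I))
    (fun i => by
      rw [norm_expu]
      exact Real.exp_lt_one_iff.2 (by linarith [(hu _ (htab i i.2)).1])) _ (fun i => sub_nonneg.2 min_le_max) hcar1 x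
  have hsplit : ∫ θ in a..b, f θ = ∑ i ∈ Finset.range N, ∫ θ in P i..P (i + 1), f θ := by
    rw [intervalIntegral.sum_integral_adjacent_intervals (fun i _ => hf.intervalIntegrable _ _), hP0, hPN]
  rw [hsplit, ← Fin.sum_univ_eq_sum_range (fun i => ∫ θ in P i..P (i + 1), f θ)]
  have hpiece : ∀ i : Fin N, ∫ θ in P i..P (i + 1), f θ ≤
      k⁻¹ * ((max (α (P i)) (α (P (i + 1))) - min (α (P i)) (α (P (i + 1)))) *
        ‖fa x (Complex.exp (-(u (t i) : ℂ) + α (t i) * I))‖ ^ 2) := by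
    intro i
    have h1 : ∫ θ in P i..P (i + 1), f θ ≤ ∫ θ in P i..P (i + 1), f (t i) := by
      apply intervalIntegral.integral_mono_on (hPm (Nat.le_succ _)) (hf.intervalIntegrable _ _) (by simp)
      intro y hy
      exact htm i y hy
    refine h1.trans ?_
    rw [intervalIntegral.integral_const, smul_eq_mul, hfe _ (htab i i.2), ← mul_assoc]
    gcongr
    rw [max_sub_min_eq_abs', inv_mul_eq_div, le_div_iff₀ hk, abs_sub_comm]
    have := (hα _ _ (hmem i i.2.le).1 (hPm (Nat.le_succ i)) (hmem (i + 1) i.2).2).1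
    simp only [Nat.succ_eq_add_one] at this
    linarith
  refine (Finset.sum_le_sum fun i _ => hpiece i).trans ?_
  rw [← Finset.mul_sum]
  have : k⁻¹ * (C * ‖x‖ ^ 2) = C / k * ‖x‖ ^ 2 := by field_simp
  rw [← this]
  gcongr

lemma exp_lip {a b : ℂ} (ha : 0 ≤ a.re) (hb : 0 ≤ b.re) : ‖Complex.exp (-a) - Complex.exp (-b)‖ ≤ ‖a - b‖ := by
  have h := (convex_halfSpace_re_ge 0).norm_image_sub_le_of_norm_hasDerivWithin_le
    (f := fun z => Complex.exp (-z)) (f' := fun z => Complex.exp (-z) * (-1)) (C := 1) (x := b) (y := a)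
    (fun z _ => ((hasDerivAt_id z).neg.cexp).hasDerivWithinAt)
    (fun z hz => by
      rw [norm_mul, Complex.norm_exp]
      simp only [mem_ofPred_eq] at hz
      simpa using hz) hb ha
  simpa using h

lemma bl_up {w z : ℂ} (hw : ‖w‖ < 1) (hz : ‖z‖ < 1) {q : ℝ} (hq : 0 ≤ q)
    (h : ‖z - w‖ ^ 2 ≤ q * ((1 - ‖w‖ ^ 2) * (1 - ‖z‖ ^ 2))) :
    ‖bl w z‖ ≤ √(q / (1 + q)) := by
  have h1 := one_sub_sq_pos hw
  have h2 := one_sub_sq_pos hz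
  have h3 : 0 < (1 - ‖w‖ ^ 2) * (1 - ‖z‖ ^ 2) := mul_pos h1 h2
  apply Real.le_sqrt_of_sq_le
  rw [bl_norm_sq hw hz, div_le_div_iff₀ (by positivity) (by positivity)]
  nlinarith

lemma bl_le_one {w z : ℂ} (hw : ‖w‖ < 1) (hz : ‖z‖ < 1) : ‖bl w z‖ ≤ 1 := by
  have h1 := one_sub_sq_pos hw
  have h2 := one_sub_sq_pos hz
  have h3 : 0 < (1 - ‖w‖ ^ 2) * (1 - ‖z‖ ^ 2) := mul_pos h1 h2
  have : ‖bl w z‖ ^ 2 ≤ 1 := by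
    rw [bl_norm_sq hw hz, div_le_one (by positivity)]
    linarith
  nlinarith [norm_nonneg (bl w z)]

lemma bl_conj (w z : ℂ) : ‖bl ((starRingEnd ℂ) w) ((starRingEnd ℂ) z)‖ = ‖bl w z‖ := by
  have : bl ((starRingEnd ℂ) w) ((starRingEnd ℂ) z) = (starRingEnd ℂ) (bl w z) := by
    unfold bl; simp
  rw [this, RCLike.norm_conj]

lemma wt_low {u M : ℝ} (hu : u ≤ M) (h0 : 0 ≤ u) : 2 * u * Real.exp (-(2 * M)) ≤ 1 - (Real.exp (-u)) ^ 2 := by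
  rw [← Real.exp_nat_mul]
  have e : ((2 : ℕ) : ℝ) * -u = -(2 * u) := by push_cast; ring
  rw [e]
  have h1 := Real.add_one_le_exp (2 * u)
  have h2 : Real.exp (2 * u) * Real.exp (-(2 * u)) = 1 := by rw [← Real.exp_add]; simp
  have h3 : Real.exp (-(2 * M)) ≤ Real.exp (-(2 * u)) := Real.exp_le_exp.2 (by linarith)
  have h4 : 2 * u * Real.exp (-(2 * M)) ≤ 2 * u * Real.exp (-(2 * u)) := by gcongr
  nlinarith [Real.exp_pos (-(2 * u))]

section est
variable {U U' U'' : ℝ → ℝ} {C₀ : ℝ} {F : ℂ → ℂ} {δ K c : ℝ}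

lemma FD.mid (H : UD U U' U'' C₀) (D : FD U F δ K c) (φ : ℂ → ℂ) (hφ : ∀ z, φ z = Complex.exp (-F z))
    (T : H2 →L[ℂ] H2) (hT : ∀ (a : H2) (z : ℂ), ‖z‖ < 1 → fa (T a) z = fa a (φ z)) :
    ∃ C : ℝ, 0 < C ∧ ∀ (x : H2) (s a r : ℝ), 0 < a → a ≤ s → s ≤ δ → 1 / 2 ≤ r → r < 1 → 1 - r ≤ a / (4 * Real.pi) →
      (∫ θ in a..s, ‖fa (T x) (r * Complex.exp (θ * I))‖ ^ 2) ≤ C / hU U s * ‖x‖ ^ 2 ∧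
      (∫ θ in a..s, ‖fa (T x) (r * Complex.exp ((-θ : ℝ) * I))‖ ^ 2) ≤ C / hU U s * ‖x‖ ^ 2 := by
  have K1 := D.K1
  have K0 : 0 < K := by linarith
  have hp := Real.pi_gt_three
  obtain ⟨C, hC, hmid⟩ := mid_abs K K0.le
  refine ⟨C * K, by positivity, ?_⟩
  intro x s a r ha has hsδ hr hr1 hra
  have hr0 : 0 ≤ r := by linarith
  have d1 := D.d1
  have hs0 := ha.trans_le has
  have hhs : 1 ≤ hU U s := D.h1 s hs0 hsδ
  have hhs0 : 0 < hU U s := by linarith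
  have hha : 0 ≤ hU U a := by linarith [H.h_anti ha has]
  have hUa : 0 < U a := H.pos a ha (by linarith)
  have e0 : C * K / hU U s * ‖x‖ ^ 2 = C / (hU U s / K) * ‖x‖ ^ 2 := by field_simp
  have hu : ∀ θ ∈ Icc a s, U a / K ≤ (Fp F r θ).re ∧ (Fp F r θ).re ≤ K := by
    intro θ hθ
    have h0 : 0 < θ := ha.trans_le hθ.1
    refine ⟨?_, D.uM _ _ hr hr1⟩
    rw [div_le_iff₀ K0]
    have h1 := D.ulow r θ hr hr1 h0 (hθ.2.trans hsδ)
    have h2 : U a ≤ U θ := H.mono ⟨ha.le, by linarith⟩ ⟨h0.le, by linarith [hθ.2]⟩ hθ.1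
    linarith
  have hα : ∀ θ1 θ2, a ≤ θ1 → θ1 ≤ θ2 → θ2 ≤ s → 
      hU U s / K * (θ2 - θ1) ≤ (Fp F r θ1).im - (Fp F r θ2).im ∧
      |(Fp F r θ2).im - (Fp F r θ1).im| ≤ K * hU U a * (θ2 - θ1) ∧ |(Fp F r θ2).im - (Fp F r θ1).im| ≤ 1 := by
    intro θ1 θ2 h1 h12 h2
    have h10 : 0 < θ1 := ha.trans_le h1
    have a1 := D.arcl r θ1 θ2 hr hr1 h10 h12 (h2.trans hsδ) (hra.trans (by gcongr))
    have a2 := D.arc r θ1 θ2 hr hr1 h10 h12 (h2.trans hsδ)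
    have a3 := D.osc θ1 θ2 h10 h12 (h2.trans hsδ)
    have a4 := Complex.abs_im_le_norm (Fp F r θ2 - Fp F r θ1)
    rw [Complex.sub_im] at a4
    have a5 := H.Hh_le h10 h12 (by linarith)
    have a6 : hU U θ1 ≤ hU U a := H.h_anti ha h1
    have a7 : hU U s ≤ hU U θ2 := H.h_anti (by linarith) h2
    have hd : 0 ≤ θ2 - θ1 := by linarith
    refine ⟨?_, ?_, ?_⟩
    · rw [div_mul_eq_mul_div, div_le_iff₀ K0]
      nlinarith
    · refine a4.trans (a2.trans ?_)
      rw [mul_assoc]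
      gcongr
      nlinarith
    · linarith
  have hz : ∀ θ : ℝ, ‖(r : ℂ) * Complex.exp (θ * I)‖ < 1 := fun θ => by rw [norm_rexp hr0]; exact hr1
  rw [e0]
  constructor
  · apply hmid x (fun θ => (Fp F r θ).re) (fun θ => -(Fp F r θ).im) _ a s (U a / K) (hU U s / K) (K * hU U a) has
      (by positivity) (by positivity) (by positivity) hu
    · intro θ1 θ2 h1 h12 h2
      obtain ⟨b1, b2, b3⟩ := hα θ1 θ2 h1 h12 h2
      have e1 : -(Fp F r θ2).im - -(Fp F r θ1).im = -((Fp F r θ2).im - (Fp F r θ1).im) := by ring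
      simp only [e1, abs_neg]
      refine ⟨?_, b2, b3⟩
      rw [abs_sub_comm]
      exact b1.trans (le_abs_self _)
    · left
      intro θ1 h1 θ2 h2 h12
      have b1 := (hα θ1 θ2 h1.1 h12 h2.2).1
      have : 0 ≤ hU U s / K * (θ2 - θ1) := mul_nonneg (by positivity) (by linarith)
      simp only; linarith
    · exact (circle_cont (T x) hr0 hr1).norm.pow 2
    · intro θ hθ
      rw [hT x _ (hz θ), hφ, re_parts]
      rfl
  · apply hmid x (fun θ => (Fp F r θ).re) (fun θ => (Fp F r θ).im) _ a s (U a / K) (hU U s / K) (K * hU U a) has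
      (by positivity) (by positivity) (by positivity) hu
    · intro θ1 θ2 h1 h12 h2
      obtain ⟨b1, b2, b3⟩ := hα θ1 θ2 h1 h12 h2
      refine ⟨?_, b2, b3⟩
      rw [abs_sub_comm]
      exact b1.trans (le_abs_self _)
    · right
      intro θ1 h1 θ2 h2 h12
      have b1 := (hα θ1 θ2 h1.1 h12 h2.2).1
      have : 0 ≤ hU U s / K * (θ2 - θ1) := mul_nonneg (by positivity) (by linarith)
      simp only; linarith
    · exact ((circle_cont (T x) hr0 hr1).comp continuous_neg).norm.pow 2
    · intro θ hθ
      rw [hT x _ (hz (-θ)), hφ, re_parts]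
      have := D.symm r θ hr0 hr1
      unfold Fp at this ⊢
      rw [this]
      simp

lemma FD.phi_lt (D : FD U F δ K c) (φ : ℂ → ℂ) (hφ : ∀ z, φ z = Complex.exp (-F z)) {z : ℂ} (hz : ‖z‖ < 1) : ‖φ z‖ < 1 := by
  rw [hφ, Complex.norm_exp]
  exact Real.exp_lt_one_iff.2 (by simpa using D.upos z hz)

set_option maxHeartbeats 2000000 in
lemma FD.far (H : UD U U' U'' C₀) (D : FD U F δ K c) (φ : ℂ → ℂ) (hφ : ∀ z, φ z = Complex.exp (-F z)) :
    ∃ ρ : ℝ, 0 < ρ ∧ ρ < 1 ∧ ∀ s, 0 < s → s ≤ δ → ∃ l : List ℂ, (∀ a ∈ l, ‖a‖ < 1) ∧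
      (l.length : ℝ) ≤ 2 * (Gg U s - Gg U δ) + 3 ∧ ∃ r0 : ℝ, 1 / 2 ≤ r0 ∧ r0 < 1 ∧ ∀ r θ : ℝ, r0 ≤ r → r < 1 →
      s ≤ |θ| → |θ| ≤ Real.pi → ∃ a ∈ l, ‖bl a (φ (r * Complex.exp (θ * I)))‖ ≤ ρ := by
  have K1 := D.K1
  have K0 : 0 < K := by linarith
  have hp := Real.pi_gt_three
  have d0 := D.d0
  have d1 := D.d1
  have hE0 : 0 < Real.exp C₀ := Real.exp_pos _
  set E := Real.exp C₀ with hE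
  set q : ℝ := K ^ 4 * E * Real.exp (2 * K) ^ 2 with hq
  have hq0 : 0 < q := by positivity
  refine ⟨max (√(q / (1 + q))) (Real.exp (-c)), by positivity, max_lt ?_ ?_, ?_⟩
  · rw [Real.sqrt_lt' one_pos, one_pow, div_lt_one (by positivity)]; linarith
  · exact Real.exp_lt_one_iff.2 (by linarith [D.c0])
  intro s hs hsδ
  obtain ⟨τ, hτ⟩ := D.exists_tau H
  set J : ℕ := ⌊Gg U s - Gg U δ⌋₊ with hJ
  have hGs : 0 ≤ Gg U s - Gg U δ := by
    have := (D.Gg_le_iff H hs hsδ d0 le_rfl).2 hsδ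
    linarith
  have hhs : 1 ≤ hU U s := D.h1 s hs hsδ
  have hUs : 0 < U s := H.pos s hs (by linarith)
  set e0 : ℝ := min (1 / 2) (U s / hU U s) with he0
  have he0p : 0 < e0 := by positivity
  have he01 : e0 ≤ 1 / 2 := min_le_left _ _
  have he02 : e0 * hU U s ≤ U s := by
    have := min_le_right (1 / 2) (U s / hU U s)
    rwa [← he0, le_div_iff₀ (by linarith)] at this
  set r0 := 1 - e0 with hr0
  set w : ℕ → ℂ := fun k => φ (r0 * Complex.exp ((τ k : ℝ) * I)) with hw
  have hr00 : 0 ≤ r0 := by linarith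
  have hr01 : r0 < 1 := by linarith
  have hw1 : ∀ k, ‖w k‖ < 1 := fun k => D.phi_lt φ hφ (by rw [norm_rexp hr00]; exact hr01)
  set l : List ℂ := 0 :: ((List.range (J + 1)).map w ++ (List.range (J + 1)).map (fun k => (starRingEnd ℂ) (w k))) with hl
  -- estimate on the positive side
  have hpos : ∀ r θ : ℝ, r0 ≤ r → r < 1 → s ≤ θ → θ ≤ δ → ∃ k < J + 1, ‖bl (w k) (φ (r * Complex.exp (θ * I)))‖ ≤ √(q / (1 + q)) := by
    intro r θ hr hr1 hθ hθδ
    have hθ0 := hs.trans_le hθ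
    have hGθ : 0 ≤ Gg U θ - Gg U δ := by
      have := (D.Gg_le_iff H hθ0 hθδ d0 le_rfl).2 hθδ
      linarith
    have hGθs : Gg U θ ≤ Gg U s := (D.Gg_le_iff H hs hsδ hθ0 hθδ).2 hθ
    refine ⟨⌊Gg U θ - Gg U δ⌋₊, ?_, ?_⟩
    · rw [hJ]; exact Nat.lt_succ_of_le (Nat.floor_le_floor (by linarith))
    set k := ⌊Gg U θ - Gg U δ⌋₊ with hk
    have hk1 := Nat.floor_le hGθ
    have hk2 := Nat.lt_floor_add_one (Gg U θ - Gg U δ)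
    rw [← hk] at hk1 hk2
    obtain ⟨t0, t1, t2⟩ := hτ k (by positivity)
    set t := τ k with htk
    have htθ : θ ≤ t := by
      rw [← D.Gg_le_iff H hθ0 hθδ t0 t1, t2]; linarith
    have g := D.g123 H hθ0 htθ t1
    have hUt : 0 < U t := H.pos t t0 (by linarith)
    have hUθ : 0 < U θ := H.pos θ hθ0 (by linarith)
    have hGd : Gg U θ - Gg U t ≤ 1 := by rw [t2]; linarith
    have hHt : Hh U t - Hh U θ ≤ U t := g.2.1.trans (by nlinarith)
    have hEU : U t ≤ E * U θ := by
      refine g.2.2.2.trans ?_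
      gcongr
      rw [hE]
      apply Real.exp_le_exp.2
      nlinarith [H.C0]
    have hr12 : 1 / 2 ≤ r := by linarith
    have b1 := D.arc r θ t hr12 hr1 hθ0 htθ t1
    have b2 := D.rad r r0 t hr12 hr1 (by linarith) hr01 t0 t1
    rw [abs_of_nonneg (by linarith)] at b2
    have b3 : K * hU U t * (r - r0) ≤ K * U t := by
      rw [mul_assoc]
      gcongr
      have i1 : hU U t ≤ hU U s := H.h_anti hs (hθ.trans htθ)
      have i2 : U s ≤ U t := H.mono ⟨hs.le, by linarith⟩ ⟨t0.le, by linarith⟩ (hθ.trans htθ)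
      have i3 : hU U t * (r - r0) ≤ hU U s * e0 := mul_le_mul i1 (by linarith) (by linarith) (by linarith)
      linarith
    have hFd : ‖Fp F r θ - Fp F r0 t‖ ≤ 2 * K * U t := by
      have : Fp F r θ - Fp F r0 t = -(Fp F r t - Fp F r θ) + (Fp F r t - Fp F r0 t) := by ring
      rw [this]
      refine (norm_add_le _ _).trans ?_
      rw [norm_neg]
      have : K * (Hh U t - Hh U θ) ≤ K * U t := by gcongr
      linarith
    have hz1 : ‖φ (r * Complex.exp (θ * I))‖ < 1 := D.phi_lt φ hφ (by rw [norm_rexp (by linarith)]; exact hr1)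
    apply bl_up (hw1 k) hz1 hq0.le
    have u1 := D.ulow r θ hr12 hr1 hθ0 hθδ
    have u2 := D.ulow r0 t (by linarith) hr01 t0 t1
    have u3 := D.uM r θ hr12 hr1
    have u4 := D.uM r0 t (by linarith) hr01
    have v1 : 0 < (Fp F r θ).re := pos_of_mul_pos_right (hUθ.trans_le u1) K0.le
    have v2 : 0 < (Fp F r0 t).re := pos_of_mul_pos_right (hUt.trans_le u2) K0.le
    have n1 : ‖φ (r * Complex.exp (θ * I))‖ = Real.exp (-(Fp F r θ).re) := by
      rw [hφ, Complex.norm_exp]; simp [Fp]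
    have n2 : ‖w k‖ = Real.exp (-(Fp F r0 t).re) := by
      simp only [hw]
      rw [hφ, Complex.norm_exp]; simp [Fp, htk]
    have m1 := wt_low u3 v1.le
    have m2 := wt_low u4 v2.le
    rw [n1, n2]
    have hdist : ‖φ (r * Complex.exp (θ * I)) - w k‖ ≤ 2 * K * U t := by
      simp only [hw]
      rw [hφ, hφ]
      refine (exp_lip ?_ ?_).trans hFd
      · exact v1.le
      · exact v2.le
    have hsq : ‖φ (r * Complex.exp (θ * I)) - w k‖ ^ 2 ≤ (2 * K * U t) ^ 2 := by gcongr
    refine hsq.trans ?_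
    have hPl : (2 * (Fp F r0 t).re * Real.exp (-(2 * K))) * (2 * (Fp F r θ).re * Real.exp (-(2 * K))) ≤
        (1 - Real.exp (-(Fp F r0 t).re) ^ 2) * (1 - Real.exp (-(Fp F r θ).re) ^ 2) :=
      mul_le_mul m2 m1 (by positivity) (le_trans (by positivity) m2)
    refine le_trans ?_ (mul_le_mul_of_nonneg_left hPl hq0.le)
    have h8 : Real.exp (2 * K) * Real.exp (-(2 * K)) = 1 := by rw [← Real.exp_add]; simp
    have e : q * ((2 * (Fp F r0 t).re * Real.exp (-(2 * K))) * (2 * (Fp F r θ).re * Real.exp (-(2 * K)))) =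
        4 * K ^ 2 * ((K * (Fp F r0 t).re) * (E * (K * (Fp F r θ).re))) * (Real.exp (2 * K) * Real.exp (-(2 * K))) ^ 2 := by
      rw [hq]; ring
    rw [e, h8]
    have : U t * U t ≤ (K * (Fp F r0 t).re) * (E * (K * (Fp F r θ).re)) := by
      apply mul_le_mul u2 _ hUt.le (by positivity)
      refine hEU.trans ?_
      gcongr
    nlinarith [sq_nonneg K]
  have hlen : (l.length : ℝ) ≤ 2 * (Gg U s - Gg U δ) + 3 := by
    rw [hl]
    simp only [List.length_cons, List.length_append, List.length_map, List.length_range]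
    have := Nat.floor_le hGs
    rw [← hJ] at this
    push_cast
    linarith
  refine ⟨l, ?_, hlen, r0, by linarith, hr01, ?_⟩
  · intro a ha
    rw [hl] at ha
    simp only [List.mem_cons, List.mem_append, List.mem_map] at ha
    rcases ha with rfl | ⟨k, _, rfl⟩ | ⟨k, _, rfl⟩
    · simp
    · exact hw1 k
    · rw [RCLike.norm_conj]; exact hw1 k
  · intro r θ hr hr1 hθ hθπ
    have hr0' : 0 ≤ r := by linarith
    have hr12 : 1 / 2 ≤ r := by linarith
    have hsym : ∀ t : ℝ, φ (r * Complex.exp (((-t : ℝ) : ℂ) * I)) = (starRingEnd ℂ) (φ (r * Complex.exp (t * I))) := by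
      intro t
      have := D.symm r t hr0' hr1
      unfold Fp at this
      rw [hφ, hφ, this, ← Complex.exp_conj, map_neg]
    rcases le_total |θ| δ with hδ | hδ
    · obtain ⟨k, hk, hb⟩ := hpos r |θ| hr hr1 hθ hδ
      rcases abs_choice θ with h | h
      · refine ⟨w k, ?_, ?_⟩
        · simp only [hl, List.mem_cons, List.mem_append, List.mem_map]
          exact Or.inr (Or.inl ⟨k, List.mem_range.2 hk, rfl⟩)
        · rw [h] at hb; exact hb.trans (le_max_left _ _)
      · refine ⟨(starRingEnd ℂ) (w k), ?_, ?_⟩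
        · simp only [hl, List.mem_cons, List.mem_append, List.mem_map]
          exact Or.inr (Or.inr ⟨k, List.mem_range.2 hk, rfl⟩)
        · have : θ = -|θ| := by rw [h]; ring
          rw [this, hsym, bl_conj]
          exact hb.trans (le_max_left _ _)
    · refine ⟨0, by simp [hl], ?_⟩
      have hfar := D.ufar r |θ| hr12 hr1 hδ hθπ
      have hb : ‖bl 0 (φ (r * Complex.exp ((|θ| : ℝ) * I)))‖ ≤ Real.exp (-c) := by
        have : bl 0 (φ (r * Complex.exp ((|θ| : ℝ) * I))) = φ (r * Complex.exp ((|θ| : ℝ) * I)) := by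
          unfold bl; simp
        rw [this, hφ, Complex.norm_exp]
        apply Real.exp_le_exp.2
        unfold Fp at hfar
        simpa using hfar
      rcases abs_choice θ with h | h
      · rw [h] at hb; exact hb.trans (le_max_right _ _)
      · have : θ = -|θ| := by rw [h]; ring
        rw [this, hsym]
        have e : (0 : ℂ) = (starRingEnd ℂ) 0 := by simp
        rw [e, bl_conj]
        exact hb.trans (le_max_right _ _)

end est

lemma split_int (f g : ℝ → ℝ) (hf : Continuous f) (hg : Continuous g) (hg0 : ∀ θ, 0 ≤ g θ) {ε M a s : ℝ} (hε : 0 ≤ ε)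
    (ha : 0 < a) (has : a ≤ s) (hs : s ≤ Real.pi) (h1 : ∀ θ, f θ ≤ g θ)
    (h2 : ∀ θ, s ≤ |θ| → |θ| ≤ Real.pi → f θ ≤ ε * g θ) (h3 : ∀ θ, f θ ≤ M) :
    ∫ θ in (-Real.pi)..Real.pi, f θ ≤ ε * (∫ θ in (-Real.pi)..Real.pi, g θ) + (∫ θ in a..s, g θ) +
      (∫ θ in a..s, g (-θ)) + 2 * a * M := by
  have fi : ∀ p q, IntervalIntegrable f volume p q := fun p q => hf.intervalIntegrable p q
  have gi : ∀ p q, IntervalIntegrable g volume p q := fun p q => hg.intervalIntegrable p q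
  have e1 : ∫ θ in (-Real.pi)..Real.pi, f θ = (∫ θ in (-Real.pi)..(-s), f θ) + (∫ θ in (-s)..(-a), f θ) +
      (∫ θ in (-a)..a, f θ) + (∫ θ in a..s, f θ) + (∫ θ in s..Real.pi, f θ) := by
    rw [intervalIntegral.integral_add_adjacent_intervals (fi _ _) (fi _ _),
      intervalIntegral.integral_add_adjacent_intervals (fi _ _) (fi _ _),
      intervalIntegral.integral_add_adjacent_intervals (fi _ _) (fi _ _),
      intervalIntegral.integral_add_adjacent_intervals (fi _ _) (fi _ _)]
  have e2 : ∫ θ in (-Real.pi)..Real.pi, g θ = (∫ θ in (-Real.pi)..(-s), g θ) + (∫ θ in (-s)..s, g θ) +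
      (∫ θ in s..Real.pi, g θ) := by
    rw [intervalIntegral.integral_add_adjacent_intervals (gi _ _) (gi _ _),
      intervalIntegral.integral_add_adjacent_intervals (gi _ _) (gi _ _)]
  have i1 : ∫ θ in (-Real.pi)..(-s), f θ ≤ ε * ∫ θ in (-Real.pi)..(-s), g θ := by
    rw [← intervalIntegral.integral_const_mul]
    apply intervalIntegral.integral_mono_on (by linarith) (fi _ _) ((gi _ _).const_mul _)
    intro θ hθ
    have : |θ| = -θ := abs_of_nonpos (by linarith [hθ.2])
    exact h2 θ (by rw [this]; linarith [hθ.2]) (by rw [this]; linarith [hθ.1])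
  have i5 : ∫ θ in s..Real.pi, f θ ≤ ε * ∫ θ in s..Real.pi, g θ := by
    rw [← intervalIntegral.integral_const_mul]
    apply intervalIntegral.integral_mono_on (by linarith) (fi _ _) ((gi _ _).const_mul _)
    intro θ hθ
    have : |θ| = θ := abs_of_nonneg (by linarith [hθ.1])
    exact h2 θ (by rw [this]; linarith [hθ.1]) (by rw [this]; linarith [hθ.2])
  have i2 : ∫ θ in (-s)..(-a), f θ ≤ ∫ θ in a..s, g (-θ) := by
    rw [intervalIntegral.integral_comp_neg]
    exact intervalIntegral.integral_mono_on (by linarith) (fi _ _) (gi _ _) fun θ _ => h1 θ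
  have i4 : ∫ θ in a..s, f θ ≤ ∫ θ in a..s, g θ :=
    intervalIntegral.integral_mono_on (by linarith) (fi _ _) (gi _ _) fun θ _ => h1 θ
  have i3 : ∫ θ in (-a)..a, f θ ≤ 2 * a * M := by
    have := intervalIntegral.integral_mono_on (a := -a) (b := a) (by linarith) (fi _ _)
      (continuous_const.intervalIntegrable _ _ : IntervalIntegrable (fun _ : ℝ => M) volume (-a) a) fun θ _ => h3 θ
    rw [intervalIntegral.integral_const, smul_eq_mul] at this
    linarith
  have i6 : 0 ≤ ε * ∫ θ in (-s)..s, g θ :=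
    mul_nonneg hε (intervalIntegral.integral_nonneg (by linarith) fun θ _ => hg0 θ)
  rw [e1, e2]
  linarith

lemma prod_le_one (l : List ℂ) (hl : ∀ a ∈ l, ‖a‖ < 1) {z : ℂ} (hz : ‖z‖ < 1) :
    ‖(l.map (fun a => bl a z)).prod‖ ≤ 1 := by
  induction l with
  | nil => simp
  | cons b l ih =>
    rw [List.map_cons, List.prod_cons, norm_mul]
    exact mul_le_one₀ (bl_le_one (hl b (by simp)) hz) (norm_nonneg _) (ih fun a ha => hl a (by simp [ha]))

lemma prod_le_rho (l : List ℂ) (hl : ∀ a ∈ l, ‖a‖ < 1) {z : ℂ} (hz : ‖z‖ < 1) {ρ : ℝ} (h : ∃ a ∈ l, ‖bl a z‖ ≤ ρ) :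
    ‖(l.map (fun a => bl a z)).prod‖ ≤ ρ := by
  obtain ⟨a, ha, hρ⟩ := h
  induction l with
  | nil => simp at ha
  | cons b l ih =>
    rw [List.map_cons, List.prod_cons, norm_mul]
    rcases List.mem_cons.1 ha with rfl | ha
    · exact (mul_le_of_le_one_right (norm_nonneg _) (prod_le_one l (fun a ha => hl a (by simp [ha])) hz)).trans hρ
    · exact (mul_le_of_le_one_left (norm_nonneg _) (bl_le_one (hl b (by simp)) hz)).trans (ih (fun a ha => hl a (by simp [ha])) ha)

lemma prod_rep (l : List ℂ) (m : ℕ) (z : ℂ) :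
    (((List.replicate m l).flatten).map (fun a => bl a z)).prod = (l.map (fun a => bl a z)).prod ^ m := by
  induction m with
  | zero => simp
  | succ m ih => rw [List.replicate_succ, List.flatten_cons, List.map_append, List.prod_append, ih, pow_succ']

section est
variable {U U' U'' : ℝ → ℝ} {C₀ : ℝ} {F : ℂ → ℂ} {δ K c : ℝ}

lemma FD.upper_core (H : UD U U' U'' C₀) (D : FD U F δ K c) (φ : ℂ → ℂ) (hφ : ∀ z, φ z = Complex.exp (-F z))
    (T : H2 →L[ℂ] H2) (hT : ∀ (a : H2) (z : ℂ), ‖z‖ < 1 → fa (T a) z = fa a (φ z)) :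
    ∃ ρ C : ℝ, 0 < ρ ∧ ρ < 1 ∧ 0 < C ∧ ∀ (s : ℝ) (m n : ℕ), 0 < s → s ≤ δ → ρ ^ (2 * m) ≤ 1 / hU U s →
      m * (2 * (Gg U s - Gg U δ) + 3) ≤ (n : ℝ) - 1 → approxNum T n ≤ √(C / hU U s) := by
  obtain ⟨Cm, hCm, hmid⟩ := D.mid H φ hφ T hT
  obtain ⟨ρ, hρ0, hρ1, hfar⟩ := D.far H φ hφ
  have hpi := Real.pi_pos
  refine ⟨ρ, ‖T‖ ^ 2 + Cm / Real.pi, hρ0, hρ1, by positivity, ?_⟩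
  intro s m n hs hsδ hm hcount
  have hd1 := D.d1
  have hpi3 := Real.pi_gt_three
  have hh : 1 ≤ hU U s := D.h1 s hs hsδ
  obtain ⟨l, hl, hlen, r0, hr12, hr01, hfl⟩ := hfar s hs hsδ
  apply approxNum_le_blaschke_bdd T n ((List.replicate m l).flatten)
  · intro a ha
    obtain ⟨l', hl', ha'⟩ := List.mem_flatten.1 ha
    rw [List.eq_of_mem_replicate hl'] at ha'
    exact hl a ha'
  · have e : ((List.replicate m l).flatten).length = m * l.length := by
      simp
    rw [e]
    have : ((m * l.length : ℕ) : ℝ) + 1 ≤ n := by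
      push_cast
      have : (m : ℝ) * l.length ≤ m * (2 * (Gg U s - Gg U δ) + 3) := by gcongr
      linarith
    have : m * l.length + 1 ≤ n := by exact_mod_cast this
    omega
  · positivity
  intro y x ⟨B, hB⟩ hyx
  have hTy : ∀ z, ‖z‖ < 1 → fa (T y) z = ((l.map (fun a => bl a (φ z))).prod) ^ m * fa (T x) z := by
    intro z hz
    rw [hT y z hz, hT x z hz, hyx _ (D.phi_lt φ hφ hz), prod_rep]
  have key : ∀ a, 0 < a → a ≤ s → ‖T y‖ ^ 2 ≤ (‖T‖ ^ 2 + Cm / Real.pi) / hU U s * ‖x‖ ^ 2 + a * (B ^ 2 / Real.pi) := by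
    intro a ha has
    have h4 : a / (4 * Real.pi) ≤ 1 / 2 := by
      rw [div_le_iff₀ (by positivity)]; nlinarith
    have h5 : 0 < a / (4 * Real.pi) := by positivity
    apply norm_sq_le_of_mean (T y) _ (max r0 (1 - a / (4 * Real.pi)))
      (le_trans (by linarith) (le_max_left _ _)) (max_lt hr01 (by linarith))
    intro r hr hr1
    have hrr0 : r0 ≤ r := (le_max_left _ _).trans hr
    have hra : 1 - a / (4 * Real.pi) ≤ r := (le_max_right _ _).trans hr
    have hr0 : 0 ≤ r := by linarith
    have hz : ∀ θ : ℝ, ‖(r : ℂ) * Complex.exp (θ * I)‖ < 1 := fun θ => by rw [norm_rexp hr0]; exact hr1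
    have hpr : ∀ θ : ℝ, ‖(l.map (fun a => bl a (φ (r * Complex.exp (θ * I))))).prod‖ ≤ 1 := fun θ =>
      prod_le_one l hl (D.phi_lt φ hφ (hz θ))
    have hle : ∀ θ : ℝ, ‖fa (T y) (r * Complex.exp (θ * I))‖ ≤ ‖fa (T x) (r * Complex.exp (θ * I))‖ := fun θ => by
      rw [hTy _ (hz θ), norm_mul, norm_pow]
      exact mul_le_of_le_one_left (norm_nonneg _) (pow_le_one₀ (norm_nonneg _) (hpr θ))
    have hsp := split_int (fun θ : ℝ => ‖fa (T y) (r * Complex.exp (θ * I))‖ ^ 2)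
      (fun θ : ℝ => ‖fa (T x) (r * Complex.exp (θ * I))‖ ^ 2)
      ((circle_cont (T y) hr0 hr1).norm.pow 2) ((circle_cont (T x) hr0 hr1).norm.pow 2) (fun θ => by positivity)
      (ε := 1 / hU U s) (M := B ^ 2) (a := a) (s := s) (by positivity) ha has (by linarith)
      (fun θ => by have := hle θ; gcongr)
      (fun θ h1 h2 => by
        obtain hb := prod_le_rho l hl (D.phi_lt φ hφ (hz θ)) (hfl r θ hrr0 hr1 h1 h2)
        rw [hTy _ (hz θ), norm_mul, norm_pow, mul_pow]
        apply mul_le_mul_of_nonneg_right _ (sq_nonneg _)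
        refine le_trans ?_ hm
        rw [← pow_mul, mul_comm m 2]
        exact pow_le_pow_left₀ (norm_nonneg _) hb _)
      (fun θ => by
        have h1 : ‖fa (T x) (r * Complex.exp (θ * I))‖ ≤ B := by
          rw [hT x _ (hz θ)]; exact hB _ (D.phi_lt φ hφ (hz θ))
        have h2 := (hle θ).trans h1
        gcongr)
    obtain ⟨m1, m2⟩ := hmid x s a r ha has hsδ (by linarith) hr1 (by linarith)
    have m3 := mean_le (T x) hr0 hr1
    have hTx : ‖T x‖ ^ 2 ≤ ‖T‖ ^ 2 * ‖x‖ ^ 2 := by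
      rw [← mul_pow]
      have := T.le_opNorm x
      gcongr
    have m4 : 1 / hU U s * (∫ θ in (-Real.pi)..Real.pi, ‖fa (T x) (r * Complex.exp (θ * I))‖ ^ 2) ≤
        1 / hU U s * (2 * Real.pi * (‖T‖ ^ 2 * ‖x‖ ^ 2)) := by
      apply mul_le_mul_of_nonneg_left _ (by positivity)
      refine m3.trans ?_
      gcongr
    have e : 2 * Real.pi * ((‖T‖ ^ 2 + Cm / Real.pi) / hU U s * ‖x‖ ^ 2 + a * (B ^ 2 / Real.pi)) =
        1 / hU U s * (2 * Real.pi * (‖T‖ ^ 2 * ‖x‖ ^ 2)) + Cm / hU U s * ‖x‖ ^ 2 + Cm / hU U s * ‖x‖ ^ 2 + 2 * a * B ^ 2 := by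
      field_simp
      ring
    rw [e]
    refine hsp.trans ?_
    linarith
  have hlim : ‖T y‖ ^ 2 ≤ (‖T‖ ^ 2 + Cm / Real.pi) / hU U s * ‖x‖ ^ 2 := by
    have ht : Tendsto (fun a : ℝ => (‖T‖ ^ 2 + Cm / Real.pi) / hU U s * ‖x‖ ^ 2 + a * (B ^ 2 / Real.pi))
        (nhdsWithin 0 (Set.Ioi 0)) (nhds ((‖T‖ ^ 2 + Cm / Real.pi) / hU U s * ‖x‖ ^ 2 + 0 * (B ^ 2 / Real.pi))) := by
      apply Tendsto.mono_left _ nhdsWithin_le_nhds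
      apply Continuous.tendsto
      fun_prop
    rw [zero_mul, add_zero] at ht
    apply ge_of_tendsto ht
    filter_upwards [Ioc_mem_nhdsGT hs] with a ha
    exact key a ha.1 ha.2
  apply le_of_sq_le_sq _ (by positivity)
  rw [mul_pow, Real.sq_sqrt (by positivity)]
  exact hlim

lemma UD.h1_pos (H : UD U U' U'' C₀) : 0 < hU U 1 := by
  have hpi3 := Real.pi_gt_three
  apply intervalIntegral.intervalIntegral_pos_of_pos_on
  · apply ContinuousOn.intervalIntegrable
    apply ContinuousOn.div H.cont.continuousOn (by fun_prop)
    intro x hx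
    rw [uIcc_of_le (by linarith)] at hx
    have : 0 < x := by linarith [hx.1]
    positivity
  · intro x hx
    have h0 : 0 < x := by linarith [hx.1]
    have := H.pos x h0 hx.2.le
    positivity
  · linarith

lemma UD.Gg_nonneg (H : UD U U' U'' C₀) {a : ℝ} (ha : 0 < a) (ha1 : a ≤ 1) : 0 ≤ Gg U a := by
  have hpi3 := Real.pi_gt_three
  apply intervalIntegral.integral_nonneg ha1
  intro x hx
  have h0 : 0 < x := ha.trans_le hx.1
  exact div_nonneg (H.h_nonneg h0 (by linarith [hx.2])) (H.pos x h0 (by linarith [hx.2])).le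

lemma UD.Gg_anti (H : UD U U' U'' C₀) {a b : ℝ} (ha : 0 < a) (hab : a ≤ b) (hb1 : b ≤ 1) : Gg U b ≤ Gg U a := by
  have hpi3 := Real.pi_gt_three
  have e : Gg U a = (∫ x in a..b, hU U x / U x) + Gg U b := by
    unfold Gg
    rw [intervalIntegral.integral_add_adjacent_intervals]
    · exact H.hdU_ii ha (ha.trans_le hab) (by linarith) (by linarith)
    · exact H.hdU_ii (ha.trans_le hab) one_pos (by linarith) (by linarith)
  have : 0 ≤ ∫ x in a..b, hU U x / U x := by
    apply intervalIntegral.integral_nonneg hab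
    intro x hx
    have h0 : 0 < x := ha.trans_le hx.1
    exact div_nonneg (H.h_nonneg h0 (by linarith [hx.2])) (H.pos x h0 (by linarith [hx.2])).le
  linarith

lemma FD.upper_final (H : UD U U' U'' C₀) (D : FD U F δ K c) (φ : ℂ → ℂ) (hφ : ∀ z, φ z = Complex.exp (-F z))
    (T : H2 →L[ℂ] H2) (hT : ∀ (a : H2) (z : ℂ), ‖z‖ < 1 → fa (T a) z = fa a (φ z))
    (γinv : ℝ → ℝ) (hγinv : ∀ y : ℝ, 0 ≤ y → γinv y ∈ Set.Ioc (0 : ℝ) 1 ∧ gammaU U (γinv y) = y) :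
    ∃ C C₁ : ℝ, 0 < C ∧ 0 < C₁ ∧ ∃ N : ℕ, ∀ n : ℕ, N ≤ n →
      approxNum T n ≤ C₁ * (hU U (γinv (C * n))) ^ (-(1 : ℝ) / 2) := by
  obtain ⟨ρ, C2, hρ0, hρ1, hC2, hcore⟩ := D.upper_core H φ hφ T hT
  obtain ⟨s0, hs0, hs0δ, hgood⟩ := D.good H
  have d0 := D.d0
  have d1 := D.d1
  have hlr : 0 < -Real.log ρ := by linarith [Real.log_neg hρ0 hρ1]
  set A : ℝ := 1 / (2 * (-Real.log ρ)) + 1 with hA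
  have hA0 : 0 < A := by positivity
  set C : ℝ := 1 / (20 * A) with hC
  have hC0 : 0 < C := by positivity
  set M0 : ℝ := Gg U s0 * (Real.log (hU U s0) - Real.log (hU U 1)) with hM0
  refine ⟨C, √C2, hC0, by positivity, max 2 (⌈M0 / C⌉₊ + 1), fun n hn => ?_⟩
  have hn2 : 2 ≤ n := (le_max_left _ _).trans hn
  have hn2' : (2 : ℝ) ≤ n := by exact_mod_cast hn2
  have hnM : M0 < C * n := by
    have h1 : ⌈M0 / C⌉₊ + 1 ≤ n := (le_max_right _ _).trans hn
    have h2 : ((⌈M0 / C⌉₊ : ℝ)) + 1 ≤ n := by exact_mod_cast h1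
    have h3 := Nat.le_ceil (M0 / C)
    have h4 : M0 / C < n := by linarith
    rw [div_lt_iff₀ hC0] at h4
    linarith
  obtain ⟨⟨hsp, hs1⟩, hγ⟩ := hγinv (C * n) (by positivity)
  set s := γinv (C * n) with hs
  have hh1 := H.h1_pos
  have hss0 : s ≤ s0 := by
    by_contra hcon
    push Not at hcon
    have : gammaU U s ≤ M0 := by
      change Gg U s * (Real.log (hU U s) - Real.log (hU U 1)) ≤ _
      have i1 := H.Gg_anti hs0 hcon.le hs1
      have i2 := H.Gg_nonneg hs0 (by linarith)
      have i3 : hU U 1 ≤ hU U s := H.h_anti hsp hs1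
      have i4 : hU U s ≤ hU U s0 := H.h_anti hs0 hcon.le
      have i5 := Real.log_le_log hh1 i3
      have i6 := Real.log_le_log (hh1.trans_le i3) i4
      exact mul_le_mul i1 (by linarith) (by linarith) i2
    linarith
  obtain ⟨g1, g2, g3, g4, g5⟩ := hgood s hsp hss0
  have hsδ := hss0.trans hs0δ
  have hhs : 1 ≤ hU U s := D.h1 s hsp hsδ
  set m : ℕ := ⌈Real.log (hU U s) / (2 * (-Real.log ρ))⌉₊ with hm
  have hm1 := Nat.le_ceil (Real.log (hU U s) / (2 * (-Real.log ρ)))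
  have hm2 := Nat.ceil_lt_add_one (a := Real.log (hU U s) / (2 * (-Real.log ρ))) (by positivity)
  rw [← hm] at hm1 hm2
  have hmA : (m : ℝ) ≤ A * Real.log (hU U s) := by
    rw [hA, add_mul, one_mul]
    have : Real.log (hU U s) / (2 * (-Real.log ρ)) = 1 / (2 * (-Real.log ρ)) * Real.log (hU U s) := by ring
    linarith
  have hc := hcore s m n hsp hsδ ?_ ?_
  · refine hc.trans (le_of_eq ?_)
    rw [Real.sqrt_div hC2.le, neg_div, Real.rpow_neg (by linarith), ← Real.sqrt_eq_rpow, div_eq_mul_inv]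
  · rw [← Real.log_le_log_iff (by positivity) (by positivity), Real.log_pow, one_div, Real.log_inv]
    rw [div_le_iff₀ (by positivity)] at hm1
    push_cast
    linarith
  · have hGδ := H.Gg_nonneg d0 d1
    have hγ' : Gg U s * (Real.log (hU U s) - Real.log (hU U 1)) = C * n := hγ
    have j1 : (m : ℝ) * (2 * (Gg U s - Gg U δ) + 3) ≤ (A * Real.log (hU U s)) * (5 * Gg U s) :=
      mul_le_mul hmA (by linarith) (by linarith) (by positivity)
    have j2 : Gg U s * (Real.log (hU U s) / 2) ≤ C * n := by
      rw [← hγ']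
      exact mul_le_mul_of_nonneg_left g4 (by linarith)
    have j3 : (A * Real.log (hU U s)) * (5 * Gg U s) = 10 * A * (Gg U s * (Real.log (hU U s) / 2)) := by ring
    have j4 : 10 * A * (C * n) = n / 2 := by
      rw [hC]; field_simp; norm_num
    have j5 := mul_le_mul_of_nonneg_left j2 (by positivity : 0 ≤ 10 * A)
    linarith

end est

theorem stmt6 (U U' U'' : ℝ → ℝ) (hU_mem : ClassU U)
    (hderiv1 : ∀ t ∈ Set.Ioc (0 : ℝ) Real.pi, HasDerivAt U (U' t) t)
    (hderiv2 : ∀ t ∈ Set.Ioc (0 : ℝ) Real.pi, HasDerivAt U' (U'' t) t)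
    (hcont2 : ContinuousOn U'' (Set.Ioc 0 Real.pi))
    (hU'pi : U' Real.pi = 0)
    (hlittleo : Tendsto (fun t => (U t / t) / Real.log (hU U t))
      (nhdsWithin 0 (Set.Ioi 0)) (nhds 0))
    (C₀ : ℝ) (hC₀ : 0 < C₀)
    (hbound : ∀ t : ℝ, 0 < t → t ≤ Real.pi / 2 →
      t * U' t ≤ C₀ * U t ∧ t ^ 2 * |U'' t| ≤ C₀ * U t)
    (γinv : ℝ → ℝ)
    (hγinv : ∀ y : ℝ, 0 ≤ y → γinv y ∈ Set.Ioc (0 : ℝ) 1 ∧ gammaU U (γinv y) = y)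
    (F : ℂ → ℂ) (hF : DifferentiableOn ℂ F (Metric.ball 0 1))
    (hFre : ∀ r θ : ℝ, 0 ≤ r → r < 1 →
      (F ((r : ℂ) * Complex.exp (θ * Complex.I))).re = poisson U r θ)
    (hFim : (F 0).im = 0)
    (φ : ℂ → ℂ) (hφ : ∀ z, φ z = Complex.exp (-F z))
    (T : H2 →L[ℂ] H2)
    (hT : ∀ (a : H2) (z : ℂ), ‖z‖ < 1 → fa (T a) z = fa a (φ z)) :
    ∃ c C c₁ C₁ : ℝ, 0 < c ∧ 0 < C ∧ 0 < c₁ ∧ 0 < C₁ ∧ ∃ N : ℕ, ∀ n : ℕ, N ≤ n →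
      c₁ * (hU U (Real.exp (-Real.sqrt n))) ^
          (-(1 / 2 + c * n / gammaU U (Real.exp (-Real.sqrt n)))) ≤ approxNum T n ∧
      approxNum T n ≤ C₁ * (hU U (γinv (C * n))) ^ (-(1 : ℝ) / 2) := by
  obtain ⟨h1, h2, h3, h4, h5, h6, h7⟩ := hU_mem
  have H : UD U U' U'' C₀ := ⟨h1, h2, h3, h4, h5, h6, h7, hderiv1, hderiv2, hlittleo, hC₀, hbound⟩
  obtain ⟨δ, K, c', D⟩ := H.toFD F hF hFre hFim
  obtain ⟨c, c₁, hc, hc₁, N1, hN1⟩ := D.lower_final H φ hφ T hT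
  obtain ⟨C, C₁, hC, hC₁, N2, hN2⟩ := D.upper_final H φ hφ T hT γinv hγinv
  exact ⟨c, C, c₁, C₁, hc, hC, hc₁, hC₁, max N1 N2, fun n hn =>
    ⟨hN1 n ((le_max_left _ _).trans hn), hN2 n ((le_max_right _ _).trans hn)⟩⟩

end
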